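/- Let m = p + q and 0 < k ≤ p, and let (X_1, ..., X_p, F_1, ..., F_q) be a complex analytic integrable system of type (p, q) on an open neighborhood U of 0 in ℂ^m such that: X_{p−k+j}(x) = e_j (the j-th constant coordinate vector field) for j = 1, ..., k; all X_i and F_j are independent of the coordinates x_1, ..., x_k; X_1(0) = ... = X_{p−k}(0) = 0; and the reduced system of type (p−k, q) on ℂ^{m−k} obtained by regarding X_1, ..., X_{p−k} and F_1, ..., F_q as functions of the last m−k coordinates has a nondegenerate fixed point at 0, i.e. the induced matrices A_i ∈ M_{m−k}(ℂ) (the linear parts at 0 of the reduced vector fields) are semisimple, the vectors A_1 z, ..., A_{p−k} z are linearly independent for z in a dense subset of ℂ^{m−k}, and the lowest-degree nonzero homogeneous Taylor terms G_j of F_j have linearly independent differentials on a dense subset of ℂ^{m−k}. Then there exist a neighborhood V of 0, an analytic diffeomorphism φ : V → W ⊆ ℂ^m with φ(0) = 0, and analytic functions f_{ij} (1 ≤ i, j ≤ p) on W with det(f_{ij}(y)) ≠ 0 everywhere, each f_{ij} being a common first integral of the model vector fields Ŷ_1, ..., Ŷ_p, such that Dφ(x)(X_i(x)) = Σ_{j=1}^p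 f_{ij}(φ(x)) · Ŷ_j(φ(x)) for all x ∈ V and all i, where Ŷ_j(y) = A_j applied to the last m−k coordinates of y (viewed in ℂ^m, with zero first k components) for j ≤ p−k, and Ŷ_{p−k+j}(y) = e_j for j = 1, ..., k. (Every nondegenerate singular point of an analytic integrable system is locally geometrically equivalent to the direct product of a nondegenerate linear integrable system and a constant regular system.) -/

import Mathlib

open scoped BigOperators

/-- A complex square matrix is semisimple iff it is diagonalizable (over ℂ). -/
def IsSemisimpleMatrixC {m : ℕ} (A : Matrix (Fin m) (Fin m) ℂ) : Prop :=
  ∃ P : Matrix (Fin m) (Fin m) ℂ, IsUnit P ∧ ∃ d : Fin m → ℂ,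
    A = P * Matrix.diagonal d * P⁻¹

/-- The embedding of ℂ^{m-k} into ℂ^m as the last m-k coordinates
(first k coordinates set to 0). -/
def embLast (m k : ℕ) (z : Fin (m - k) → ℂ) : Fin m → ℂ :=
  fun l => if h : (l : ℕ) < k then 0 else z ⟨(l : ℕ) - k, by have := l.isLt; omega⟩

/-- The model vector fields: for `j < p - k`, the linear vector field given by `A j`
acting on the last `m - k` coordinates (with zero first `k` components); for
`j ≥ p - k`, the constant coordinate vector field `e_{j-(p-k)}`. -/
noncomputable def modelYhat (m k p : ℕ) (hpm : p ≤ m)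
    (A : Fin (p - k) → Matrix (Fin (m - k)) (Fin (m - k)) ℂ)
    (j : Fin p) (y : Fin m → ℂ) : Fin m → ℂ :=
  if hj : (j : ℕ) < p - k then
    fun l => if hl : (l : ℕ) < k then 0
      else ∑ s : Fin (m - k),
        A ⟨(j : ℕ), hj⟩ ⟨(l : ℕ) - k, by have := l.isLt; omega⟩ s *
          y ⟨k + (s : ℕ), by have := s.isLt; omega⟩
  else
    Pi.single (⟨(j : ℕ) - (p - k), by have := j.isLt; omega⟩ : Fin m) 1

namespace GeoLin
open MvPowerSeries Filter Topology

/-- absolutely summable power series -/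
noncomputable def Alg (n : ℕ) : Subalgebra ℂ (MvPowerSeries (Fin n) ℂ) where
  carrier := {a | Summable fun α => ‖coeff α a‖}
  mul_mem' := by
    intro a b ha hb
    simp only [Set.mem_ofPred_eq] at *
    have h := summable_sum_mul_antidiagonal_of_summable_mul
      (f := fun α => ‖coeff α a‖) (g := fun α => ‖coeff α b‖)
      (ha.mul_of_nonneg hb (fun _ => norm_nonneg _) (fun _ => norm_nonneg _))
    refine Summable.of_nonneg_of_le (fun _ => norm_nonneg _) (fun α => ?_) h
    rw [coeff_mul]
    exact (norm_sum_le _ _).trans (Finset.sum_le_sum fun _ _ => norm_mul_le _ _)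
  add_mem' := by
    intro a b ha hb
    simp only [Set.mem_ofPred_eq] at *
    refine Summable.of_nonneg_of_le (fun _ => norm_nonneg _) (fun α => ?_) (ha.add hb)
    rw [map_add]
    exact norm_add_le _ _
  algebraMap_mem' := by
    intro c
    simp only [Set.mem_ofPred_eq]
    refine summable_of_ne_finset_zero (s := {0}) (fun α hα => ?_)
    rw [← MvPowerSeries.c_eq_algebraMap, coeff_C, if_neg (by simpa using hα), norm_zero]

abbrev W (n : ℕ) := ↥(Alg n)

variable {n : ℕ}

/-- coefficient -/
noncomputable def co (a : W n) (α : Fin n →₀ ℕ) : ℂ := coeff α a.1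

theorem co_summable (a : W n) : Summable fun α => ‖co a α‖ := a.2

theorem W_ext {a b : W n} (h : ∀ α, co a α = co b α) : a = b :=
  Subtype.ext (MvPowerSeries.ext h)

/-- constructor -/
noncomputable def mk (c : (Fin n →₀ ℕ) → ℂ) (h : Summable fun α => ‖c α‖) : W n := ⟨c, h⟩

@[simp] theorem co_mk (c : (Fin n →₀ ℕ) → ℂ) (h) (α) : co (mk c h) α = c α := rfl
@[simp] theorem co_add (a b : W n) (α) : co (a + b) α = co a α + co b α := rfl
@[simp] theorem co_sub (a b : W n) (α) : co (a - b) α = co a α - co b α := rfl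
@[simp] theorem co_neg (a : W n) (α) : co (-a) α = - co a α := rfl
@[simp] theorem co_zero (α) : co (0 : W n) α = 0 := rfl
@[simp] theorem co_smul (c : ℂ) (a : W n) (α) : co (c • a) α = c * co a α := rfl
theorem co_one (α) : co (1 : W n) α = if α = 0 then 1 else 0 := by
  classical
  exact (coeff_one (R := ℂ) α).trans (by congr)
theorem co_mul (a b : W n) (α) :
    co (a * b) α = ∑ x ∈ Finset.HasAntidiagonal.antidiagonal α, co a x.1 * co b x.2 := by
  exact coeff_mul α a.1 b.1

noncomputable def wnorm : AddGroupNorm (W n) where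
  toFun a := ∑' α, ‖co a α‖
  map_zero' := by simp
  add_le' a b := by
    rw [← (co_summable a).tsum_add (co_summable b)]
    exact (co_summable (a + b)).tsum_le_tsum (fun α => norm_add_le _ _)
      ((co_summable a).add (co_summable b))
  neg' a := by simp
  eq_zero_of_map_eq_zero' a h := by
    have := (hasSum_zero_iff_of_nonneg (fun α => norm_nonneg (co a α))).1
      (h ▸ (co_summable a).hasSum)
    exact W_ext fun α => by simpa using congrFun this α

noncomputable instance : NormedAddCommGroup (W n) := (wnorm (n := n)).toNormedAddCommGroup

theorem norm_def (a : W n) : ‖a‖ = ∑' α, ‖co a α‖ := rfl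

theorem co_le (a : W n) (α) : ‖co a α‖ ≤ ‖a‖ :=
  (co_summable a).le_tsum α (fun _ _ => norm_nonneg _)

theorem wnorm_mul_le (a b : W n) : ‖a * b‖ ≤ ‖a‖ * ‖b‖ := by
  have hm : Summable fun x : (Fin n →₀ ℕ) × (Fin n →₀ ℕ) => ‖co a x.1‖ * ‖co b x.2‖ :=
    (co_summable a).mul_of_nonneg (co_summable b) (fun _ => norm_nonneg _)
    (fun _ => norm_nonneg _)
  have h := summable_sum_mul_antidiagonal_of_summable_mul
    (f := fun α => ‖co a α‖) (g := fun α => ‖co b α‖) hm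
  have e : ‖a‖ * ‖b‖ = _ :=
    (co_summable a).tsum_mul_tsum_eq_tsum_sum_antidiagonal (co_summable b) hm
  rw [e]
  refine (co_summable (a * b)).tsum_le_tsum (fun α => ?_) h
  rw [co_mul]
  exact (norm_sum_le _ _).trans (Finset.sum_le_sum fun _ _ => norm_mul_le _ _)

noncomputable instance : NormedCommRing (W n) where
  dist_eq := fun _ _ => rfl
  norm_mul_le := wnorm_mul_le
  mul_comm := mul_comm

noncomputable instance : NormedAlgebra ℂ (W n) where
  norm_smul_le c a := by
    rw [norm_def, norm_def, ← tsum_mul_left]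
    simp

instance : NormOneClass (W n) := ⟨by
  rw [norm_def, tsum_eq_single 0]
  · simp [co_one]
  · intro α h; simp [co_one, h]⟩

noncomputable def toLp : W n ≃ₗᵢ[ℂ] lp (fun _ : (Fin n →₀ ℕ) => ℂ) 1 where
  toFun a := ⟨co a, memℓp_gen (by simpa using co_summable a)⟩
  map_add' a b := rfl
  map_smul' a b := rfl
  invFun f := mk f (by simpa using (lp.memℓp f).summable (by simp))
  left_inv a := rfl
  right_inv f := rfl
  norm_map' a := by
    rw [lp.norm_eq_tsum_rpow (by simp), norm_def]
    simp only [ENNReal.toReal_one, Real.rpow_one, div_one]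
    rfl

instance : CompleteSpace (W n) :=
  (completeSpace_congr (e := (toLp (n := n)).toLinearEquiv.toEquiv)
    (toLp (n := n)).isometry.isUniformEmbedding).2 inferInstance

/-- coefficient as continuous linear functional -/
noncomputable def coL (α : Fin n →₀ ℕ) : W n →L[ℂ] ℂ :=
  LinearMap.mkContinuous ⟨⟨fun a => co a α, fun _ _ => rfl⟩, fun _ _ => rfl⟩ 1
    (fun a => by rw [one_mul]; exact co_le a α)

@[simp] theorem coL_apply (α : Fin n →₀ ℕ) (a : W n) : coL α a = co a α := rfl

/-- multiplier operator -/
noncomputable def mult (μ : (Fin n →₀ ℕ) → ℂ) (C : ℝ) (h : ∀ α, ‖μ α‖ ≤ C) : W n →L[ℂ] W n :=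
  LinearMap.mkContinuous
    { toFun := fun a => mk (fun α => μ α * co a α) (Summable.of_nonneg_of_le
        (fun _ => norm_nonneg _) (fun α => by
          rw [norm_mul]; exact mul_le_mul_of_nonneg_right (h α) (norm_nonneg _))
        ((co_summable a).mul_left C))
      map_add' := fun a b => W_ext fun α => by simp [mul_add]
      map_smul' := fun c b => W_ext fun α => by simp; ring } C
    (fun a => by
      rw [norm_def, norm_def, ← tsum_mul_left]
      refine (co_summable _).tsum_le_tsum (fun α => ?_) ((co_summable a).mul_left C)
      simp only [LinearMap.coe_mk, AddHom.coe_mk, co_mk, norm_mul]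
      exact mul_le_mul_of_nonneg_right (h α) (norm_nonneg _))

@[simp] theorem co_mult (μ : (Fin n →₀ ℕ) → ℂ) (C h) (a : W n) (α) :
    co (mult μ C h a) α = μ α * co a α := rfl

/-- shift -/
noncomputable def shift (δ : Fin n →₀ ℕ) : W n →L[ℂ] W n :=
  LinearMap.mkContinuous
    { toFun := fun a => mk (fun α => co a (α + δ))
        ((co_summable a).comp_injective (add_left_injective δ))
      map_add' := fun a b => rfl
      map_smul' := fun c b => rfl } 1
    (fun a => by
      rw [norm_def, norm_def, one_mul]
      exact tsum_comp_le_tsum_of_inj (co_summable a) (fun _ => norm_nonneg _)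
        (add_left_injective δ))

@[simp] theorem co_shift (δ : Fin n →₀ ℕ) (a : W n) (α) :
    co (shift δ a) α = co a (α + δ) := rfl

/-- monomial value -/
noncomputable def mon (y : Fin n → ℂ) (α : Fin n →₀ ℕ) : ℂ := ∏ l, y l ^ α l

theorem mon_add (y : Fin n → ℂ) (α β) : mon y (α + β) = mon y α * mon y β := by
  simp [mon, pow_add, Finset.prod_mul_distrib]

theorem mon_zero (y : Fin n → ℂ) : mon y 0 = 1 := by simp [mon]

theorem mon_single (y : Fin n → ℂ) (l) : mon y (Finsupp.single l 1) = y l := by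
  classical
  rw [mon, Finset.prod_eq_single l] <;> simp +contextual [eq_comm]

theorem mon_mul (y w : Fin n → ℂ) (α) : mon (y * w) α = mon y α * mon w α := by
  simp [mon, mul_pow, Finset.prod_mul_distrib]

theorem mon_smul (t : ℂ) (y : Fin n → ℂ) (α) : mon (t • y) α = t ^ α.degree * mon y α := by
  simp [mon, mul_pow, Finset.prod_mul_distrib, Finset.prod_pow_eq_pow_sum, Finsupp.degree_eq_sum]

theorem norm_mon_le (y : Fin n → ℂ) (α) : ‖mon y α‖ ≤ ‖y‖ ^ α.degree := by
  rw [mon, norm_prod, Finsupp.degree_eq_sum, ← Finset.prod_pow_eq_pow_sum]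
  refine Finset.prod_le_prod (fun _ _ => norm_nonneg _) (fun l _ => ?_)
  rw [norm_pow]
  exact pow_le_pow_left₀ (norm_nonneg _) (norm_le_pi_norm y l) _

theorem norm_mon_le_one {y : Fin n → ℂ} (hy : ‖y‖ ≤ 1) (α) : ‖mon y α‖ ≤ 1 :=
  (norm_mon_le y α).trans (pow_le_one₀ (norm_nonneg _) hy)

theorem ev_summable {y : Fin n → ℂ} (hy : ‖y‖ ≤ 1) (a : W n) :
    Summable fun α => ‖co a α * mon y α‖ := by
  refine Summable.of_nonneg_of_le (fun _ => norm_nonneg _) (fun α => ?_) (co_summable a)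
  rw [norm_mul]
  exact mul_le_of_le_one_right (norm_nonneg _) (norm_mon_le_one hy α)

/-- evaluation -/
noncomputable def ev (a : W n) (y : Fin n → ℂ) : ℂ := ∑' α, co a α * mon y α

theorem ev_hasSum {y : Fin n → ℂ} (hy : ‖y‖ ≤ 1) (a : W n) :
    HasSum (fun α => co a α * mon y α) (ev a y) := (ev_summable hy a).of_norm.hasSum

theorem ev_add {y : Fin n → ℂ} (hy : ‖y‖ ≤ 1) (a b : W n) : ev (a + b) y = ev a y + ev b y :=
  (ev_hasSum hy (a + b)).unique (by
    simpa [add_mul] using (ev_hasSum hy a).add (ev_hasSum hy b))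

theorem ev_smul (y : Fin n → ℂ) (c : ℂ) (a : W n) : ev (c • a) y = c * ev a y := by
  simp only [ev, co_smul, mul_assoc, tsum_mul_left]

theorem ev_one (y : Fin n → ℂ) : ev 1 y = 1 := by
  rw [ev, tsum_eq_single 0]
  · simp [co_one, mon_zero]
  · intro α h; simp [co_one, h]

theorem ev_mul {y : Fin n → ℂ} (hy : ‖y‖ ≤ 1) (a b : W n) : ev (a * b) y = ev a y * ev b y := by
  have ha := ev_summable hy a
  have hb := ev_summable hy b
  have hs : Summable fun x : (Fin n →₀ ℕ) × (Fin n →₀ ℕ) =>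
      (co a x.1 * mon y x.1) * (co b x.2 * mon y x.2) := summable_mul_of_summable_norm
      (f := fun α => co a α * mon y α) (g := fun α => co b α * mon y α) ha hb
  have e : ev a y * ev b y = _ :=
    ha.of_norm.tsum_mul_tsum_eq_tsum_sum_antidiagonal hb.of_norm hs
  rw [e, ev]
  refine tsum_congr fun α => ?_
  rw [co_mul, Finset.sum_mul]
  refine Finset.sum_congr rfl fun x hx => ?_
  rw [← Finset.HasAntidiagonal.mem_antidiagonal.1 hx, mon_add]
  ring

/-- evaluation as an algebra hom -/
noncomputable def evA (y : Fin n → ℂ) (hy : ‖y‖ ≤ 1) : W n →ₐ[ℂ] ℂ where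
  toFun a := ev a y
  map_one' := ev_one y
  map_mul' := ev_mul hy
  map_zero' := by simp [ev]
  map_add' := ev_add hy
  commutes' c := by
    rw [Algebra.algebraMap_eq_smul_one, ev_smul, ev_one]; simp

@[simp] theorem evA_apply (y : Fin n → ℂ) (hy : ‖y‖ ≤ 1) (a : W n) : evA y hy a = ev a y := rfl

theorem norm_ev_le {y : Fin n → ℂ} (hy : ‖y‖ ≤ 1) (a : W n) : ‖ev a y‖ ≤ ‖a‖ := by
  refine (norm_tsum_le_tsum_norm (ev_summable hy a)).trans ?_
  refine (ev_summable hy a).tsum_le_tsum (fun α => ?_) (co_summable a)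
  rw [norm_mul]
  exact mul_le_of_le_one_right (norm_nonneg _) (norm_mon_le_one hy α)

theorem evA_continuous (y : Fin n → ℂ) (hy : ‖y‖ ≤ 1) : Continuous (evA y hy) :=
  ((evA y hy).toLinearMap.mkContinuous 1 (fun a => by simpa using norm_ev_le hy a)).continuous

/-- coordinate function -/
noncomputable def Xw (l : Fin n) : W n :=
  mk (fun α => if α = Finsupp.single l 1 then 1 else 0)
    (summable_of_ne_finset_zero (s := {Finsupp.single l 1}) (fun α hα => by
      simp [show α ≠ Finsupp.single l 1 by simpa using hα]))

theorem co_Xw (l : Fin n) (α) : co (Xw l) α = if α = Finsupp.single l 1 then 1 else 0 := rfl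

theorem ev_Xw (l : Fin n) (y : Fin n → ℂ) : ev (Xw l) y = y l := by
  rw [ev, tsum_eq_single (Finsupp.single l 1)]
  · simp [co_Xw, mon_single]
  · intro α h; simp [co_Xw, h]

end GeoLin

namespace GeoLin
open Filter Topology

variable {n : ℕ}

/-- the lift of a formal multilinear series to the Banach algebra -/
noncomputable def lift (p : FormalMultilinearSeries ℂ (Fin n → ℂ) ℂ) :
    FormalMultilinearSeries ℂ (Fin n → W n) (W n) := fun k =>
  ∑ i : Fin k → Fin n, (p k (fun j => Pi.single (i j) 1)) •
    (ContinuousMultilinearMap.mkPiAlgebra ℂ (Fin k) (W n)).compContinuousLinearMap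
      (fun j => ContinuousLinearMap.proj (R := ℂ) (φ := fun _ : Fin n => W n) (i j))

theorem lift_apply (p : FormalMultilinearSeries ℂ (Fin n → ℂ) ℂ) (k : ℕ) (v : Fin k → Fin n → W n) :
    lift p k v = ∑ i : Fin k → Fin n, (p k (fun j => Pi.single (i j) 1)) • ∏ j, v j (i j) := by
  simp [lift]

theorem norm_lift_le (p : FormalMultilinearSeries ℂ (Fin n → ℂ) ℂ) (k : ℕ) :
    ‖lift p k‖ ≤ (n : ℝ) ^ k * ‖p k‖ := by
  have hb : ∀ i : Fin k → Fin n, ‖(p k (fun j => Pi.single (i j) 1)) •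
    (ContinuousMultilinearMap.mkPiAlgebra ℂ (Fin k) (W n)).compContinuousLinearMap
      (fun j => ContinuousLinearMap.proj (R := ℂ) (φ := fun _ : Fin n => W n) (i j))‖ ≤ ‖p k‖ := by
    intro i
    have h1 : ‖p k (fun j => Pi.single (i j) 1)‖ ≤ ‖p k‖ := by
      refine ((p k).le_opNorm _).trans ?_
      refine mul_le_of_le_one_right (norm_nonneg _) (Finset.prod_le_one (fun _ _ => norm_nonneg _) ?_)
      intro j _
      rw [pi_norm_le_iff_of_nonneg zero_le_one]
      intro l
      by_cases h : l = i j
      · subst h; simp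
      · simp [h]
    have h2 : ‖(ContinuousMultilinearMap.mkPiAlgebra ℂ (Fin k) (W n)).compContinuousLinearMap
      (fun j => ContinuousLinearMap.proj (R := ℂ) (φ := fun _ : Fin n => W n) (i j))‖ ≤ 1 := by
      refine ContinuousMultilinearMap.opNorm_le_bound zero_le_one (fun v => ?_)
      simp only [ContinuousMultilinearMap.compContinuousLinearMap_apply,
        ContinuousMultilinearMap.mkPiAlgebra_apply, ContinuousLinearMap.proj_apply, one_mul]
      refine (Finset.norm_prod_le _ _).trans ?_
      exact Finset.prod_le_prod (fun _ _ => norm_nonneg _) (fun j _ => norm_le_pi_norm _ _)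
    rw [norm_smul]
    calc _ ≤ ‖p k‖ * 1 := mul_le_mul h1 h2 (norm_nonneg _) (norm_nonneg _)
      _ = _ := mul_one _
  refine (norm_sum_le _ _).trans ((Finset.sum_le_sum fun i _ => hb i).trans ?_)
  simp

theorem lift_radius_pos (p : FormalMultilinearSeries ℂ (Fin n → ℂ) ℂ) (hp : 0 < p.radius) :
    0 < (lift p).radius := by
  obtain ⟨r, hr0, hr⟩ := ENNReal.lt_iff_exists_nnreal_btwn.1 hp
  obtain ⟨C, hC, h⟩ := p.norm_mul_pow_le_of_lt_radius hr
  have hr0' : 0 < r := by exact_mod_cast hr0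
  have hn : (0 : NNReal) < n + 1 := by positivity
  refine lt_of_lt_of_le (b := ((r / (n + 1) : NNReal) : ENNReal)) (by
    exact_mod_cast div_pos hr0' hn) ?_
  refine (lift p).le_radius_of_bound C (fun k => ?_)
  have h1 := norm_lift_le p k
  push_cast
  calc ‖lift p k‖ * (r / (n + 1)) ^ k ≤ ((n : ℝ) ^ k * ‖p k‖) * (r / (n + 1)) ^ k := by
        gcongr
    _ = (‖p k‖ * r ^ k) * ((n : ℝ) / (n + 1)) ^ k := by
        rw [div_pow, div_pow]; ring
    _ ≤ C * 1 := by
        refine mul_le_mul (h k) (pow_le_one₀ (by positivity) ?_) (by positivity) hC.le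
        rw [div_le_one (by positivity)]; linarith
    _ = C := mul_one C

/-- functional calculus in several variables -/
theorem exists_lift (f : (Fin n → ℂ) → ℂ) (hf : AnalyticAt ℂ f 0) :
    ∃ g : (Fin n → W n) → W n, AnalyticAt ℂ g 0 ∧
      (f 0 = 0 → g 0 = 0) ∧ (fderiv ℂ f 0 = 0 → HasStrictFDerivAt g (0 : (Fin n → W n) →L[ℂ] W n) 0) ∧
      ∀ᶠ a in 𝓝 (0 : Fin n → W n), ∀ y : Fin n → ℂ, ‖y‖ ≤ 1 →
        ev (g a) y = f (fun l => ev (a l) y) := by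
  obtain ⟨p, hp⟩ := hf
  obtain ⟨r, hr⟩ := hp
  have hrad := lift_radius_pos p (hr.r_pos.trans_le hr.r_le)
  have hg := (lift p).hasFPowerSeriesOnBall hrad
  refine ⟨(lift p).sum, ⟨_, hg.hasFPowerSeriesAt⟩, ?_, ?_, ?_⟩
  · intro h0
    have := hg.hasFPowerSeriesAt.coeff_zero (fun _ => 0)
    rw [← this, lift_apply]
    have h1 := hr.hasFPowerSeriesAt.coeff_zero (fun j => Pi.single (Fin.elim0 j) 1)
    rw [h0] at h1
    refine Finset.sum_eq_zero fun i _ => ?_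
    rw [show (fun j : Fin 0 => (Pi.single (i j) 1 : Fin n → ℂ)) = fun j => Pi.single (Fin.elim0 j) 1 from
      funext fun j => Fin.elim0 j, h1, zero_smul]
  · intro h1
    have h2 := hg.hasFPowerSeriesAt.hasStrictFDerivAt
    have h3 : (continuousMultilinearCurryFin1 ℂ (Fin n → W n) (W n)) (lift p 1) = 0 := by
      ext v : 1
      rw [continuousMultilinearCurryFin1_apply, lift_apply]
      refine Finset.sum_eq_zero fun i _ => ?_
      have h4 := hr.hasFPowerSeriesAt.fderiv_eq
      rw [h1] at h4
      have h5 := congrArg (fun L => L (Pi.single (i 0) 1)) h4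
      simp only [continuousMultilinearCurryFin1_apply] at h5
      rw [show (fun j : Fin 1 => (Pi.single (i j) 1 : Fin n → ℂ)) = Fin.snoc 0 (Pi.single (i 0) 1) from
        funext fun j => by
          rw [Subsingleton.elim j 0]; rfl, ← h5]
      simp
    rw [h3] at h2
    exact h2
  · have e1 : ∀ᶠ a in 𝓝 (0 : Fin n → W n), a ∈ Metric.eball 0 (lift p).radius :=
      Metric.isOpen_eball.mem_nhds (Metric.mem_eball_self hrad)
    have e2 : ∀ᶠ a in 𝓝 (0 : Fin n → W n), a ∈ Metric.eball 0 r :=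
      Metric.isOpen_eball.mem_nhds (Metric.mem_eball_self hr.r_pos)
    filter_upwards [e1, e2] with a h1 h2 y hy
    have s1 := hg.hasSum h1
    rw [zero_add] at s1
    have s2 := s1.map (evA y hy) (evA_continuous y hy)
    have hm : (fun l => ev (a l) y) ∈ Metric.eball (0 : Fin n → ℂ) r := by
      rw [Metric.mem_eball, edist_zero_right] at h2 ⊢
      refine lt_of_le_of_lt ?_ h2
      rw [← ofReal_norm, ← ofReal_norm]
      refine ENNReal.ofReal_le_ofReal ?_
      rw [pi_norm_le_iff_of_nonneg (norm_nonneg _)]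
      intro l
      exact (norm_ev_le hy _).trans (norm_le_pi_norm a l)
    have s3 := hr.hasSum hm
    rw [zero_add] at s3
    refine s2.unique ?_
    have key : ∀ k, evA y hy (lift p k fun _ => a) = p k (fun _ => fun l => ev (a l) y) := ?_
    · simpa only [Function.comp_def, key] using s3
    intro k
    simp only [lift_apply, map_sum, map_smul, map_prod, evA_apply]
    have : (fun l => ev (a l) y) = ∑ l, (ev (a l) y) • (Pi.single l 1 : Fin n → ℂ) := by
      ext l
      simp [Finset.sum_apply, Pi.single_apply]
    rw [show (fun _ : Fin k => (fun l => ev (a l) y)) =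
      fun _ : Fin k => ∑ l, (ev (a l) y) • (Pi.single l 1 : Fin n → ℂ) from funext fun _ => this]
    rw [(p k).map_sum]
    refine Finset.sum_congr rfl fun i _ => ?_
    rw [(p k).map_smul_univ, smul_eq_mul, smul_eq_mul, mul_comm]

end GeoLin

namespace GeoLin
open Filter Topology

variable {n : ℕ}

/-- `f` is represented by the power series `a` on the polydisc of radius `ρ` -/
def RepOn (ρ : ℝ) (f : (Fin n → ℂ) → ℂ) (a : (Fin n →₀ ℕ) → ℂ) : Prop :=
  0 < ρ ∧ (Summable fun α => ‖a α‖ * ρ ^ α.degree) ∧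
    ∀ z, ‖z‖ ≤ ρ → HasSum (fun α => a α * mon z α) (f z)

/-- `f` is represented by the power series `a` near zero -/
def Rep (f : (Fin n → ℂ) → ℂ) (a : (Fin n →₀ ℕ) → ℂ) : Prop := ∃ ρ, RepOn ρ f a

theorem RepOn.mono {ρ ρ' : ℝ} {f : (Fin n → ℂ) → ℂ} {a} (h : RepOn ρ f a) (h0 : 0 < ρ')
    (hle : ρ' ≤ ρ) : RepOn ρ' f a := by
  refine ⟨h0, Summable.of_nonneg_of_le (fun α => by positivity) (fun α => ?_) h.2.1,
    fun z hz => h.2.2 z (hz.trans hle)⟩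
  gcongr

theorem RepOn.toW {ρ : ℝ} {f : (Fin n → ℂ) → ℂ} {a} (h : RepOn ρ f a) :
    ∃ A : W n, (∀ α, co A α = a α * (ρ : ℂ) ^ α.degree) ∧
      ∀ y, ‖y‖ ≤ 1 → ev A y = f ((ρ : ℂ) • y) := by
  refine ⟨mk (fun α => a α * (ρ : ℂ) ^ α.degree) ?_, fun α => rfl, fun y hy => ?_⟩
  · refine h.2.1.congr fun α => ?_
    rw [norm_mul, norm_pow, Complex.norm_real, Real.norm_of_nonneg h.1.le]
  · refine (ev_hasSum hy _).unique ?_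
    have : ‖(ρ : ℂ) • y‖ ≤ ρ := by
      rw [norm_smul, Complex.norm_real, Real.norm_of_nonneg h.1.le]
      exact mul_le_of_le_one_right h.1.le hy
    convert h.2.2 _ this using 2 with α
    rw [mon_smul, co_mk, mul_assoc]

theorem RepOn.ofW {ρ : ℝ} (hρ : 0 < ρ) {f : (Fin n → ℂ) → ℂ} {a} (A : W n)
    (h1 : ∀ α, co A α = a α * (ρ : ℂ) ^ α.degree)
    (h2 : ∀ y, ‖y‖ ≤ 1 → ev A y = f ((ρ : ℂ) • y)) : RepOn ρ f a := by
  refine ⟨hρ, (co_summable A).congr fun α => ?_, fun z hz => ?_⟩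
  · rw [h1, norm_mul, norm_pow, Complex.norm_real, Real.norm_of_nonneg hρ.le]
  · have hρ' : (ρ : ℂ) ≠ 0 := by exact_mod_cast hρ.ne'
    have hy : ‖(ρ : ℂ)⁻¹ • z‖ ≤ 1 := by
      rw [norm_smul, norm_inv, Complex.norm_real, Real.norm_of_nonneg hρ.le]
      rw [inv_mul_le_iff₀ hρ, mul_one]; exact hz
    have e : (ρ : ℂ) • (ρ : ℂ)⁻¹ • z = z := by rw [smul_smul, mul_inv_cancel₀ hρ', one_smul]
    have := ev_hasSum hy A
    rw [h2 _ hy, e] at this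
    convert this using 2 with α
    rw [h1, mul_assoc, ← mon_smul, e]

theorem Rep.congr {f g : (Fin n → ℂ) → ℂ} {a} (h : Rep f a) (hfg : f =ᶠ[𝓝 0] g) : Rep g a := by
  obtain ⟨ρ, hρ⟩ := h
  obtain ⟨ε, hε, h2⟩ := Metric.eventually_nhds_iff.1 hfg
  have h0 : 0 < min ρ (ε / 2) := lt_min hρ.1 (by linarith)
  have h3 := hρ.mono h0 (min_le_left _ _)
  refine ⟨_, h0, h3.2.1, fun z hz => ?_⟩
  rw [← h2]
  · exact h3.2.2 z hz
  · rw [dist_zero_right]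
    have := hz.trans (min_le_right _ _)
    linarith

theorem Rep.two {f g : (Fin n → ℂ) → ℂ} {a b} (hf : Rep f a) (hg : Rep g b) :
    ∃ ρ, RepOn ρ f a ∧ RepOn ρ g b := by
  obtain ⟨ρ, hρ⟩ := hf
  obtain ⟨σ, hσ⟩ := hg
  have h0 := lt_min hρ.1 hσ.1
  exact ⟨min ρ σ, hρ.mono h0 (min_le_left _ _), hσ.mono h0 (min_le_right _ _)⟩

theorem Rep.add {f g : (Fin n → ℂ) → ℂ} {a b} (hf : Rep f a) (hg : Rep g b) :
    Rep (fun z => f z + g z) (fun α => a α + b α) := by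
  obtain ⟨ρ, h1, h2⟩ := hf.two hg
  refine ⟨ρ, h1.1, ?_, fun z hz => ?_⟩
  · refine Summable.of_nonneg_of_le (fun α => by have := h1.1; positivity) (fun α => ?_) (h1.2.1.add h2.2.1)
    rw [← add_mul]
    have := h1.1
    gcongr
    exact norm_add_le _ _
  · simp only [add_mul]
    exact (h1.2.2 z hz).add (h2.2.2 z hz)

theorem Rep.cmul {f : (Fin n → ℂ) → ℂ} {a} (c : ℂ) (hf : Rep f a) :
    Rep (fun z => c * f z) (fun α => c * a α) := by
  obtain ⟨ρ, h1⟩ := hf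
  refine ⟨ρ, h1.1, ?_, fun z hz => ?_⟩
  · simp only [norm_mul, mul_assoc]
    exact h1.2.1.mul_left _
  · simp only [mul_assoc]
    exact (h1.2.2 z hz).mul_left _

theorem Rep.zero : Rep (fun _ : Fin n → ℂ => 0) (fun _ => 0) :=
  ⟨1, one_pos, by simp, fun z _ => by simp⟩

theorem Rep.neg {f : (Fin n → ℂ) → ℂ} {a} (hf : Rep f a) :
    Rep (fun z => - f z) (fun α => - a α) := by
  simpa using hf.cmul (-1)

theorem Rep.sub {f g : (Fin n → ℂ) → ℂ} {a b} (hf : Rep f a) (hg : Rep g b) :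
    Rep (fun z => f z - g z) (fun α => a α - b α) := by
  simpa [sub_eq_add_neg] using hf.add hg.neg

theorem Rep.sum {ι : Type*} (s : Finset ι) {f : ι → (Fin n → ℂ) → ℂ} {a : ι → (Fin n →₀ ℕ) → ℂ}
    (h : ∀ i ∈ s, Rep (f i) (a i)) :
    Rep (fun z => ∑ i ∈ s, f i z) (fun α => ∑ i ∈ s, a i α) := by
  classical
  induction s using Finset.induction_on with
  | empty => simpa using Rep.zero
  | insert i s hi ih =>
    simp only [Finset.sum_insert hi]
    exact (h i (by simp)).add (ih fun j hj => h j (by simp [hj]))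

theorem Rep.mul {f g : (Fin n → ℂ) → ℂ} {a b} (hf : Rep f a) (hg : Rep g b) :
    Rep (fun z => f z * g z)
      (fun α => ∑ x ∈ Finset.HasAntidiagonal.antidiagonal α, a x.1 * b x.2) := by
  obtain ⟨ρ, h1, h2⟩ := hf.two hg
  obtain ⟨A, hA, hA'⟩ := h1.toW
  obtain ⟨B, hB, hB'⟩ := h2.toW
  refine ⟨ρ, RepOn.ofW h1.1 (A * B) (fun α => ?_) (fun y hy => ?_)⟩
  · rw [co_mul, Finset.sum_mul]
    refine Finset.sum_congr rfl fun x hx => ?_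
    rw [← Finset.HasAntidiagonal.mem_antidiagonal.1 hx, hA, hB, map_add, pow_add]
    ring
  · rw [ev_mul hy, hA' y hy, hB' y hy]

theorem Rep.coord (l : Fin n) :
    Rep (fun z => z l) (fun α => if α = Finsupp.single l 1 then 1 else 0) :=
  ⟨1, RepOn.ofW one_pos (Xw l) (fun α => by simp [co_Xw]) (fun y _ => by simp [ev_Xw])⟩

/-- multiplication by a coordinate -/
theorem Rep.coord_mul (l : Fin n) {f : (Fin n → ℂ) → ℂ} {a} (hf : Rep f a) :
    ∃ b, Rep (fun z => z l * f z) b ∧ (∀ α, b (α + Finsupp.single l 1) = a α) ∧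
      ∀ α, α l = 0 → b α = 0 := by
  refine ⟨_, (Rep.coord l).mul hf, fun α => ?_, fun α hα => ?_⟩
  · rw [Finset.sum_eq_single (Finsupp.single l 1, α)]
    · simp
    · rintro ⟨x1, x2⟩ hx hne
      have hx := Finset.HasAntidiagonal.mem_antidiagonal.1 hx
      simp only at hx
      by_cases h : x1 = Finsupp.single l 1
      · exfalso; apply hne
        subst h
        rw [add_comm] at hx
        rw [add_right_cancel hx]
      · simp [h]
    · intro h; exfalso; apply h
      rw [Finset.HasAntidiagonal.mem_antidiagonal, add_comm]
  · refine Finset.sum_eq_zero fun x hx => ?_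
    have hx := Finset.HasAntidiagonal.mem_antidiagonal.1 hx
    by_cases h : x.1 = Finsupp.single l 1
    · exfalso
      have := congrArg (fun v => v l) hx
      simp [h, hα] at this
    · simp [h]

/-- exponentially bounded multipliers -/
theorem Rep.mult {f : (Fin n → ℂ) → ℂ} {a} (hf : Rep f a) (m : (Fin n →₀ ℕ) → ℂ) (C : ℝ)
    (hm : ∀ α, ‖m α‖ ≤ C * 2 ^ α.degree) : ∃ g, Rep g (fun α => m α * a α) := by
  obtain ⟨ρ, h1⟩ := hf
  have h0 := h1.1
  have hs : Summable fun α => ‖m α * a α‖ * (ρ / 2) ^ α.degree := by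
    refine Summable.of_nonneg_of_le (fun α => by positivity) (fun α => ?_) (h1.2.1.mul_left C)
    rw [norm_mul]
    calc ‖m α‖ * ‖a α‖ * (ρ / 2) ^ α.degree ≤ (C * 2 ^ α.degree) * ‖a α‖ * (ρ / 2) ^ α.degree := by
          gcongr; exact hm α
      _ = C * (‖a α‖ * ρ ^ α.degree) := by rw [div_pow]; field_simp
  refine ⟨fun z => ∑' α, m α * a α * mon z α, ρ / 2, by positivity, hs, fun z hz => ?_⟩
  refine Summable.hasSum (Summable.of_norm (Summable.of_nonneg_of_le (fun α => norm_nonneg _) (fun α => ?_) hs))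
  rw [norm_mul]
  gcongr
  exact (norm_mon_le z α).trans (pow_le_pow_left₀ (norm_nonneg _) hz _)

theorem AnalyticAt.exists_rep {f : (Fin n → ℂ) → ℂ} (hf : AnalyticAt ℂ f 0) : ∃ a, Rep f a := by
  obtain ⟨g, -, -, -, h⟩ := exists_lift f hf
  have hc : Tendsto (fun t : ℝ => fun l : Fin n => (t : ℂ) • (Xw l : W n)) (𝓝[>] 0) (𝓝 0) := by
    have : Continuous (fun t : ℝ => fun l : Fin n => (t : ℂ) • (Xw l : W n)) := by fun_prop
    have h2 := this.tendsto 0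
    simp only [Complex.ofReal_zero, zero_smul] at h2
    exact h2.mono_left nhdsWithin_le_nhds
  obtain ⟨t, ht, ht0⟩ := ((hc.eventually h).and self_mem_nhdsWithin).exists
  have ht0 : 0 < t := ht0
  have ht' : (t : ℂ) ≠ 0 := by exact_mod_cast ht0.ne'
  refine ⟨fun α => co (g fun l => (t : ℂ) • (Xw l : W n)) α / (t : ℂ) ^ α.degree, t,
    RepOn.ofW ht0 (g fun l => (t : ℂ) • (Xw l : W n)) (fun α => ?_) (fun y hy => ?_)⟩
  · field_simp
  · rw [ht y hy]
    congr 1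
    ext l
    change ev ((t : ℂ) • (Xw l : W n)) y = (t : ℂ) * y l
    rw [ev_smul, ev_Xw]

/-- exponents of given degree -/
noncomputable def degSet (n k : ℕ) : Finset (Fin n →₀ ℕ) := Finset.finsuppAntidiag Finset.univ k

theorem mem_degSet {k : ℕ} {α : Fin n →₀ ℕ} : α ∈ degSet n k ↔ α.degree = k := by
  rw [degSet, Finset.mem_finsuppAntidiag, Finsupp.degree_eq_sum]
  simp

/-- homogeneous part -/
noncomputable def hom (a : (Fin n →₀ ℕ) → ℂ) (k : ℕ) (y : Fin n → ℂ) : ℂ :=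
  ∑ α ∈ degSet n k, a α * mon y α

theorem exists_idx (k : ℕ) : ∀ α : Fin n →₀ ℕ, α.degree = k →
    ∃ i : Fin k → Fin n, ∀ y : Fin n → ℂ, ∏ j, y (i j) = mon y α := by
  induction k with
  | zero =>
    intro α hα
    have : α = 0 := by rwa [Finsupp.degree_eq_zero_iff] at hα
    subst this
    exact ⟨fun j => j.elim0, fun y => by simp [mon_zero]⟩
  | succ k ih =>
    intro α hα
    have : ∃ l, α l ≠ 0 := by
      by_contra! h
      have : α = 0 := Finsupp.ext h
      subst this
      simp at hα
    obtain ⟨l, hl⟩ := this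
    have e : α = (α - Finsupp.single l 1) + Finsupp.single l 1 := by
      ext s
      by_cases h : s = l
      · subst h; simp; omega
      · simp [Ne.symm h]
    obtain ⟨i, hi⟩ := ih (α - Finsupp.single l 1) (by
      rw [e, map_add] at hα
      simpa using hα)
    refine ⟨Fin.cons l i, fun y => ?_⟩
    rw [Fin.prod_univ_succ, e, mon_add, mon_single]
    simp [hi, mul_comm]

/-- index choice -/
noncomputable def idx (k : ℕ) (α : Fin n →₀ ℕ) (h : α.degree = k) : Fin k → Fin n :=
  (exists_idx k α h).choose

theorem idx_spec (k : ℕ) (α : Fin n →₀ ℕ) (h : α.degree = k) (y : Fin n → ℂ) :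
    ∏ j, y (idx k α h j) = mon y α := (exists_idx k α h).choose_spec y

/-- monomial multilinear map -/
noncomputable def mmon (k : ℕ) (α : Fin n →₀ ℕ) :
    ContinuousMultilinearMap ℂ (fun _ : Fin k => Fin n → ℂ) ℂ :=
  if h : α.degree = k then
    (ContinuousMultilinearMap.mkPiAlgebra ℂ (Fin k) ℂ).compContinuousLinearMap
      (fun j => ContinuousLinearMap.proj (R := ℂ) (φ := fun _ : Fin n => ℂ) (idx k α h j))
  else 0

theorem norm_mmon_le (k : ℕ) (α : Fin n →₀ ℕ) : ‖mmon k α‖ ≤ 1 := by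
  unfold mmon
  split_ifs with h
  · refine ContinuousMultilinearMap.opNorm_le_bound zero_le_one (fun v => ?_)
    simp only [ContinuousMultilinearMap.compContinuousLinearMap_apply,
        ContinuousMultilinearMap.mkPiAlgebra_apply, ContinuousLinearMap.proj_apply, one_mul]
    refine (Finset.norm_prod_le _ _).trans ?_
    exact Finset.prod_le_prod (fun _ _ => norm_nonneg _) (fun j _ => norm_le_pi_norm _ _)
  · simp

theorem mmon_apply (k : ℕ) (α : Fin n →₀ ℕ) (h : α.degree = k) (y : Fin n → ℂ) :
    mmon k α (fun _ => y) = mon y α := by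
  rw [mmon, dif_pos h]
  simp [idx_spec]

/-- the formal multilinear series of a power series -/
noncomputable def ser (a : (Fin n →₀ ℕ) → ℂ) : FormalMultilinearSeries ℂ (Fin n → ℂ) ℂ :=
  fun k => ∑ α ∈ degSet n k, a α • mmon k α

theorem ser_apply (a : (Fin n →₀ ℕ) → ℂ) (k : ℕ) (y : Fin n → ℂ) :
    ser a k (fun _ => y) = hom a k y := by
  simp only [ser, hom, sum_apply]
  refine Finset.sum_congr rfl fun α hα => ?_
  rw [smul_apply, mmon_apply _ _ (mem_degSet.1 hα), smul_eq_mul]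

theorem hasSum_deg {g : (Fin n →₀ ℕ) → ℂ} {s : ℂ} (h : HasSum g s) :
    HasSum (fun k => ∑ α ∈ degSet n k, g α) s := by
  have := h.tsum_fiberwise (fun α : Fin n →₀ ℕ => α.degree)
  have key : ∀ k, ∑' b : ↑((fun α : Fin n →₀ ℕ => α.degree) ⁻¹' {k}), g b = ∑ α ∈ degSet n k, g α := ?_
  · simpa only [key] using this
  intro k
  rw [← Finset.tsum_subtype]
  have e : (fun α : Fin n →₀ ℕ => α.degree) ⁻¹' {k} = {α | α ∈ degSet n k} := by
    ext α; simp [mem_degSet]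
  rw [e]
  rfl

theorem Rep.hasFPowerSeriesAt {f : (Fin n → ℂ) → ℂ} {a} (hf : Rep f a) :
    HasFPowerSeriesAt f (ser a) 0 := by
  obtain ⟨ρ, hρ, hs, hz⟩ := hf
  refine ⟨ENNReal.ofReal ρ, ?_, by simpa using hρ, ?_⟩
  · refine FormalMultilinearSeries.le_radius_of_bound _ (∑' α, ‖a α‖ * ρ ^ α.degree) (r := ⟨ρ, hρ.le⟩)
      (fun k => ?_) |>.trans' ?_
    · have : ‖ser a k‖ ≤ ∑ α ∈ degSet n k, ‖a α‖ := by
        refine (norm_sum_le _ _).trans (Finset.sum_le_sum fun α _ => ?_)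
        rw [norm_smul]
        exact mul_le_of_le_one_right (norm_nonneg _) (norm_mmon_le _ _)
      calc ‖ser a k‖ * ρ ^ k ≤ (∑ α ∈ degSet n k, ‖a α‖) * ρ ^ k := by gcongr
        _ = ∑ α ∈ degSet n k, ‖a α‖ * ρ ^ α.degree := by
          rw [Finset.sum_mul]
          exact Finset.sum_congr rfl fun α hα => by rw [mem_degSet.1 hα]
        _ ≤ _ := hs.sum_le_tsum _ (fun α _ => by positivity)
    · rw [ENNReal.ofReal, Real.toNNReal_of_nonneg hρ.le]
      exact le_rfl
  · intro y hy
    rw [zero_add]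
    have hy' : ‖y‖ ≤ ρ := by
      rw [Metric.mem_eball, edist_zero_right, ← ofReal_norm] at hy
      exact ((ENNReal.ofReal_lt_ofReal_iff hρ).1 hy).le
    have := hasSum_deg (hz y hy')
    simp only [ser_apply]
    exact this

theorem Rep.analyticAt {f : (Fin n → ℂ) → ℂ} {a} (hf : Rep f a) : AnalyticAt ℂ f 0 :=
  ⟨_, hf.hasFPowerSeriesAt⟩

theorem Rep.isBigO {f : (Fin n → ℂ) → ℂ} {a} (hf : Rep f a) {M : ℕ}
    (ha : ∀ α, α.degree < M → a α = 0) :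
    (fun z => f z - hom a M z) =O[𝓝 0] fun z => ‖z‖ ^ (M + 1) := by
  have := hf.hasFPowerSeriesAt.isBigO_sub_partialSum_pow (M + 1)
  simp only [zero_add] at this
  refine this.congr_left fun z => ?_
  rw [FormalMultilinearSeries.partialSum, Finset.sum_range_succ, Finset.sum_eq_zero, zero_add, ser_apply]
  intro k hk
  rw [ser_apply, hom]
  refine Finset.sum_eq_zero fun α hα => ?_
  rw [ha α (by rw [mem_degSet.1 hα]; exact Finset.mem_range.1 hk), zero_mul]

theorem continuous_mon (α : Fin n →₀ ℕ) : Continuous fun y : Fin n → ℂ => mon y α := by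
  unfold mon; fun_prop

theorem continuous_hom (a) (k : ℕ) : Continuous (hom (n := n) a k) := by
  unfold hom
  exact continuous_finsetSum _ fun α _ => continuous_const.mul (continuous_mon α)

theorem hom_smul (a) (k : ℕ) (t : ℂ) (y : Fin n → ℂ) : hom a k (t • y) = t ^ k * hom a k y := by
  simp only [hom, Finset.mul_sum]
  refine Finset.sum_congr rfl fun α hα => ?_
  rw [mon_smul, mem_degSet.1 hα]; ring

/-- leading term along a curve -/
theorem Rep.lead {f : (Fin n → ℂ) → ℂ} {a} (hf : Rep f a) {M : ℕ}
    (ha : ∀ α, α.degree < M → a α = 0) {z : ℂ → Fin n → ℂ} {y : Fin n → ℂ}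
    (hz : Tendsto (fun t => t⁻¹ • z t) (𝓝[≠] 0) (𝓝 y)) :
    Tendsto (fun t => (t ^ M)⁻¹ * f (z t)) (𝓝[≠] 0) (𝓝 (hom a M y)) := by
  have ht : Tendsto (fun t : ℂ => t) (𝓝[≠] 0) (𝓝 0) := tendsto_id.mono_left nhdsWithin_le_nhds
  have hne : ∀ᶠ t : ℂ in 𝓝[≠] 0, t ≠ 0 := self_mem_nhdsWithin
  have hz0 : Tendsto z (𝓝[≠] 0) (𝓝 0) := by
    have := ht.smul hz
    rw [zero_smul] at this
    refine this.congr' ?_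
    filter_upwards [hne] with t h
    rw [smul_smul, mul_inv_cancel₀ h, one_smul]
  have h1 := ((continuous_hom a M).tendsto y).comp hz
  obtain ⟨C, hC⟩ := (hf.isBigO ha).bound
  have h2 : Tendsto (fun t => (t ^ M)⁻¹ * (f (z t) - hom a M (z t))) (𝓝[≠] 0) (𝓝 0) := by
    have hb : Tendsto (fun t : ℂ => C * (‖t‖ * ‖t⁻¹ • z t‖ ^ (M + 1))) (𝓝[≠] 0) (𝓝 0) := by
      have := (ht.norm.mul (hz.norm.pow (M + 1))).const_mul C
      simpa using this
    refine squeeze_zero_norm' ?_ hb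
    filter_upwards [hne, hz0.eventually hC] with t h hh
    rw [norm_mul, norm_inv, norm_pow, norm_smul, norm_inv, mul_pow]
    have h0 : 0 < ‖t‖ := norm_pos_iff.2 h
    rw [norm_pow, norm_norm] at hh
    calc (‖t‖ ^ M)⁻¹ * ‖f (z t) - hom a M (z t)‖ ≤ (‖t‖ ^ M)⁻¹ * (C * ‖z t‖ ^ (M + 1)) := by gcongr
      _ = _ := by rw [inv_pow]; field_simp; ring
  have h3 := h2.add h1
  rw [zero_add] at h3
  refine h3.congr' ?_
  filter_upwards [hne] with t h
  simp only [Function.comp]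
  rw [hom_smul, inv_pow]; ring

theorem tendsto_ray (y : Fin n → ℂ) : Tendsto (fun t : ℂ => t⁻¹ • (t • y)) (𝓝[≠] 0) (𝓝 y) := by
  refine tendsto_const_nhds.congr' ?_
  filter_upwards [self_mem_nhdsWithin] with t h
  rw [smul_smul, inv_mul_cancel₀ h, one_smul]

/-- polynomial vanishing -/
theorem finsum_mon_eq_zero (s : Finset (Fin n →₀ ℕ)) (a : (Fin n →₀ ℕ) → ℂ)
    (h : ∀ y, ∑ α ∈ s, a α * mon y α = 0) : ∀ α ∈ s, a α = 0 := by
  classical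
  have : (∑ α ∈ s, MvPolynomial.monomial α (a α) : MvPolynomial (Fin n) ℂ) = 0 := by
    apply MvPolynomial.funext
    intro y
    rw [map_sum, map_zero, ← h y]
    refine Finset.sum_congr rfl fun α _ => ?_
    rw [MvPolynomial.eval_monomial, mon, Finsupp.prod_fintype]
    simp
  intro α hα
  have h2 := congrArg (MvPolynomial.coeff α) this
  rw [MvPolynomial.coeff_sum, Finset.sum_eq_single α] at h2
  · simpa using h2
  · intro b _ hb; simp [MvPolynomial.coeff_monomial, hb]
  · intro h; exact absurd hα h

theorem hom_eq_zero {a} {k : ℕ} (h : ∀ y : Fin n → ℂ, hom a k y = 0) :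
    ∀ α, α.degree = k → a α = 0 := fun α hα =>
  finsum_mon_eq_zero _ _ h α (mem_degSet.2 hα)

theorem Rep.eq_zero {a : (Fin n →₀ ℕ) → ℂ} (hf : Rep (fun _ => 0) a) : a = 0 := by
  have : ∀ k, ∀ α, α.degree < k → a α = 0 := by
    intro k
    induction k with
    | zero => intro α h; omega
    | succ k ih =>
      intro α h
      rcases Nat.lt_succ_iff_lt_or_eq.1 h with h | h
      · exact ih α h
      · refine hom_eq_zero (fun y => ?_) α h
        have h1 := hf.lead ih (tendsto_ray y)
        simp only [mul_zero] at h1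
        exact tendsto_nhds_unique h1 tendsto_const_nhds
  ext α
  exact this _ α (Nat.lt_succ_self _)

theorem Rep.unique {f : (Fin n → ℂ) → ℂ} {a b} (hf : Rep f a) (hg : Rep f b) : a = b := by
  have := hf.sub hg
  simp only [sub_self] at this
  have := this.eq_zero
  ext α
  have := congrFun this α
  exact sub_eq_zero.1 this

theorem Rep.eventually_zero {f : (Fin n → ℂ) → ℂ} (hf : Rep f (fun _ => 0)) :
    ∀ᶠ z in 𝓝 0, f z = 0 := by
  obtain ⟨ρ, h0, -, h⟩ := hf
  filter_upwards [Metric.closedBall_mem_nhds (0 : Fin n → ℂ) h0] with z hz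
  have := h z (by simpa using hz)
  simp only [zero_mul] at this
  exact this.unique hasSum_zero

/-- a bound on the order from limits -/
theorem Rep.order_of_lim {f : (Fin n → ℂ) → ℂ} {a} (hf : Rep f a) {M : ℕ} {Q : (Fin n → ℂ) → ℂ}
    (hQ : ∀ y, Tendsto (fun t : ℂ => (t ^ M)⁻¹ * f (t • y)) (𝓝[≠] 0) (𝓝 (Q y))) :
    (∀ α, α.degree < M → a α = 0) ∧ ∀ y, hom a M y = Q y := by
  have key : ∀ k ≤ M, ∀ α, α.degree < k → a α = 0 := by
    intro k
    induction k with
    | zero => intro _ α h; omega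
    | succ k ih =>
      intro hk α h
      have ih := ih (by omega)
      rcases Nat.lt_succ_iff_lt_or_eq.1 h with h | h
      · exact ih α h
      · refine hom_eq_zero (fun y => ?_) α h
        have h1 := hf.lead ih (tendsto_ray y)
        have ht : Tendsto (fun t : ℂ => t ^ (M - k)) (𝓝[≠] 0) (𝓝 0) := by
          have : Tendsto (fun t : ℂ => t ^ (M - k)) (𝓝[≠] 0) (𝓝 (0 ^ (M - k))) :=
            (continuous_pow (M - k)).tendsto (0 : ℂ) |>.mono_left nhdsWithin_le_nhds
          rwa [zero_pow (by omega)] at this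
        have h2 := ht.mul (hQ y)
        rw [zero_mul] at h2
        refine tendsto_nhds_unique h1 (h2.congr' ?_)
        filter_upwards [self_mem_nhdsWithin] with t h
        have h : t ≠ 0 := h
        rw [← mul_assoc]
        congr 1
        have : t ^ M = t ^ (M - k) * t ^ k := by rw [← pow_add]; congr 1; omega
        rw [this]
        field_simp
  exact ⟨key M le_rfl, fun y => tendsto_nhds_unique (hf.lead (key M le_rfl) (tendsto_ray y)) (hQ y)⟩

end GeoLin

namespace GeoLin
open Filter Topology

variable {n : ℕ}

/-- weight of an exponent -/
noncomputable def lam (w : Fin n → ℂ) (α : Fin n →₀ ℕ) : ℂ := ∑ l, w l * (α l : ℂ)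

theorem lam_add (w : Fin n → ℂ) (α β) : lam w (α + β) = lam w α + lam w β := by
  simp [lam, mul_add, Finset.sum_add_distrib]

theorem lam_single (w : Fin n → ℂ) (l) : lam w (Finsupp.single l 1) = w l := by
  classical
  simp [lam, Finsupp.single_apply]

theorem norm_lam_le (w : Fin n → ℂ) (α) : ‖lam w α‖ ≤ ‖w‖ * α.degree := by
  refine (norm_sum_le _ _).trans ?_
  rw [Finsupp.degree_eq_sum, Nat.cast_sum, Finset.mul_sum]
  refine Finset.sum_le_sum fun l _ => ?_
  rw [norm_mul, Complex.norm_natCast]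
  exact mul_le_mul_of_nonneg_right (norm_le_pi_norm w l) (by positivity)

theorem norm_lam_le2 (w : Fin n → ℂ) (α) : ‖lam w α‖ ≤ ‖w‖ * 2 ^ α.degree := by
  refine (norm_lam_le w α).trans ?_
  gcongr
  exact_mod_cast (Nat.lt_two_pow_self).le

theorem mon_exp (y w : Fin n → ℂ) (s : ℂ) (α) :
    mon (fun l => y l * Complex.exp (s * w l)) α = mon y α * Complex.exp (s * lam w α) := by
  have := mon_mul y (fun l => Complex.exp (s * w l)) α
  rw [show (fun l => y l * Complex.exp (s * w l)) = y * fun l => Complex.exp (s * w l) from rfl, this]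
  congr 1
  rw [mon, lam, Finset.mul_sum, Complex.exp_sum]
  refine Finset.prod_congr rfl fun l _ => ?_
  rw [← Complex.exp_nat_mul]; congr 1; ring

theorem Rep.theta {f : (Fin n → ℂ) → ℂ} {a} (hf : Rep f a) (w : Fin n → ℂ) :
    Rep (fun y => fderiv ℂ f y (w * y)) (fun α => lam w α * a α) := by
  obtain ⟨ρ, hρ⟩ := id hf
  have h0 := hρ.1
  obtain ⟨g, hg⟩ := hf.mult (lam w) ‖w‖ (norm_lam_le2 w)
  refine hg.congr ?_
  obtain ⟨σ, hσ⟩ := id hg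
  have e1 : ∀ᶠ y in 𝓝 (0 : Fin n → ℂ), ‖y‖ ≤ σ := by
    filter_upwards [Metric.closedBall_mem_nhds (0 : Fin n → ℂ) hσ.1] with y hy
    simpa using hy
  have e2 : ∀ᶠ y in 𝓝 (0 : Fin n → ℂ), ‖y‖ ≤ ρ / 4 := by
    filter_upwards [Metric.closedBall_mem_nhds (0 : Fin n → ℂ) (show 0 < ρ / 4 by positivity)] with y hy
    simpa using hy
  filter_upwards [e1, e2, hf.analyticAt.eventually_analyticAt] with y h1 h2 h3
  -- small disc
  obtain ⟨δ, hδ, hδ2⟩ : ∃ δ > 0, Real.exp (δ * ‖w‖) ≤ 2 := by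
    have : Tendsto (fun δ : ℝ => Real.exp (δ * ‖w‖)) (𝓝[>] 0) (𝓝 1) := by
      have h : Continuous (fun δ : ℝ => Real.exp (δ * ‖w‖)) := by fun_prop
      have := h.tendsto 0
      simp only [zero_mul, Real.exp_zero] at this
      exact this.mono_left nhdsWithin_le_nhds
    obtain ⟨δ, h, h'⟩ := ((this.eventually (Iic_mem_nhds (show (1 : ℝ) < 2 by norm_num))).and
      self_mem_nhdsWithin).exists
    exact ⟨δ, h', h⟩
  have hexp : ∀ s ∈ Metric.ball (0 : ℂ) δ, ∀ α : Fin n →₀ ℕ,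
      ‖Complex.exp (s * lam w α)‖ ≤ 2 ^ α.degree := by
    intro s hs α
    rw [Complex.norm_exp]
    have hs : ‖s‖ ≤ δ := by simpa using (Metric.mem_ball.1 hs).le
    calc Real.exp (s * lam w α).re ≤ Real.exp ((δ * ‖w‖) * α.degree) := by
          apply Real.exp_le_exp.2
          refine (Complex.re_le_norm _).trans ?_
          rw [norm_mul, mul_assoc]
          exact mul_le_mul hs (norm_lam_le w α) (norm_nonneg _) hδ.le
      _ = Real.exp (δ * ‖w‖) ^ α.degree := by rw [← Real.exp_nat_mul]; congr 1; ring
      _ ≤ _ := by gcongr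
  have hmon : ∀ α, ‖mon y α‖ ≤ (ρ / 4) ^ α.degree := fun α =>
    (norm_mon_le y α).trans (pow_le_pow_left₀ (norm_nonneg _) h2 _)
  have hsum := hasDerivAt_tsum_of_isPreconnected (𝕜 := ℂ) (F := ℂ)
    (u := fun α : Fin n →₀ ℕ => ‖w‖ * (‖a α‖ * ρ ^ α.degree))
    (g := fun α s => a α * (mon y α * Complex.exp (s * lam w α)))
    (g' := fun α s => a α * (mon y α * (Complex.exp (s * lam w α) * lam w α)))
    (hρ.2.1.mul_left _) Metric.isOpen_ball (convex_ball (0 : ℂ) δ).isPreconnected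
    (fun α s _ => by
      have : HasDerivAt (fun s : ℂ => s * lam w α) (lam w α) s := hasDerivAt_mul_const _
      exact ((this.cexp.const_mul _).const_mul _))
    (fun α s hs => by
      rw [norm_mul, norm_mul, norm_mul]
      calc ‖a α‖ * (‖mon y α‖ * (‖Complex.exp (s * lam w α)‖ * ‖lam w α‖)) ≤
          ‖a α‖ * ((ρ / 4) ^ α.degree * (2 ^ α.degree * (‖w‖ * 2 ^ α.degree))) := by
            gcongr
            · exact hmon α
            · exact hexp s hs α
            · exact norm_lam_le2 w α
        _ = ‖w‖ * (‖a α‖ * ρ ^ α.degree) := by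
          rw [div_pow, show (4 : ℝ) = 2 * 2 by norm_num, mul_pow]; field_simp)
    (Metric.mem_ball_self hδ) (by
      have := (hρ.2.2 y (by linarith)).summable
      refine this.congr fun α => ?_
      simp) (Metric.mem_ball_self hδ)
  have hval : ∑' α, a α * (mon y α * (Complex.exp (0 * lam w α) * lam w α)) = g y := by
    rw [← (hσ.2.2 y h1).tsum_eq]
    refine tsum_congr fun α => ?_
    simp; ring
  rw [hval] at hsum
  -- the curve
  have hcurve : HasDerivAt (fun s : ℂ => fun l => y l * Complex.exp (s * w l)) (w * y) 0 := by
    rw [hasDerivAt_pi]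
    intro l
    have : HasDerivAt (fun s : ℂ => s * w l) (w l) 0 := hasDerivAt_mul_const _
    have := (this.cexp).const_mul (y l)
    have e : (w * y) l = y l * (Complex.exp (0 * w l) * w l) := by simp [mul_comm]
    rw [e]
    exact this
  have hy0 : (fun l => y l * Complex.exp ((0 : ℂ) * w l)) = y := by ext l; simp
  have hcomp : HasDerivAt (fun s : ℂ => f (fun l => y l * Complex.exp (s * w l))) (fderiv ℂ f y (w * y)) 0 := by
    have hd : HasFDerivAt f (fderiv ℂ f y) (fun l => y l * Complex.exp ((0 : ℂ) * w l)) := by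
      rw [hy0]; exact h3.differentiableAt.hasFDerivAt
    exact hd.comp_hasDerivAt (0 : ℂ) hcurve
  refine hsum.unique (hcomp.congr_of_eventuallyEq ?_)
  filter_upwards [Metric.ball_mem_nhds (0 : ℂ) hδ] with s hs
  have hn : ‖fun l => y l * Complex.exp (s * w l)‖ ≤ ρ := by
    rw [pi_norm_le_iff_of_nonneg h0.le]
    intro l
    rw [norm_mul]
    have := hexp s hs (Finsupp.single l 1)
    rw [lam_single] at this
    simp at this
    calc ‖y l‖ * ‖Complex.exp (s * w l)‖ ≤ (ρ / 4) * 2 := by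
          gcongr
          exact (norm_le_pi_norm y l).trans h2
      _ ≤ ρ := by linarith
  rw [← (hρ.2.2 _ hn).tsum_eq]
  refine tsum_congr fun α => ?_
  rw [mon_exp]

/-- partial derivatives -/
theorem Rep.pderiv {f : (Fin n → ℂ) → ℂ} {a} (hf : Rep f a) (l : Fin n) :
    Rep (fun y => fderiv ℂ f y (Pi.single l 1))
      (fun α => ((α l : ℂ) + 1) * a (α + Finsupp.single l 1)) := by
  classical
  have han : AnalyticAt ℂ (fun y => fderiv ℂ f y (Pi.single l 1)) 0 := by
    have := hf.analyticAt.fderiv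
    exact (ContinuousLinearMap.apply ℂ ℂ (Pi.single l (1 : ℂ) : Fin n → ℂ)).analyticAt _ |>.comp this
  obtain ⟨b, hb⟩ := AnalyticAt.exists_rep han
  obtain ⟨c, hc, hc1, -⟩ := hb.coord_mul l
  have ht := hf.theta (Pi.single l 1)
  have he : (fun z : Fin n → ℂ => z l * fderiv ℂ f z (Pi.single l 1)) =
      fun y => fderiv ℂ f y (Pi.single l 1 * y) := by
    ext z
    have : (Pi.single l 1 * z : Fin n → ℂ) = z l • Pi.single l 1 := by
      ext s
      by_cases h : s = l
      · subst h; simp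
      · simp [h]
    rw [this, map_smul, smul_eq_mul]
  rw [he] at hc
  have hu := hc.unique ht
  convert hb using 1
  ext α
  rw [← hc1, hu]
  congr 1
  rw [lam, Finset.sum_eq_single l]
  · simp
  · intro s _ hs; simp [hs]
  · simp

theorem mon_poly_analytic (a) (k : ℕ) (y : Fin n → ℂ) : AnalyticAt ℂ (hom (n := n) a k) y := by
  have : ContDiff ℂ ⊤ (hom (n := n) a k) := by
    unfold hom mon; fun_prop
  exact this.contDiffAt.analyticAt

end GeoLin

namespace GeoLin
open Filter Topology

variable {n r q : ℕ}

/-- integer vectors annihilated by `L` -/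
def intK (L : Fin r → Fin n → ℂ) : Set (Fin n → ℂ) :=
  {v | (∀ i, ∑ l, L i l * v l = 0) ∧ ∃ w : Fin n → ℤ, v = fun l => (w l : ℂ)}

theorem divisor (L : Fin r → Fin n → ℂ)
    (hK : ∀ v : Fin n → ℂ, (∀ i, ∑ l, L i l * v l = 0) → v ∈ Submodule.span ℂ (intK L)) :
    ∃ c : ℝ, 0 < c ∧ ∀ w : Fin n → ℤ, (∀ i, ∑ l, L i l * (w l : ℂ) = 0) ∨
      ∃ i, c ≤ ‖∑ l, L i l * (w l : ℂ)‖ := by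
  classical
  set Lm : (Fin n → ℂ) →ₗ[ℂ] (Fin r → ℂ) := Matrix.mulVecLin (Matrix.of L) with hLm
  have hLa : ∀ v i, Lm v i = ∑ l, L i l * v l := by
    intro v i; simp [hLm, Matrix.mulVec, dotProduct]
  set T : Set (Fin n → ℂ) := {v | ∃ w : Fin n → ℤ, v = fun l => (w l : ℂ)} with hT
  obtain ⟨s, hs1, -, hs2, hs3⟩ := exists_linearIndepOn_id_extension (K := ℂ) (s := (∅ : Set (Fin n → ℂ)))
    (t := intK L) (linearIndepOn_empty _ _) (Set.empty_subset _)
  obtain ⟨b, hb1, hsb, hb2, hb3⟩ := exists_linearIndepOn_id_extension (K := ℂ) (s := s) (t := T) hs3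
    (fun v hv => (hs1 hv).2)
  have hspan : ⊤ ≤ Submodule.span ℂ (Set.range ((↑) : b → Fin n → ℂ)) := by
    rw [Subtype.range_coe]
    intro v _
    have : v = ∑ l, v l • (Pi.single l 1 : Fin n → ℂ) := by
      ext l; simp [Finset.sum_apply, Pi.single_apply]
    rw [this]
    refine Submodule.sum_mem _ fun l _ => Submodule.smul_mem _ _ (hb2 ⟨Pi.single l 1, ?_⟩)
    ext s
    by_cases h : s = l
    · subst h; simp
    · simp [h]
  let B0 : Module.Basis b ℂ (Fin n → ℂ) := Module.Basis.mk hb3 hspan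
  have : Finite b := Module.Finite.finite_basis B0
  have : Fintype b := Fintype.ofFinite b
  have hcard : Fintype.card b = n := by
    have := Module.finrank_eq_card_basis B0
    simpa using this.symm
  let e : b ≃ Fin n := Fintype.equivFinOfCardEq hcard
  choose wv hwv using fun x : b => hb1 x.2
  have hB0 : ∀ x : b, B0 x = x := fun x => by simp [B0]
  -- integer matrix
  let BI : Matrix (Fin n) (Fin n) ℤ := Matrix.of fun l a => wv (e.symm a) l
  let Bc : Matrix (Fin n) (Fin n) ℂ := BI.map (Int.cast)
  have hBc : ∀ v : Fin n → ℂ, Bc.mulVec (fun a => B0.repr v (e.symm a)) = v := by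
    intro v
    conv_rhs => rw [← B0.sum_repr v]
    ext l
    simp only [Matrix.mulVec, dotProduct, Finset.sum_apply, Pi.smul_apply, smul_eq_mul]
    rw [← Equiv.sum_comp e]
    refine Finset.sum_congr rfl fun x _ => ?_
    simp only [Equiv.symm_apply_apply, hB0, Bc, BI, Matrix.map_apply, Matrix.of_apply]
    have h := congrFun (hwv x) l
    rw [h, mul_comm]
  have hdet : BI.det ≠ 0 := by
    intro h0
    have h1 : Bc.det = 0 := by
      have : Bc.det = ((BI.det : ℤ) : ℂ) := by
        rw [Int.cast_det]
      rw [this, h0]; simp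
    obtain ⟨x, hx, hx2⟩ := Matrix.exists_vecMul_eq_zero_iff.2 h1
    apply hx
    ext l
    have h3 := hBc (Pi.single l 1)
    have h4 : x ⬝ᵥ (Bc.mulVec (fun a => B0.repr (Pi.single l 1) (e.symm a))) = 0 := by
      rw [Matrix.dotProduct_mulVec, hx2, zero_dotProduct]
    rw [h3] at h4
    simpa using h4
  -- integrality of coordinates
  have hfirst : ∀ (w : Fin n → ℤ) (x : b), ∃ N : ℤ, (BI.det : ℂ) * B0.repr (fun l => (w l : ℂ)) x = N := by
    intro w x
    refine ⟨(BI.adjugate.mulVec w) (e x), ?_⟩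
    have h1 := congrArg (fun u => (BI.adjugate.map (Int.cast : ℤ → ℂ)).mulVec u) (hBc (fun l => (w l : ℂ)))
    simp only [Matrix.mulVec_mulVec] at h1
    have h2 : (BI.adjugate.map (Int.cast : ℤ → ℂ)) * Bc = (BI.det : ℂ) • (1 : Matrix (Fin n) (Fin n) ℂ) := by
      have := congrArg (fun M : Matrix (Fin n) (Fin n) ℤ => M.map (Int.castRingHom ℂ)) (Matrix.adjugate_mul BI)
      simp only [Matrix.map_mul] at this
      have h5 : (BI.det • (1 : Matrix (Fin n) (Fin n) ℤ)).map (Int.castRingHom ℂ) =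
          (BI.det : ℂ) • (1 : Matrix (Fin n) (Fin n) ℂ) := by
        ext i j
        by_cases h : i = j
        · subst h
          rw [Matrix.map_apply, Matrix.smul_apply, Matrix.smul_apply, Matrix.one_apply_eq, Matrix.one_apply_eq]
          simp only [smul_eq_mul, mul_one, eq_intCast]
        · rw [Matrix.map_apply, Matrix.smul_apply, Matrix.smul_apply, Matrix.one_apply_ne h, Matrix.one_apply_ne h]
          simp only [smul_eq_mul, mul_zero, map_zero]
      rw [h5] at this
      exact this
    rw [h2, Matrix.smul_mulVec, Matrix.one_mulVec] at h1
    have h3 := congrFun h1 (e x)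
    simp only [Pi.smul_apply, Equiv.symm_apply_apply, smul_eq_mul] at h3
    rw [h3]
    simp [Matrix.mulVec, dotProduct]
  -- functionals factor
  have hfac : ∀ x : b, ∃ C : ℝ, 0 ≤ C ∧ ((x : Fin n → ℂ) ∉ s → ∀ v, ‖B0.repr v x‖ ≤ C * ‖Lm v‖) := by
    intro x
    by_cases hx : (x : Fin n → ℂ) ∈ s
    · exact ⟨0, le_rfl, fun h => absurd hx h⟩
    have hmem : B0.coord x ∈ (LinearMap.ker Lm).dualAnnihilator := by
      rw [Submodule.mem_dualAnnihilator]
      intro v hv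
      have hv' : v ∈ Submodule.span ℂ s := by
        have h1 := hK v (fun i => by rw [← hLa, LinearMap.mem_ker.1 hv]; rfl)
        exact (Submodule.span_le.2 hs2) h1
      have hle : Submodule.span ℂ s ≤ LinearMap.ker (B0.coord x) := by
        rw [Submodule.span_le]
        intro u hu
        rw [SetLike.mem_coe, LinearMap.mem_ker, Module.Basis.coord_apply]
        have : u = B0 ⟨u, hsb hu⟩ := (hB0 ⟨u, hsb hu⟩).symm
        rw [this, B0.repr_self, Finsupp.single_apply, if_neg]
        rintro rfl
        exact hx hu
      exact hle hv'
    rw [← LinearMap.range_dualMap_eq_dualAnnihilator_ker] at hmem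
    obtain ⟨g, hg⟩ := hmem
    refine ⟨‖LinearMap.toContinuousLinearMap g‖, norm_nonneg _, fun _ v => ?_⟩
    have : B0.repr v x = LinearMap.toContinuousLinearMap g (Lm v) := by
      rw [← Module.Basis.coord_apply, ← hg]; rfl
    rw [this]
    exact ContinuousLinearMap.le_opNorm _ _
  choose C hC0 hC using hfac
  set D : ℝ := ∑ x, C x + 1 with hD
  have hD0 : 0 < D := by
    have : 0 ≤ ∑ x, C x := Finset.sum_nonneg fun x _ => hC0 x
    linarith
  have hCD : ∀ x, C x ≤ D := fun x => by
    have := Finset.single_le_sum (f := C) (fun x _ => hC0 x) (Finset.mem_univ x)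
    linarith
  have hd0 : 0 < |(BI.det : ℝ)| := abs_pos.2 (by exact_mod_cast hdet)
  refine ⟨(|(BI.det : ℝ)| * D)⁻¹, by positivity, fun w => ?_⟩
  by_contra! hcon
  obtain ⟨⟨i0, hi0⟩, hlt⟩ := hcon
  have hnorm : ‖Lm (fun l => (w l : ℂ))‖ < (|(BI.det : ℝ)| * D)⁻¹ := by
    rw [pi_norm_lt_iff (by positivity)]
    intro i
    rw [hLa]
    exact hlt i
  have hex : ∃ x : b, (x : Fin n → ℂ) ∉ s ∧ B0.repr (fun l => (w l : ℂ)) x ≠ 0 := by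
    by_contra! hno
    apply hi0
    have hm : (fun l => (w l : ℂ)) ∈ LinearMap.ker Lm := by
      rw [← B0.sum_repr (fun l => (w l : ℂ))]
      refine Submodule.sum_mem _ fun x _ => ?_
      by_cases hx : (x : Fin n → ℂ) ∈ s
      · refine Submodule.smul_mem _ _ ?_
        rw [hB0, LinearMap.mem_ker]
        ext i
        rw [hLa]
        exact (hs1 hx).1 i
      · rw [hno x hx, zero_smul]; exact Submodule.zero_mem _
    rw [← hLa (fun l => (w l : ℂ)) i0, LinearMap.mem_ker.1 hm]; rfl
  obtain ⟨x, hx, hx0⟩ := hex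
  obtain ⟨N, hN⟩ := hfirst w x
  have hN0 : N ≠ 0 := by
    rintro rfl
    simp at hN
    rcases hN with h | h
    · exact hdet h
    · exact hx0 h
  have h1 : (1 : ℝ) ≤ |(BI.det : ℝ)| * ‖B0.repr (fun l => (w l : ℂ)) x‖ := by
    have h2 := congrArg norm hN
    rw [norm_mul, Complex.norm_intCast, Complex.norm_intCast] at h2
    rw [h2]
    exact_mod_cast Int.one_le_abs hN0
  have h2 := hC x hx (fun l => (w l : ℂ))
  have h3 : |(BI.det : ℝ)| * ‖B0.repr (fun l => (w l : ℂ)) x‖ < 1 := by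
    calc |(BI.det : ℝ)| * ‖B0.repr (fun l => (w l : ℂ)) x‖ ≤ |(BI.det : ℝ)| * (D * ‖Lm (fun l => (w l : ℂ))‖) := by
          gcongr
          exact h2.trans (by gcongr; exact hCD x)
      _ < |(BI.det : ℝ)| * (D * (|(BI.det : ℝ)| * D)⁻¹) := by gcongr
      _ = 1 := by field_simp
  linarith

theorem kernel_span (L : Fin r → Fin n → ℂ) (hL : LinearIndependent ℂ L) (hn : n = r + q)
    (u : Fin q → Fin n → ℂ) (hu : LinearIndependent ℂ u)
    (hu2 : ∀ j, u j ∈ Submodule.span ℂ (intK L)) (v : Fin n → ℂ)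
    (hv : ∀ i, ∑ l, L i l * v l = 0) : v ∈ Submodule.span ℂ (intK L) := by
  set Lm : (Fin n → ℂ) →ₗ[ℂ] (Fin r → ℂ) := Matrix.mulVecLin (Matrix.of L) with hLm
  have hLa : ∀ v i, Lm v i = ∑ l, L i l * v l := by
    intro v i; simp [hLm, Matrix.mulVec, dotProduct]
  have hle : Submodule.span ℂ (intK L) ≤ LinearMap.ker Lm := by
    rw [Submodule.span_le]
    intro x hx
    rw [SetLike.mem_coe, LinearMap.mem_ker]
    ext i
    rw [hLa]; exact hx.1 i
  have hrank : Module.finrank ℂ (LinearMap.range Lm) = r := by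
    have : (Matrix.of L).rank = r := by
      have := LinearIndependent.rank_matrix (M := Matrix.of L) hL
      simpa using this
    exact this
  have hker : Module.finrank ℂ (LinearMap.ker Lm) = q := by
    have := LinearMap.finrank_range_add_finrank_ker Lm
    rw [hrank] at this
    simp at this
    omega
  have h1 : Submodule.span ℂ (Set.range u) ≤ Submodule.span ℂ (intK L) := by
    rw [Submodule.span_le]; rintro _ ⟨j, rfl⟩; exact hu2 j
  have h2 : q ≤ Module.finrank ℂ (Submodule.span ℂ (intK L)) := by
    have := Submodule.finrank_mono h1
    rw [finrank_span_eq_card hu] at this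
    simpa using this
  have h3 := Submodule.eq_of_le_of_finrank_le hle (by omega)
  rw [h3, LinearMap.mem_ker]
  ext i
  rw [hLa]; exact hv i

end GeoLin

namespace GeoLin
open Filter Topology

variable {n r q : ℕ}

theorem strict_of_quadratic {E F : Type*} [NormedAddCommGroup E] [NormedSpace ℂ E]
    [NormedAddCommGroup F] [NormedSpace ℂ F] (B : E → F) (hB : ContDiff ℂ 1 B)
    (hq : ∀ (s : ℂ) x, B (s • x) = s ^ 2 • B x) : HasStrictFDerivAt B (0 : E →L[ℂ] F) 0 := by
  have h1 : HasStrictFDerivAt B (fderiv ℂ B 0) 0 := hB.contDiffAt.hasStrictFDerivAt (by norm_num)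
  have h2 : fderiv ℂ B 0 = 0 := by
    ext x
    have h3 : HasDerivAt (fun s : ℂ => B (s • x)) (fderiv ℂ B 0 x) 0 := by
      have hc : HasDerivAt (fun s : ℂ => s • x) x 0 := by
        simpa using (hasDerivAt_id (0 : ℂ)).smul_const x
      have h4 : HasFDerivAt B (fderiv ℂ B 0) ((0 : ℂ) • x) := by
        rw [zero_smul]; exact h1.hasFDerivAt
      exact h4.comp_hasDerivAt (0 : ℂ) hc
    have h5 : HasDerivAt (fun s : ℂ => s ^ 2 • B x) 0 0 := by
      simpa using (hasDerivAt_pow 2 (0 : ℂ)).smul_const (B x)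
    simp only [hq] at h3
    simpa using h3.unique h5
  rwa [h2] at h1

theorem fp_abstract {E Y : Type*} [NormedAddCommGroup E] [NormedSpace ℂ E] [CompleteSpace E]
    [NormedAddCommGroup Y] [NormedSpace ℂ Y] (Λ : Y →L[ℂ] E) (B : E → E) (hB0 : B 0 = 0)
    (hB : HasStrictFDerivAt B (0 : E →L[ℂ] E) 0) :
    ∃ η : ℝ, 0 < η ∧ ∀ S : E → Y, ‖S 0‖ ≤ η →
      (∀ x x', ‖x‖ ≤ 1 → ‖x'‖ ≤ 1 → ‖S x - S x'‖ ≤ η * ‖x - x'‖) →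
      ∃ x, ‖x‖ ≤ 1 ∧ Λ (S x) + B x = x := by
  obtain ⟨σ0, hσ0, hLip⟩ : ∃ σ > 0, ∀ x ∈ Metric.ball (0 : E) σ, ∀ x' ∈ Metric.ball (0 : E) σ,
      ‖B x - B x'‖ ≤ (1 / 4) * ‖x - x'‖ := by
    have := hB.isLittleO.bound (show (0 : ℝ) < 1 / 4 by norm_num)
    rw [nhds_prod_eq] at this
    obtain ⟨u, hu, v, hv, huv⟩ := Filter.mem_prod_iff.1 this
    obtain ⟨ε1, h1, h1'⟩ := Metric.mem_nhds_iff.1 hu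
    obtain ⟨ε2, h2, h2'⟩ := Metric.mem_nhds_iff.1 hv
    refine ⟨min ε1 ε2, lt_min h1 h2, fun x hx x' hx' => ?_⟩
    have := huv (Set.mk_mem_prod (h1' (Metric.ball_subset_ball (min_le_left _ _) hx))
      (h2' (Metric.ball_subset_ball (min_le_right _ _) hx')))
    simpa using this
  set σ := min (σ0 / 2) 1 with hσ
  have hσp : 0 < σ := lt_min (by linarith) one_pos
  have hσ1 : σ ≤ 1 := min_le_right _ _
  have hσ2 : σ < σ0 := lt_of_le_of_lt (min_le_left _ _) (by linarith)
  refine ⟨σ / (4 * (‖Λ‖ + 1)), by positivity, fun S hS0 hS => ?_⟩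
  set η := σ / (4 * (‖Λ‖ + 1)) with hη
  have hηp : 0 < η := by positivity
  have hΛη : ‖Λ‖ * η ≤ σ / 4 := by
    rw [hη]
    have : ‖Λ‖ / (‖Λ‖ + 1) ≤ 1 := by
      rw [div_le_one (by positivity)]; linarith
    calc ‖Λ‖ * (σ / (4 * (‖Λ‖ + 1))) = (σ / 4) * (‖Λ‖ / (‖Λ‖ + 1)) := by field_simp
      _ ≤ (σ / 4) * 1 := by gcongr
      _ = _ := mul_one _
  let T : E → E := fun x => Λ (S x) + B x
  have hT : ∀ x x', ‖x‖ ≤ σ → ‖x'‖ ≤ σ → ‖T x - T x'‖ ≤ (1 / 2) * ‖x - x'‖ := by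
    intro x x' hx hx'
    have e : T x - T x' = Λ (S x - S x') + (B x - B x') := by simp only [T, map_sub]; abel
    have h1 := hLip x (by simpa using lt_of_le_of_lt hx hσ2) x' (by simpa using lt_of_le_of_lt hx' hσ2)
    have h2 : ‖Λ (S x - S x')‖ ≤ (1 / 4) * ‖x - x'‖ := by
      calc ‖Λ (S x - S x')‖ ≤ ‖Λ‖ * (η * ‖x - x'‖) :=
            (Λ.le_opNorm _).trans (by gcongr; exact hS x x' (hx.trans hσ1) (hx'.trans hσ1))
        _ = (‖Λ‖ * η) * ‖x - x'‖ := by ring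
        _ ≤ (1 / 4) * ‖x - x'‖ := by
          gcongr; linarith
    rw [e]
    exact (norm_add_le _ _).trans (by linarith)
  have hT0 : ‖T 0‖ ≤ σ / 4 := by
    simp only [T, hB0, add_zero]
    exact (Λ.le_opNorm _).trans (le_trans (by gcongr) hΛη)
  have hmaps : Set.MapsTo T (Metric.closedBall 0 σ) (Metric.closedBall 0 σ) := by
    intro x hx
    rw [mem_closedBall_zero_iff] at hx ⊢
    have h1 := hT x 0 hx (by simpa using hσp.le)
    rw [sub_zero] at h1
    have : ‖T x‖ ≤ ‖T x - T 0‖ + ‖T 0‖ := by simpa using norm_add_le (T x - T 0) (T 0)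
    linarith
  have hcontr : ContractingWith (1 / 2) (hmaps.restrict T _ _) := by
    refine ⟨by
      rw [← NNReal.coe_lt_coe]; norm_num, LipschitzWith.of_dist_le_mul fun x x' => ?_⟩
    have h := hT x x' (mem_closedBall_zero_iff.1 x.2) (mem_closedBall_zero_iff.1 x'.2)
    simp only [Subtype.dist_eq, dist_eq_norm]
    simpa using h
  obtain ⟨x, hx, hfix, -⟩ := hcontr.exists_fixedPoint' (Metric.isClosed_closedBall.isComplete) hmaps
    (x := 0) (Metric.mem_closedBall_self hσp.le) (edist_ne_top _ _)
  exact ⟨x, (mem_closedBall_zero_iff.1 hx).trans hσ1, hfix⟩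

/-- the nonlinear algebraic fixed point in the Banach algebra -/
theorem fp_alg (C : ℝ) (hC0 : 0 ≤ C) (M : Fin n → (Fin n →₀ ℕ) → ℂ) (hM : ∀ l β, ‖M l β‖ ≤ C)
    (m : Fin r → Fin n → (Fin n →₀ ℕ) → ℂ) (hm : ∀ j l β, ‖m j l β‖ ≤ C)
    (sel : Fin r → Fin n → (Fin n →₀ ℕ) → ℂ) (hsel : ∀ j l β, ‖sel j l β‖ ≤ C)
    (ri : (Fin n →₀ ℕ) → ℂ) (hri : ∀ β, ‖ri β‖ ≤ C) (K : Fin r → Fin n → ℂ)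
    (R : Fin r → Fin n → (Fin n → W n) → W n) (hR0 : ∀ i l, R i l 0 = 0)
    (hR : ∀ i l, HasStrictFDerivAt (R i l) (0 : (Fin n → W n) →L[ℂ] W n) 0)
    (O : Set (Fin n → W n)) (hO : O ∈ 𝓝 0) :
    ∃ t : ℝ, 0 < t ∧ ∃ (u h : Fin n → W n) (g : Fin r → Fin r → W n) (v : Fin r → Fin n → W n)
      (S : Fin r → Fin n → W n),
      (∀ l β, co (u l) β = M l β * co (h l) β) ∧
      (∀ j l β, co (v j l) β = m j l β * co (h l) β) ∧
      (fun l => (t : ℂ) • (Xw l + u l)) ∈ O ∧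
      (∀ i l, (t : ℂ) • S i l = R i l (fun l => (t : ℂ) • (Xw l + u l))) ∧
      (∀ l β, co (h l) β = ∑ i, sel i l β * co (S i l - ∑ j, g i j * v j l) β) ∧
      (∀ i j γ, co (g i j) γ = ∑ l, K j l * (ri γ * co (S i l) (γ + Finsupp.single l 1))) := by
  classical
  let uL : Fin n → W n →L[ℂ] W n := fun l => mult (M l) C (hM l)
  let vL : Fin r → Fin n → W n →L[ℂ] W n := fun j l => mult (m j l) C (hm j l)
  let sL : Fin r → Fin n → W n →L[ℂ] W n := fun j l => mult (sel j l) C (hsel j l)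
  let rL : W n →L[ℂ] W n := mult ri C hri
  let B : (Fin n → W n) × (Fin r → Fin r → W n) → (Fin n → W n) × (Fin r → Fin r → W n) :=
    fun x => (fun l => - ∑ i, sL i l (∑ j, x.2 i j * vL j l (x.1 l)), 0)
  let Λ : (Fin r → Fin n → W n) →L[ℂ] (Fin n → W n) × (Fin r → Fin r → W n) :=
    ContinuousLinearMap.prod
      (ContinuousLinearMap.pi fun l => ∑ i, (sL i l).comp
        ((ContinuousLinearMap.proj (R := ℂ) (φ := fun _ : Fin n => W n) l).comp
          (ContinuousLinearMap.proj (R := ℂ) (φ := fun _ : Fin r => Fin n → W n) i)))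
      (ContinuousLinearMap.pi fun i => ContinuousLinearMap.pi fun j => ∑ l, K j l • (rL.comp ((shift (Finsupp.single l 1)).comp
        ((ContinuousLinearMap.proj (R := ℂ) (φ := fun _ : Fin n => W n) l).comp
          (ContinuousLinearMap.proj (R := ℂ) (φ := fun _ : Fin r => Fin n → W n) i)))))
  have hB : ContDiff ℂ 1 B := by
    refine ContDiff.prodMk (contDiff_pi.2 fun l => ?_) contDiff_const
    refine ContDiff.neg (ContDiff.sum fun i _ => ?_)
    refine (sL i l).contDiff.comp (ContDiff.sum fun j _ => ?_)
    have h1 : ContDiff ℂ 1 fun x : (Fin n → W n) × (Fin r → Fin r → W n) => x.2 i j :=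
      (contDiff_apply_apply ℂ (W n) i j).comp contDiff_snd
    have h2 : ContDiff ℂ 1 fun x : (Fin n → W n) × (Fin r → Fin r → W n) => vL j l (x.1 l) :=
      (vL j l).contDiff.comp ((contDiff_apply ℂ (W n) l).comp contDiff_fst)
    exact h1.mul h2
  have hBq : ∀ (s : ℂ) x, B (s • x) = s ^ 2 • B x := by
    intro s x
    refine Prod.ext ?_ (by simp [B])
    ext1 l
    simp only [B, Prod.smul_fst, Prod.smul_snd, Pi.smul_apply, map_smul, smul_neg, Finset.smul_sum, map_sum]
    congr 1
    refine Finset.sum_congr rfl fun i _ => Finset.sum_congr rfl fun j _ => ?_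
    rw [smul_mul_smul_comm, map_smul, sq]
  obtain ⟨η, hη, hfp⟩ := fp_abstract Λ B (by simpa using hBq 0 0) (strict_of_quadratic B hB hBq)
  -- Lipschitz constant for R
  set Xv : Fin n → W n := fun l => Xw l with hXv
  set ε := η / ((C + 1) * (1 + ‖Xv‖)) with hε
  have hεp : 0 < ε := by positivity
  obtain ⟨δ, hδ, hδO, hLip⟩ : ∃ δ > 0, Metric.ball (0 : Fin n → W n) δ ⊆ O ∧
      ∀ x ∈ Metric.ball (0 : Fin n → W n) δ, ∀ x' ∈ Metric.ball (0 : Fin n → W n) δ,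
      ∀ i l, ‖R i l x - R i l x'‖ ≤ ε * ‖x - x'‖ := by
    have h1 : ∀ᶠ p : (Fin n → W n) × (Fin n → W n) in 𝓝 0 ×ˢ 𝓝 0,
        ∀ i l, ‖R i l p.1 - R i l p.2‖ ≤ ε * ‖p.1 - p.2‖ := by
      rw [eventually_all]; intro i
      rw [eventually_all]; intro l
      have := (hR i l).isLittleO.bound hεp
      rw [nhds_prod_eq] at this
      simpa using this
    obtain ⟨u, hu, v, hv, huv⟩ := Filter.mem_prod_iff.1 h1
    obtain ⟨δ, hδ, h⟩ := Metric.mem_nhds_iff.1 (Filter.inter_mem hO (Filter.inter_mem hu hv))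
    exact ⟨δ, hδ, fun x hx => (h hx).1, fun x hx x' hx' => huv (Set.mk_mem_prod (h hx).2.1 (h hx').2.2)⟩
  set t : ℝ := δ / (2 * (‖Xv‖ + C + 1)) with ht
  have hden : 0 < ‖Xv‖ + C + 1 := by positivity
  have htp : 0 < t := by positivity
  have htc : (t : ℂ) ≠ 0 := by exact_mod_cast htp.ne'
  have huLn : ∀ (x x' : Fin n → W n), ‖(fun l => uL l (x l)) - (fun l => uL l (x' l))‖ ≤ C * ‖x - x'‖ := by
    intro x x'
    rw [pi_norm_le_iff_of_nonneg (by positivity)]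
    intro l
    simp only [Pi.sub_apply, ← map_sub]
    refine ((uL l).le_of_opNorm_le (LinearMap.mkContinuous_norm_le _ hC0 _) _).trans ?_
    gcongr
    exact norm_le_pi_norm (x - x') l
  let arg : (Fin n → W n) × (Fin r → Fin r → W n) → Fin n → W n :=
    fun x => (t : ℂ) • (Xv + fun l => uL l (x.1 l))
  have harg : ∀ x, ‖x‖ ≤ 1 → arg x ∈ Metric.ball (0 : Fin n → W n) δ := by
    intro x hx
    rw [mem_ball_zero_iff, norm_smul, Complex.norm_real, Real.norm_of_nonneg htp.le]
    have h1 := huLn x.1 0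
    simp only [Pi.zero_apply, map_zero, sub_zero] at h1
    have h2 : ‖fun l => uL l (x.1 l)‖ ≤ C := by
      have : ((fun l => uL l (x.1 l)) - fun _ => (0 : W n)) = fun l => uL l (x.1 l) := by
        ext1 l; simp
      rw [this] at h1
      exact h1.trans (mul_le_of_le_one_right hC0 ((norm_fst_le x).trans hx))
    calc t * ‖Xv + fun l => uL l (x.1 l)‖ ≤ t * (‖Xv‖ + C + 1) := by
          gcongr
          exact (norm_add_le _ _).trans (by linarith)
      _ = δ / 2 := by rw [ht]; field_simp
      _ < δ := by linarith
  have hargL : ∀ x x', ‖arg x - arg x'‖ ≤ t * (C * ‖x - x'‖) := by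
    intro x x'
    simp only [arg]
    rw [← smul_sub, norm_smul, Complex.norm_real, Real.norm_of_nonneg htp.le, add_sub_add_left_eq_sub]
    gcongr
    refine (huLn x.1 x'.1).trans ?_
    gcongr
    exact norm_fst_le (x - x')
  let S : (Fin n → W n) × (Fin r → Fin r → W n) → Fin r → Fin n → W n :=
    fun x i l => (t : ℂ)⁻¹ • R i l (arg x)
  have hS0 : ‖S 0‖ ≤ η := by
    rw [pi_norm_le_iff_of_nonneg (by positivity)]
    intro i
    rw [pi_norm_le_iff_of_nonneg (by positivity)]
    intro l
    simp only [S]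
    rw [norm_smul, norm_inv, Complex.norm_real, Real.norm_of_nonneg htp.le]
    have h1 := hLip (arg 0) (harg 0 (by simp)) 0 (Metric.mem_ball_self hδ) i l
    rw [hR0, sub_zero, sub_zero] at h1
    have h2 : ‖arg 0‖ = t * ‖Xv‖ := by
      simp only [arg, Prod.fst_zero, Pi.zero_apply, map_zero]
      rw [norm_smul, Complex.norm_real, Real.norm_of_nonneg htp.le]
      congr 2
      ext1 l; simp
    rw [h2] at h1
    rw [inv_mul_le_iff₀ htp]
    refine h1.trans ?_
    have h3 : ε * (1 + ‖Xv‖) ≤ η := by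
      have : ε * (1 + ‖Xv‖) = η / (C + 1) := by rw [hε]; field_simp
      rw [this]; exact div_le_self hη.le (by linarith)
    calc ε * (t * ‖Xv‖) ≤ t * (ε * (1 + ‖Xv‖)) := by
          have : 0 ≤ t * ε := by positivity
          nlinarith
      _ ≤ _ := by gcongr
  have hSL : ∀ x x', ‖x‖ ≤ 1 → ‖x'‖ ≤ 1 → ‖S x - S x'‖ ≤ η * ‖x - x'‖ := by
    intro x x' hx hx'
    rw [pi_norm_le_iff_of_nonneg (by positivity)]
    intro i
    rw [pi_norm_le_iff_of_nonneg (by positivity)]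
    intro l
    simp only [S, Pi.sub_apply]
    rw [← smul_sub, norm_smul, norm_inv, Complex.norm_real, Real.norm_of_nonneg htp.le, inv_mul_le_iff₀ htp]
    have h1 := hLip _ (harg x hx) _ (harg x' hx') i l
    have h3 : ε * C ≤ η := by
      have : ε * ((C + 1) * (1 + ‖Xv‖)) = η := by rw [hε]; field_simp
      have h4 : C ≤ (C + 1) * (1 + ‖Xv‖) := by nlinarith [norm_nonneg Xv]
      calc ε * C ≤ ε * ((C + 1) * (1 + ‖Xv‖)) := by gcongr
        _ = η := this
    calc _ ≤ ε * (t * (C * ‖x - x'‖)) := h1.trans (by gcongr; exact hargL x x')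
      _ = t * ((ε * C) * ‖x - x'‖) := by ring
      _ ≤ _ := by gcongr
  obtain ⟨x, hx, hfix⟩ := hfp S hS0 hSL
  refine ⟨t, htp, fun l => uL l (x.1 l), x.1, x.2, fun j l => vL j l (x.1 l), S x, fun _ _ => rfl,
    fun _ _ _ => rfl, hδO (harg x hx), fun i l => ?_, fun l β => ?_, fun i j γ => ?_⟩
  · simp only [S]
    rw [smul_smul, mul_inv_cancel₀ htc, one_smul]
    rfl
  · have h1 := congrArg (fun x => coL β (x.1 l)) hfix
    simp only [Λ, B, Prod.fst_add, Pi.add_apply, map_add] at h1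
    rw [← coL_apply, ← h1]
    simp only [ContinuousLinearMap.prod_apply, ContinuousLinearMap.pi_apply, sum_apply,
      ContinuousLinearMap.comp_apply, ContinuousLinearMap.proj_apply, map_sum, map_neg]
    rw [← sub_eq_add_neg, ← Finset.sum_sub_distrib]
    refine Finset.sum_congr rfl fun i _ => ?_
    rw [← coL_apply, map_sub, map_sum, mul_sub, Finset.mul_sum]
    rfl
  · have h1 := congrArg (fun x => coL γ (x.2 i j)) hfix
    simp only [Λ, B, Prod.snd_add, Pi.add_apply, map_add] at h1
    rw [← coL_apply, ← h1]
    simp only [ContinuousLinearMap.prod_apply, ContinuousLinearMap.pi_apply, sum_apply,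
      ContinuousLinearMap.comp_apply, ContinuousLinearMap.proj_apply, map_sum, Pi.zero_apply, map_zero, add_zero]
    refine Finset.sum_congr rfl fun l _ => ?_
    rfl

end GeoLin

namespace GeoLin
open Filter Topology

variable {n r q : ℕ}

theorem Rep.eventuallyEq {f g : (Fin n → ℂ) → ℂ} {a} (hf : Rep f a) (hg : Rep g a) : f =ᶠ[𝓝 0] g := by
  have := hf.sub hg
  simp only [sub_self] at this
  filter_upwards [this.eventually_zero] with z hz
  exact sub_eq_zero.1 hz

theorem Rep.lowdeg {f : (Fin n → ℂ) → ℂ} {a} (hf : Rep f a) (h0 : f 0 = 0)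
    (hd : HasFDerivAt f (0 : (Fin n → ℂ) →L[ℂ] ℂ) 0) : ∀ α, α.degree ≤ 1 → a α = 0 := by
  have key := hf.order_of_lim (M := 1) (Q := fun _ => 0) (fun y => by
    have h3 : HasDerivAt (fun s : ℂ => f (s • y)) 0 0 := by
      have hc : HasDerivAt (fun s : ℂ => s • y) y 0 := by
        simpa using (hasDerivAt_id (0 : ℂ)).smul_const y
      have h4 : HasFDerivAt f (0 : (Fin n → ℂ) →L[ℂ] ℂ) ((0 : ℂ) • y) := by
        rw [zero_smul]; exact hd
      exact h4.comp_hasDerivAt (0 : ℂ) hc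
    rw [hasDerivAt_iff_tendsto_slope] at h3
    refine h3.congr fun s => ?_
    simp [slope, h0])
  intro α hα
  rcases Nat.lt_or_ge α.degree 1 with h | h
  · exact key.1 α h
  · exact hom_eq_zero key.2 α (by omega)

theorem rep_ev (A : W n) (t : ℝ) (ht : 0 < t) :
    Rep (fun y => ev A ((t : ℂ)⁻¹ • y)) (fun α => co A α * ((t : ℂ)⁻¹) ^ α.degree) := by
  have htc : (t : ℂ) ≠ 0 := by exact_mod_cast ht.ne'
  refine ⟨t, RepOn.ofW ht A (fun α => ?_) (fun y _ => ?_)⟩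
  · rw [mul_assoc, ← mul_pow, inv_mul_cancel₀ htc, one_pow, mul_one]
  · rw [smul_smul, inv_mul_cancel₀ htc, one_smul]

theorem co_mul_Xw (g : W n) (l : Fin n) (γ) : co (g * Xw l) (γ + Finsupp.single l 1) = co g γ := by
  rw [co_mul, Finset.sum_eq_single (γ, Finsupp.single l 1)]
  · simp [co_Xw]
  · rintro ⟨x1, x2⟩ hx hne
    have hx := Finset.HasAntidiagonal.mem_antidiagonal.1 hx
    simp only at hx
    by_cases h : x2 = Finsupp.single l 1
    · exfalso; apply hne
      subst h
      rw [add_right_cancel hx]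
    · simp [h, co_Xw]
  · intro h; exfalso; apply h
    rw [Finset.HasAntidiagonal.mem_antidiagonal]

theorem co_mul_Xw_zero (g : W n) (l : Fin n) (β : Fin n →₀ ℕ) (hβ : β l = 0) : co (g * Xw l) β = 0 := by
  rw [co_mul]
  refine Finset.sum_eq_zero fun x hx => ?_
  have hx := Finset.HasAntidiagonal.mem_antidiagonal.1 hx
  by_cases h : x.2 = Finsupp.single l 1
  · exfalso
    have := congrArg (fun v => v l) hx
    simp [h, hβ] at this
  · simp [h, co_Xw]

theorem sub_single_add (β : Fin n →₀ ℕ) (l : Fin n) (h : β l ≠ 0) :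
    ∃ γ, β = γ + Finsupp.single l 1 := by
  refine ⟨β - Finsupp.single l 1, ?_⟩
  ext s
  by_cases hs : s = l
  · subst hs; simp; omega
  · simp [Ne.symm hs]

/-- divisors -/
noncomputable def mu (L : Fin r → Fin n → ℂ) (i : Fin r) (l : Fin n) (β : Fin n →₀ ℕ) : ℂ :=
  lam (L i) β - L i l

theorem ev_sum {y : Fin n → ℂ} (hy : ‖y‖ ≤ 1) {ι : Type*} (s : Finset ι) (f : ι → W n) :
    ev (∑ i ∈ s, f i) y = ∑ i ∈ s, ev (f i) y := by
  exact map_sum (evA y hy) f s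

theorem ev_sub {y : Fin n → ℂ} (hy : ‖y‖ ≤ 1) (a b : W n) : ev (a - b) y = ev a y - ev b y := by
  simpa using map_sub (evA y hy) a b

theorem co_sum {ι : Type*} (s : Finset ι) (f : ι → W n) (α) :
    co (∑ i ∈ s, f i) α = ∑ i ∈ s, co (f i) α := by
  exact map_sum (coL α) f s

theorem approx_normal (L K : Fin r → Fin n → ℂ)
    (hKL : ∀ j i, ∑ l, K j l * L i l = if j = i then 1 else 0)
    (c : ℝ) (hc0 : 0 < c)
    (hc : ∀ w : Fin n → ℤ, (∀ i, ∑ l, L i l * (w l : ℂ) = 0) ∨ ∃ i, c ≤ ‖∑ l, L i l * (w l : ℂ)‖)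
    (Z : Fin r → (Fin n → ℂ) → (Fin n → ℂ)) (hZan : ∀ i, AnalyticAt ℂ (Z i) 0)
    (hZ0 : ∀ i, Z i 0 = 0) (hZ1 : ∀ i v, fderiv ℂ (Z i) 0 v = L i * v) :
    ∃ (ψ : (Fin n → ℂ) → (Fin n → ℂ)) (f : Fin r → Fin r → (Fin n → ℂ) → ℂ)
      (Ψ : Fin n → (Fin n →₀ ℕ) → ℂ) (Fc : Fin r → Fin r → (Fin n →₀ ℕ) → ℂ)
      (E : Fin r → Fin n → (Fin n →₀ ℕ) → ℂ),
      (∀ l, Rep (fun y => ψ y l) (Ψ l)) ∧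
      (∀ l α, α.degree ≤ 1 → Ψ l α = if α = Finsupp.single l 1 then 1 else 0) ∧
      (∀ i j, Rep (f i j) (Fc i j)) ∧
      (∀ i j α, (∃ s, lam (L s) α ≠ 0) → Fc i j α = 0) ∧
      (∀ i j, Fc i j 0 = if i = j then 1 else 0) ∧
      (∀ i l, Rep (fun y => ∑ j, f i j y * fderiv ℂ (fun y => ψ y l) y (L j * y) - Z i (ψ y) l) (E i l)) ∧
      (∀ i l α, α.degree ≤ 1 → E i l α = 0) ∧
      (∀ l β, (∃ i, mu L i l β ≠ 0) → ∃ i, mu L i l β ≠ 0 ∧ E i l β = 0) ∧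
      (∀ γ, (∀ s, lam (L s) γ = 0) → ∀ i j, ∑ l, K j l * E i l (γ + Finsupp.single l 1) = 0) := by
  classical
  -- maximal divisor
  have hmax : ∀ l β, (∃ i, mu L i l β ≠ 0) → ∃ i, c ≤ ‖mu L i l β‖ ∧ ∀ j, ‖mu L j l β‖ ≤ ‖mu L i l β‖ := by
    intro l β ⟨i0, hi0⟩
    have hne : (Finset.univ : Finset (Fin r)).Nonempty := ⟨i0, Finset.mem_univ _⟩
    obtain ⟨i, -, hi⟩ := Finset.exists_max_image Finset.univ (fun i => ‖mu L i l β‖) hne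
    refine ⟨i, ?_, fun j => hi j (Finset.mem_univ _)⟩
    have hw : ∀ i, ∑ s, L i s * (((β s : ℤ) - (if s = l then 1 else 0) : ℤ) : ℂ) = mu L i l β := by
      intro i
      simp [mu, lam, mul_sub, Finset.sum_sub_distrib]
    rcases hc (fun s => (β s : ℤ) - (if s = l then 1 else 0)) with h | ⟨i1, h⟩
    · exact absurd ((hw i0).symm.trans (h i0)) hi0
    · rw [hw i1] at h
      exact h.trans (hi i1 (Finset.mem_univ _))
  choose ist hist1 hist2 using hmax
  let N : Fin n → (Fin n →₀ ℕ) → Prop := fun l β => 2 ≤ β.degree ∧ ∃ i, mu L i l β ≠ 0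
  let M : Fin n → (Fin n →₀ ℕ) → ℂ := fun l β =>
    if h : N l β then (mu L (ist l β h.2) l β)⁻¹ else 0
  let m : Fin r → Fin n → (Fin n →₀ ℕ) → ℂ := fun j l β => lam (L j) β * M l β
  let sel : Fin r → Fin n → (Fin n →₀ ℕ) → ℂ := fun i l β =>
    if h : N l β then (if i = ist l β h.2 then 1 else 0) else 0
  let ri : (Fin n →₀ ℕ) → ℂ := fun γ => if 1 ≤ γ.degree ∧ ∀ s, lam (L s) γ = 0 then 1 else 0
  let C : ℝ := 1 + c⁻¹ + ‖L‖ * c⁻¹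
  have hC1 : 1 ≤ C := by
    have : 0 ≤ ‖L‖ * c⁻¹ := by positivity
    have : 0 ≤ c⁻¹ := by positivity
    simp only [C]; linarith
  have hM : ∀ l β, ‖M l β‖ ≤ c⁻¹ := by
    intro l β
    simp only [M]
    split_ifs with h
    · rw [norm_inv]
      exact inv_anti₀ hc0 (hist1 l β h.2)
    · simpa using (inv_pos.2 hc0).le
  have hMC : ∀ l β, ‖M l β‖ ≤ C := fun l β => (hM l β).trans (by
    have : 0 ≤ ‖L‖ * c⁻¹ := by positivity
    simp only [C]; linarith)
  have hmC : ∀ j l β, ‖m j l β‖ ≤ C := by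
    intro j l β
    have e : m j l β = mu L j l β * M l β + L j l * M l β := by simp only [m, mu]; ring
    rw [e]
    have h1 : ‖mu L j l β * M l β‖ ≤ 1 := by
      simp only [M]
      split_ifs with h
      · rw [norm_mul, norm_inv]
        have hp : 0 < ‖mu L (ist l β h.2) l β‖ := hc0.trans_le (hist1 l β h.2)
        rw [← div_eq_mul_inv, div_le_one hp]
        exact hist2 l β h.2 j
      · simp
    have h2 : ‖L j l * M l β‖ ≤ ‖L‖ * c⁻¹ := by
      rw [norm_mul]
      exact mul_le_mul ((norm_le_pi_norm (L j) l).trans (norm_le_pi_norm L j)) (hM l β)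
        (norm_nonneg _) (norm_nonneg _)
    refine (norm_add_le _ _).trans ?_
    have : 0 ≤ c⁻¹ := by positivity
    simp only [C]; linarith
  have hselC : ∀ j l β, ‖sel j l β‖ ≤ C := by
    intro j l β
    refine le_trans ?_ hC1
    simp only [sel]
    split_ifs <;> simp
  have hriC : ∀ β, ‖ri β‖ ≤ C := by
    intro β
    refine le_trans ?_ hC1
    simp only [ri]
    split_ifs <;> simp
  -- nonlinear parts
  let R : Fin r → Fin n → (Fin n → ℂ) → ℂ := fun i l z => Z i z l - L i l * z l
  have hRan : ∀ i l, AnalyticAt ℂ (R i l) 0 := by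
    intro i l
    have h1 : AnalyticAt ℂ (fun z => Z i z l) 0 :=
      (ContinuousLinearMap.proj (R := ℂ) (φ := fun _ : Fin n => ℂ) l).analyticAt _ |>.comp (hZan i)
    have h2 : AnalyticAt ℂ (fun z : Fin n → ℂ => z l) 0 :=
      (ContinuousLinearMap.proj (R := ℂ) (φ := fun _ : Fin n => ℂ) l).analyticAt _
    exact h1.sub (analyticAt_const.mul h2)
  have hR0 : ∀ i l, R i l 0 = 0 := fun i l => by simp [R, hZ0]
  have hRd : ∀ i l, HasFDerivAt (R i l) (0 : (Fin n → ℂ) →L[ℂ] ℂ) 0 := by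
    intro i l
    have h1 : HasFDerivAt (fun z => Z i z l) ((ContinuousLinearMap.proj l).comp (fderiv ℂ (Z i) 0)) 0 :=
      (ContinuousLinearMap.proj (R := ℂ) (φ := fun _ : Fin n => ℂ) l).hasFDerivAt.comp _
        (hZan i).differentiableAt.hasFDerivAt
    have h2 : HasFDerivAt (fun z : Fin n → ℂ => L i l * z l)
        (L i l • (ContinuousLinearMap.proj (R := ℂ) (φ := fun _ : Fin n => ℂ) l)) 0 :=
      (ContinuousLinearMap.proj (R := ℂ) (φ := fun _ : Fin n => ℂ) l).hasFDerivAt.const_mul _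
    have h3 := h1.sub h2
    have e : (ContinuousLinearMap.proj (R := ℂ) (φ := fun _ : Fin n => ℂ) l).comp (fderiv ℂ (Z i) 0) -
        (L i l • (ContinuousLinearMap.proj (R := ℂ) (φ := fun _ : Fin n => ℂ) l)) = 0 := by
      ext v
      simp [hZ1]
    rw [e] at h3
    exact h3
  choose Rt hRt1 hRt2 hRt3 hRt4 using fun i l => exists_lift (R i l) (hRan i l)
  obtain ⟨t, ht, u, h, g, v, S, hu, hv, hO, hS, hh, hg⟩ := fp_alg C (by linarith) M hMC m hmC sel hselC
    ri hriC K Rt (fun i l => hRt2 i l (hR0 i l)) (fun i l => hRt3 i l (hRd i l).fderiv)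
    {a | ∀ i l, ∀ y : Fin n → ℂ, ‖y‖ ≤ 1 → ev (Rt i l a) y = R i l (fun l => ev (a l) y)}
    (by
      rw [← Filter.eventually_iff, eventually_all]; intro i
      rw [eventually_all]; intro l
      exact hRt4 i l)
  have htc : (t : ℂ) ≠ 0 := by exact_mod_cast ht.ne'
  let τ : ℂ := (t : ℂ)⁻¹
  -- supports
  have hMz : ∀ l β, ¬ N l β → M l β = 0 := fun l β h => by simp only [M]; rw [dif_neg h]
  have hu0 : ∀ l β, ¬ N l β → co (u l) β = 0 := fun l β h => by rw [hu, hMz l β h, zero_mul]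
  have hv0 : ∀ j l β, ¬ N l β → co (v j l) β = 0 := fun j l β h => by
    rw [hv]; simp only [m]; rw [hMz l β h, mul_zero, zero_mul]
  have hg0 : ∀ i j γ, ¬ (1 ≤ γ.degree ∧ ∀ s, lam (L s) γ = 0) → co (g i j) γ = 0 := by
    intro i j γ hγ
    rw [hg]
    refine Finset.sum_eq_zero fun l _ => ?_
    simp only [ri]; rw [if_neg hγ, zero_mul, mul_zero]
  let ψ : (Fin n → ℂ) → (Fin n → ℂ) := fun y l => (t : ℂ) * ev (Xw l + u l) (τ • y)
  let f : Fin r → Fin r → (Fin n → ℂ) → ℂ := fun i j y =>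
    ev ((if i = j then (1 : ℂ) else 0) • (1 : W n) + g i j) (τ • y)
  let Eh : Fin r → Fin n → W n := fun i l =>
    ∑ j, ((if i = j then (1 : ℂ) else 0) • (1 : W n) + g i j) * (L j l • Xw l + v j l)
      - L i l • (Xw l + u l) - S i l
  have hψ : ∀ l, Rep (fun y => ψ y l) (fun α => (t : ℂ) * (co (Xw l + u l) α * τ ^ α.degree)) :=
    fun l => (rep_ev (Xw l + u l) t ht).cmul t
  have hθ : ∀ j l, Rep (fun y => fderiv ℂ (fun y => ψ y l) y (L j * y))
      (fun α => (t : ℂ) * (co (L j l • Xw l + v j l) α * τ ^ α.degree)) := by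
    intro j l
    have := (hψ l).theta (L j)
    convert this using 1
    ext α
    have : co (L j l • Xw l + v j l) α = lam (L j) α * co (Xw l + u l) α := by
      rw [co_add, co_add, co_smul, hu, hv, mul_add]
      congr 1
      · rw [co_Xw]
        split_ifs with h
        · rw [h, lam_single]
        · simp
      · simp only [m]; ring
    rw [this]; ring
  have hball : ∀ᶠ y in 𝓝 (0 : Fin n → ℂ), ‖τ • y‖ ≤ 1 := by
    have h1 : Tendsto (fun y : Fin n → ℂ => ‖τ • y‖) (𝓝 0) (𝓝 0) := by
      have : Continuous (fun y : Fin n → ℂ => ‖τ • y‖) := by fun_prop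
      simpa using this.tendsto 0
    exact h1.eventually (Iic_mem_nhds one_pos)
  have hRψ : ∀ i l, (fun y => R i l (ψ y)) =ᶠ[𝓝 0] fun y => (t : ℂ) * ev (S i l) (τ • y) := by
    intro i l
    filter_upwards [hball] with y hy
    have h1 := hO i l (τ • y) hy
    rw [← hS, ev_smul] at h1
    rw [h1]
    congr 1
    ext s
    simp only [ψ]
    rw [ev_smul]
  have hErr : ∀ i l, Rep (fun y => ∑ j, f i j y * fderiv ℂ (fun y => ψ y l) y (L j * y) - Z i (ψ y) l)
      (fun α => (t : ℂ) * (co (Eh i l) α * τ ^ α.degree)) := by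
    intro i l
    refine ((rep_ev (Eh i l) t ht).cmul t).congr ?_
    have h1 : ∀ᶠ y in 𝓝 (0 : Fin n → ℂ), ∀ j, fderiv ℂ (fun y => ψ y l) y (L j * y) =
        (t : ℂ) * ev (L j l • Xw l + v j l) (τ • y) := by
      rw [eventually_all]
      intro j
      exact (hθ j l).eventuallyEq ((rep_ev (L j l • Xw l + v j l) t ht).cmul t)
    filter_upwards [hball, hRψ i l, h1] with y hy h2 h3
    have h4 : Z i (ψ y) l = L i l * ψ y l + (t : ℂ) * ev (S i l) (τ • y) := by
      rw [← h2]; simp only [R]; ring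
    rw [h4]
    simp only [h3]
    have hτ : (t : ℂ)⁻¹ • y = τ • y := rfl
    rw [hτ]
    simp only [Eh]
    rw [ev_sub hy, ev_sub hy, ev_sum hy, ev_smul, mul_sub, mul_sub, Finset.mul_sum, sub_sub]
    congr 1
    · refine Finset.sum_congr rfl fun j _ => ?_
      rw [ev_mul hy]; simp only [f]; ring
    · simp only [ψ]; ring
  -- low order of S
  have hSlow : ∀ i l α, α.degree ≤ 1 → co (S i l) α = 0 := by
    intro i l α hα
    have h1 := ((rep_ev (S i l) t ht).cmul t).congr (hRψ i l).symm
    have hψ0 : ψ 0 = 0 := by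
      ext s
      have h3 := (hψ s).hasFPowerSeriesAt.coeff_zero (fun _ => 0)
      rw [ser_apply, hom] at h3
      rw [← h3]
      refine Finset.sum_eq_zero fun β hβ => ?_
      have hβ := mem_degSet.1 hβ
      have e : co (Xw s + u s) β = 0 := by
        rw [co_add, hu0 s β (fun h => by have := h.1; omega), co_Xw, if_neg, add_zero]
        rintro rfl
        simp at hβ
      simp [e]
    have hψd : DifferentiableAt ℂ ψ 0 := differentiableAt_pi.2 fun s => (hψ s).analyticAt.differentiableAt
    have h2 := h1.lowdeg (by rw [hψ0]; exact hR0 i l) (by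
      have h3 := (hψ0.symm ▸ hRd i l : HasFDerivAt (R i l) (0 : (Fin n → ℂ) →L[ℂ] ℂ) (ψ 0)).comp
        (0 : Fin n → ℂ) hψd.hasFDerivAt
      rw [ContinuousLinearMap.zero_comp] at h3
      exact h3) α hα
    have hτ0 : ((t : ℂ)⁻¹) ^ α.degree ≠ 0 := pow_ne_zero _ (inv_ne_zero htc)
    rcases mul_eq_zero.1 h2 with h3 | h3
    · exact absurd h3 htc
    · rcases mul_eq_zero.1 h3 with h4 | h4
      · exact h4
      · exact absurd h4 hτ0
  -- formula for the error coefficients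
  have hEh : ∀ i l β, co (Eh i l) β = mu L i l β * M l β * co (h l) β +
      ∑ j, L j l * co (g i j * Xw l) β - co (S i l - ∑ j, g i j * v j l) β := by
    intro i l β
    have e : Eh i l = (v i l - L i l • u l) + ∑ j, L j l • (g i j * Xw l) - (S i l - ∑ j, g i j * v j l) := by
      have h1 : ∑ j, ((if i = j then (1 : ℂ) else 0) • (1 : W n) + g i j) * (L j l • Xw l + v j l) =
          (L i l • Xw l + v i l) + (∑ j, L j l • (g i j * Xw l) + ∑ j, g i j * v j l) := by
        have h2 : ∀ j, ((if i = j then (1 : ℂ) else 0) • (1 : W n) + g i j) * (L j l • Xw l + v j l) =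
            (if i = j then L j l • Xw l + v j l else 0) + (L j l • (g i j * Xw l) + g i j * v j l) := by
          intro j
          rw [add_mul, smul_mul_assoc, one_mul, mul_add (g i j), mul_smul_comm]
          split_ifs <;> simp
        simp only [h2]
        rw [Finset.sum_add_distrib, Finset.sum_add_distrib]
        simp
      simp only [Eh]
      rw [h1, smul_add]
      abel
    rw [e]
    rw [co_sub _ (S i l - ∑ j, g i j * v j l), co_add, co_sub, co_sum, co_smul, hu, hv]
    simp only [co_smul, m, mu]
    ring
  have hgX : ∀ i j l β, (∃ s, mu L s l β ≠ 0) → co (g i j * Xw l) β = 0 := by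
    intro i j l β ⟨s, hs⟩
    by_cases hβ : β l = 0
    · exact co_mul_Xw_zero _ _ _ hβ
    · obtain ⟨γ, rfl⟩ := sub_single_add β l hβ
      rw [co_mul_Xw]
      refine hg0 i j γ fun hγ => hs ?_
      rw [mu, lam_add, lam_single, hγ.2 s]; ring
  have hElow : ∀ i l α, α.degree ≤ 1 → co (Eh i l) α = 0 := by
      intro i l α hα
      rw [hEh, hMz l α (fun h => by have := h.1; omega), co_sub, hSlow i l α hα, co_sum]
      rw [Finset.sum_eq_zero, Finset.sum_eq_zero]
      · simp
      · intro j _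
        rw [co_mul]
        refine Finset.sum_eq_zero fun x hx => ?_
        have hx := Finset.HasAntidiagonal.mem_antidiagonal.1 hx
        rw [hv0 j l x.2, mul_zero]
        intro h
        have h1 := h.1
        have := congrArg Finsupp.degree hx
        rw [map_add] at this
        omega
      · intro j _
        by_cases hβ : α l = 0
        · rw [co_mul_Xw_zero _ _ _ hβ, mul_zero]
        · obtain ⟨γ, rfl⟩ := sub_single_add α l hβ
          rw [co_mul_Xw, hg0, mul_zero]
          intro h
          have h1 := h.1
          rw [map_add, Finsupp.degree_single] at hα
          omega
  refine ⟨ψ, f, fun l α => (t : ℂ) * (co (Xw l + u l) α * τ ^ α.degree),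
    fun i j α => co ((if i = j then (1 : ℂ) else 0) • (1 : W n) + g i j) α * τ ^ α.degree,
    fun i l α => (t : ℂ) * (co (Eh i l) α * τ ^ α.degree), hψ, ?_, fun i j => rep_ev _ t ht, ?_, ?_, hErr,
    ?_, ?_, ?_⟩
  · intro l α hα
    beta_reduce
    rw [co_add, hu0 l α (fun h => by have := h.1; omega), add_zero, co_Xw]
    split_ifs with h
    · subst h; simp [τ, htc]
    · simp
  · intro i j α ⟨s, hs⟩
    have hα : α ≠ 0 := by rintro rfl; simp [lam] at hs
    beta_reduce
    rw [co_add, co_smul, co_one, if_neg hα, hg0 i j α (fun h => hs (h.2 s))]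
    simp
  · intro i j
    beta_reduce
    rw [co_add, co_smul, co_one, if_pos rfl, hg0 i j 0 (fun h => by simp at h)]
    simp
  · intro i l α hα
    simp [hElow i l α hα]
  · intro l β hβ
    by_cases hd : 2 ≤ β.degree
    · have hN : N l β := ⟨hd, hβ⟩
      have hne : mu L (ist l β hβ) l β ≠ 0 := by
        rw [← norm_pos_iff]; exact hc0.trans_le (hist1 l β hβ)
      refine ⟨ist l β hβ, hne, ?_⟩
      have hz : co (Eh (ist l β hβ) l) β = 0 := by
        rw [hEh, Finset.sum_eq_zero (fun j _ => by rw [hgX _ _ _ _ hβ, mul_zero])]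
        have hMv : M l β = (mu L (ist l β hβ) l β)⁻¹ := by simp only [M]; rw [dif_pos hN]
        rw [hMv, mul_inv_cancel₀ hne, one_mul, add_zero, hh, Finset.sum_eq_single (ist l β hβ)]
        · simp only [sel]; rw [dif_pos hN, if_pos trivial, one_mul, sub_self]
        · intro i _ hi
          simp only [sel]; rw [dif_pos hN, if_neg hi, zero_mul]
        · simp
      simp [hz]
    · obtain ⟨i, hi⟩ := hβ
      refine ⟨i, hi, ?_⟩
      simp [hElow i l β (by omega)]
  · intro γ hγ i j
    beta_reduce
    by_cases hd : 1 ≤ γ.degree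
    · have hmu : ∀ l s, mu L s l (γ + Finsupp.single l 1) = 0 := by
        intro l s; rw [mu, lam_add, lam_single, hγ s]; ring
      have hNn : ∀ l, ¬ N l (γ + Finsupp.single l 1) := by
        rintro l ⟨-, s, hs⟩
        exact hs (hmu l s)
      have hz : ∀ l, co (Eh i l) (γ + Finsupp.single l 1) =
          ∑ j, L j l * co (g i j) γ - co (S i l) (γ + Finsupp.single l 1) := by
        intro l
        rw [hEh, hMz l _ (hNn l), co_sub, co_sum]
        simp only [co_mul_Xw]
        rw [Finset.sum_eq_zero (f := fun j => co (g i j * v j l) (γ + Finsupp.single l 1))]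
        · ring
        · intro j _
          rw [co_mul]
          refine Finset.sum_eq_zero fun x hx => ?_
          have hx := Finset.HasAntidiagonal.mem_antidiagonal.1 hx
          by_cases h1 : 1 ≤ x.1.degree ∧ ∀ s, lam (L s) x.1 = 0
          · rw [hv0 j l x.2, mul_zero]
            rintro ⟨-, s, hs⟩
            apply hs
            have := hmu l s
            rw [← hx, mu, lam_add, h1.2 s, zero_add] at this
            exact this
          · rw [hg0 _ _ _ h1, zero_mul]
      have hdeg : ∀ l, (γ + Finsupp.single l 1 : Fin n →₀ ℕ).degree = γ.degree + 1 := by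
        intro l; simp
      simp only [hdeg, hz]
      have e1 : ∑ l, K j l * ((t : ℂ) * ((∑ j, L j l * co (g i j) γ - co (S i l) (γ + Finsupp.single l 1)) *
          τ ^ (γ.degree + 1))) = (t : ℂ) * τ ^ (γ.degree + 1) *
          (∑ l, K j l * (∑ j, L j l * co (g i j) γ) - ∑ l, K j l * co (S i l) (γ + Finsupp.single l 1)) := by
        rw [← Finset.sum_sub_distrib, Finset.mul_sum]
        exact Finset.sum_congr rfl fun l _ => by ring
      have e2 : ∑ l, K j l * (∑ j, L j l * co (g i j) γ) = co (g i j) γ := by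
        simp only [Finset.mul_sum]
        rw [Finset.sum_comm]
        simp only [← mul_assoc, ← Finset.sum_mul, hKL]
        simp
      have e3 : co (g i j) γ = ∑ l, K j l * co (S i l) (γ + Finsupp.single l 1) := by
        rw [hg]
        simp only [ri]
        rw [if_pos ⟨hd, hγ⟩]
        simp
      rw [e1, e2, e3, sub_self, mul_zero]
    · refine Finset.sum_eq_zero fun l _ => ?_
      rw [hElow i l (γ + Finsupp.single l 1) (by rw [map_add, Finsupp.degree_single]; omega)]
      simp

end GeoLin

namespace GeoLin
open Filter Topology

variable {n r q : ℕ}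

theorem rep_fin (s : Finset (Fin n →₀ ℕ)) (a : (Fin n →₀ ℕ) → ℂ) (ha : ∀ α, α ∉ s → a α = 0) :
    Rep (fun y => ∑ α ∈ s, a α * mon y α) a := by
  refine ⟨1, one_pos, ?_, fun z _ => ?_⟩
  · refine summable_of_ne_finset_zero (s := s) fun α hα => ?_
    simp [ha α hα]
  · exact hasSum_sum_of_ne_finset_zero fun α hα => by simp [ha α hα]

theorem rep_hom (a : (Fin n →₀ ℕ) → ℂ) (k : ℕ) :
    Rep (hom a k) (fun α => if α.degree = k then a α else 0) := by
  have h := rep_fin (degSet n k) (fun α => if α.degree = k then a α else 0) (by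
    intro α hα
    rw [mem_degSet] at hα
    simp [hα])
  have e : hom a k = fun y => ∑ α ∈ degSet n k, (if α.degree = k then a α else 0) * mon y α := by
    ext y
    rw [hom]
    exact Finset.sum_congr rfl fun α hα => by rw [if_pos (mem_degSet.1 hα)]
  rw [e]; exact h

theorem rep_mon (o : Fin n →₀ ℕ) : Rep (fun y => mon y o) (fun α => if α = o then 1 else 0) := by
  have h := rep_fin {o} (fun α => if α = o then (1 : ℂ) else 0) (by
    intro α hα; simp at hα; simp [hα])
  have e : (fun y : Fin n → ℂ => mon y o) =
      fun y => ∑ α ∈ ({o} : Finset (Fin n →₀ ℕ)), (if α = o then (1 : ℂ) else 0) * mon y α := by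
    ext y; simp
  rw [e]; exact h

theorem conv_ind (o : Fin n →₀ ℕ) (a : (Fin n →₀ ℕ) → ℂ) (β) :
    ∑ x ∈ Finset.HasAntidiagonal.antidiagonal (β + o), (if x.1 = o then (1 : ℂ) else 0) * a x.2 = a β := by
  rw [Finset.sum_eq_single (o, β)]
  · simp
  · rintro ⟨x1, x2⟩ hx hne
    have hx := Finset.HasAntidiagonal.mem_antidiagonal.1 hx
    simp only at hx
    by_cases h : x1 = o
    · exfalso; apply hne
      subst h
      rw [add_comm] at hx
      rw [add_right_cancel hx]
    · simp [h]
  · intro h; exfalso; apply h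
    rw [Finset.HasAntidiagonal.mem_antidiagonal, add_comm]

theorem conv_ind_zero (o : Fin n →₀ ℕ) (a : (Fin n →₀ ℕ) → ℂ) (δ : Fin n →₀ ℕ) (l) (h : δ l < o l) :
    ∑ x ∈ Finset.HasAntidiagonal.antidiagonal δ, (if x.1 = o then (1 : ℂ) else 0) * a x.2 = 0 := by
  refine Finset.sum_eq_zero fun x hx => ?_
  have hx := Finset.HasAntidiagonal.mem_antidiagonal.1 hx
  rw [if_neg, zero_mul]
  intro e
  have := congrArg (fun v => v l) hx
  simp [e] at this
  omega

theorem hom_congr {a b : (Fin n →₀ ℕ) → ℂ} {k : ℕ} (h : ∀ α, α.degree = k → a α = b α) (y) :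
    hom a k y = hom b k y := by
  rw [hom, hom]
  exact Finset.sum_congr rfl fun α hα => by rw [h α (mem_degSet.1 hα)]

theorem hom_lin {a b : (Fin n →₀ ℕ) → ℂ} {k : ℕ} (c d : ℂ) (y) :
    hom (fun α => c * a α + d * b α) k y = c * hom a k y + d * hom b k y := by
  rw [hom, hom, hom, Finset.mul_sum, Finset.mul_sum, ← Finset.sum_add_distrib]
  exact Finset.sum_congr rfl fun α hα => by ring

theorem fderiv_hom_smul (a : (Fin n →₀ ℕ) → ℂ) (k : ℕ) {t : ℂ} (ht : t ≠ 0) (y v : Fin n → ℂ) :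
    t * fderiv ℂ (hom a k) (t • y) v = t ^ k * fderiv ℂ (hom a k) y v := by
  have hd : ∀ y, DifferentiableAt ℂ (hom a k) y := fun y => (mon_poly_analytic a k y).differentiableAt
  have h1 : HasFDerivAt (fun y => hom a k (t • y))
      ((fderiv ℂ (hom a k) (t • y)).comp (t • ContinuousLinearMap.id ℂ (Fin n → ℂ))) y :=
    (hd (t • y)).hasFDerivAt.comp y ((hasFDerivAt_id y).const_smul t)
  have h2 : HasFDerivAt (fun y => hom a k (t • y)) (t ^ k • fderiv ℂ (hom a k) y) y := by
    have e : (fun y => hom a k (t • y)) = fun y => t ^ k * hom a k y := by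
      ext y; exact hom_smul a k t y
    rw [e]
    exact (hd y).hasFDerivAt.const_mul _
  have h3 := congrArg (fun T => T v) (h1.unique h2)
  simpa using h3

/-- the Euler-type operator on homogeneous parts -/
theorem hom_theta (a : (Fin n →₀ ℕ) → ℂ) (k : ℕ) (w y : Fin n → ℂ) :
    hom (fun α => lam w α * a α) k y = fderiv ℂ (hom a k) y (w * y) := by
  have h := ((rep_hom a k).theta w).order_of_lim (M := k) (Q := fun y => fderiv ℂ (hom a k) y (w * y)) (by
    intro y
    refine tendsto_const_nhds.congr' ?_
    filter_upwards [self_mem_nhdsWithin] with t ht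
    have ht : t ≠ 0 := ht
    have h1 := fderiv_hom_smul a k ht y (w * y)
    rw [mul_smul_comm, map_smul, smul_eq_mul, h1, ← mul_assoc, inv_mul_cancel₀ (pow_ne_zero _ ht), one_mul])
  rw [← h.2 y]
  exact hom_congr (fun α hα => by rw [if_pos hα]) y

theorem hom_pderiv (a : (Fin n →₀ ℕ) → ℂ) (k : ℕ) (l : Fin n) (y : Fin n → ℂ) :
    hom (fun α => ((α l : ℂ) + 1) * a (α + Finsupp.single l 1)) k y =
      fderiv ℂ (hom a (k + 1)) y (Pi.single l 1) := by
  have h := ((rep_hom a (k + 1)).pderiv l).order_of_lim (M := k)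
      (Q := fun y => fderiv ℂ (hom a (k + 1)) y (Pi.single l 1)) (by
    intro y
    refine tendsto_const_nhds.congr' ?_
    filter_upwards [self_mem_nhdsWithin] with t ht
    have ht : t ≠ 0 := ht
    have h1 := fderiv_hom_smul a (k + 1) ht y (Pi.single l 1)
    rw [pow_succ', mul_assoc] at h1
    have h2 := mul_left_cancel₀ ht h1
    rw [h2, ← mul_assoc, inv_mul_cancel₀ (pow_ne_zero _ ht), one_mul])
  rw [← h.2 y]
  exact hom_congr (fun α hα => by rw [if_pos (by simp [hα])]) y

theorem ker_span (L : Fin r → Fin n → ℂ) (hL : LinearIndependent ℂ L) (hn : n = r + q)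
    (u : Fin q → Fin n → ℂ) (hu : LinearIndependent ℂ u)
    (hu2 : ∀ j i, ∑ l, L i l * u j l = 0) (v : Fin n → ℂ)
    (hv : ∀ i, ∑ l, L i l * v l = 0) : v ∈ Submodule.span ℂ (Set.range u) := by
  set Lm : (Fin n → ℂ) →ₗ[ℂ] (Fin r → ℂ) := Matrix.mulVecLin (Matrix.of L) with hLm
  have hLa : ∀ v i, Lm v i = ∑ l, L i l * v l := by
    intro v i; simp [hLm, Matrix.mulVec, dotProduct]
  have hle : Submodule.span ℂ (Set.range u) ≤ LinearMap.ker Lm := by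
    rw [Submodule.span_le]
    rintro _ ⟨j, rfl⟩
    rw [SetLike.mem_coe, LinearMap.mem_ker]
    ext i
    rw [hLa]; exact hu2 j i
  have hrank : Module.finrank ℂ (LinearMap.range Lm) = r := by
    have : (Matrix.of L).rank = r := by
      have := LinearIndependent.rank_matrix (M := Matrix.of L) hL
      simpa using this
    exact this
  have hker : Module.finrank ℂ (LinearMap.ker Lm) = q := by
    have := LinearMap.finrank_range_add_finrank_ker Lm
    rw [hrank] at this
    simp at this
    omega
  have h2 : q ≤ Module.finrank ℂ (Submodule.span ℂ (Set.range u)) := by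
    rw [finrank_span_eq_card hu]
    simp
  have h3 := Submodule.eq_of_le_of_finrank_le hle (by omega)
  rw [h3, LinearMap.mem_ker]
  ext i
  rw [hLa]; exact hv i

theorem fderiv_coords (f : (Fin n → ℂ) → ℂ) (y v : Fin n → ℂ) :
    fderiv ℂ f y v = ∑ l, v l * fderiv ℂ f y (Pi.single l 1) := by
  have h := pi_eq_sum_univ' v
  conv_lhs => rw [h]
  rw [map_sum]
  refine Finset.sum_congr rfl fun l _ => ?_
  rw [map_smul, smul_eq_mul]

/-- independence of the logarithmic gradients at a generic point -/
theorem u_indep (g : Fin q → (Fin n → ℂ) → ℂ) (y : Fin n → ℂ) (hy : ∀ l, y l ≠ 0)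
    (hg : LinearIndependent ℂ fun j => fderiv ℂ (g j) y) :
    LinearIndependent ℂ fun j => fun l => y l * fderiv ℂ (g j) y (Pi.single l 1) := by
  rw [Fintype.linearIndependent_iff] at hg ⊢
  intro c hc
  refine hg c ?_
  ext v
  rw [ContinuousLinearMap.sum_apply]
  simp only [ContinuousLinearMap.smul_apply, ContinuousLinearMap.zero_apply, smul_eq_mul]
  simp only [fderiv_coords _ y v, Finset.mul_sum]
  rw [Finset.sum_comm]
  refine Finset.sum_eq_zero fun l _ => ?_
  have h1 := congrFun hc l
  simp only [Finset.sum_apply, Pi.smul_apply, smul_eq_mul, Pi.zero_apply] at h1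
  have h2 : y l * ∑ j, c j * fderiv ℂ (g j) y (Pi.single l 1) = 0 := by
    rw [← h1, Finset.mul_sum]; exact Finset.sum_congr rfl fun j _ => by ring
  have h3 := (mul_eq_zero.1 h2).resolve_left (hy l)
  calc _ = v l * ∑ j, c j * fderiv ℂ (g j) y (Pi.single l 1) := by
        rw [Finset.mul_sum]; exact Finset.sum_congr rfl fun j _ => by ring
    _ = 0 := by rw [h3, mul_zero]

theorem dense_coords : Dense {y : Fin n → ℂ | ∀ l, y l ≠ 0} ∧ IsOpen {y : Fin n → ℂ | ∀ l, y l ≠ 0} := by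
  have e : {y : Fin n → ℂ | ∀ l, y l ≠ 0} = Set.pi Set.univ fun _ => {0}ᶜ := by
    ext y; simp
  rw [e]
  exact ⟨dense_pi _ fun l _ => dense_compl_singleton 0,
    isOpen_set_pi Set.finite_univ fun l _ => isOpen_compl_singleton⟩

theorem exists_K (L : Fin r → Fin n → ℂ) (hL : LinearIndependent ℂ L) :
    ∃ K : Fin r → Fin n → ℂ, ∀ j i, ∑ l, K j l * L i l = if j = i then 1 else 0 := by
  have hinj : LinearMap.ker (Matrix.vecMulLinear (Matrix.of L)) = ⊥ := by
    rw [LinearMap.ker_eq_bot]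
    have := Matrix.vecMul_injective_iff.2 (show LinearIndependent ℂ (Matrix.of L).row from hL)
    exact this
  obtain ⟨T, hT⟩ := LinearMap.exists_leftInverse_of_injective _ hinj
  refine ⟨fun j l => T (Pi.single l 1) j, fun j i => ?_⟩
  have h1 := congrArg (fun S => S (Pi.single i 1) j) hT
  simp only [LinearMap.comp_apply, LinearMap.id_apply, Matrix.vecMulLinear_apply,
    Matrix.single_one_vecMul] at h1
  have h2 : T (L i) j = ∑ l, T (Pi.single l 1) j * L i l := by
    conv_lhs => rw [pi_eq_sum_univ' (L i)]
    rw [map_sum, Finset.sum_apply]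
    refine Finset.sum_congr rfl fun l _ => ?_
    rw [map_smul, Pi.smul_apply, smul_eq_mul, mul_comm]
  rw [← h2]
  have h3 : (Matrix.of L).row i = L i := rfl
  rw [h3] at h1
  rw [h1]
  simp [Pi.single_apply]

end GeoLin

namespace GeoLin
open Filter Topology

variable {n r q : ℕ}

/-- leading term of a derivative along a vector-valued perturbation -/
theorem Rep.lead_fderiv {F : (Fin n → ℂ) → ℂ} {Φ} (hF : Rep F Φ) {d : ℕ}
    (hΦ : ∀ α, α.degree < d + 1 → Φ α = 0) {z v : ℂ → Fin n → ℂ} {y w : Fin n → ℂ} {N : ℕ}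
    (hz : Tendsto (fun t => t⁻¹ • z t) (𝓝[≠] 0) (𝓝 y))
    (hv : ∀ l, Tendsto (fun t => (t ^ N)⁻¹ * v t l) (𝓝[≠] 0) (𝓝 (w l))) :
    Tendsto (fun t => (t ^ (d + N))⁻¹ * fderiv ℂ F (z t) (v t)) (𝓝[≠] 0)
      (𝓝 (fderiv ℂ (hom Φ (d + 1)) y w)) := by
  have e1 : (fun t => (t ^ (d + N))⁻¹ * fderiv ℂ F (z t) (v t)) = fun t => ∑ l, ((t ^ N)⁻¹ * v t l) *
      ((t ^ d)⁻¹ * fderiv ℂ F (z t) (Pi.single l 1)) := by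
    ext t
    rw [fderiv_coords F (z t) (v t), Finset.mul_sum, pow_add, mul_inv]
    exact Finset.sum_congr rfl fun l _ => by ring
  rw [e1, fderiv_coords _ y w]
  refine tendsto_finsetSum _ fun l _ => (hv l).mul ?_
  rw [← hom_pderiv Φ d l y]
  refine (hF.pderiv l).lead (fun α hα => ?_) hz
  rw [hΦ _ (by simp; omega), mul_zero]

theorem res_F (L : Fin r → Fin n → ℂ)
    (Z : Fin r → (Fin n → ℂ) → (Fin n → ℂ)) (hZan : ∀ i, AnalyticAt ℂ (Z i) 0)
    (hZ0 : ∀ i, Z i 0 = 0) (hZ1 : ∀ i v, fderiv ℂ (Z i) 0 v = L i * v)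
    {F : (Fin n → ℂ) → ℂ} {Φ} (hF : Rep F Φ) {d : ℕ}
    (hΦ : ∀ α, α.degree < d + 1 → Φ α = 0)
    (hFZ : ∀ i, ∀ᶠ x in 𝓝 0, fderiv ℂ F x (Z i x) = 0) :
    ∀ i α, α.degree = d + 1 → lam (L i) α * Φ α = 0 := by
  intro i
  refine hom_eq_zero fun y => ?_
  rw [hom_theta]
  have h0 : Tendsto (fun t : ℂ => t⁻¹ • (t • y)) (𝓝[≠] 0) (𝓝 y) := by
    refine tendsto_const_nhds.congr' ?_
    filter_upwards [self_mem_nhdsWithin] with t ht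
    rw [smul_smul, inv_mul_cancel₀ ht, one_smul]
  have h1 : ∀ l, Tendsto (fun t : ℂ => (t ^ 1)⁻¹ * Z i (t • y) l) (𝓝[≠] 0) (𝓝 ((L i * y) l)) := by
    intro l
    have hc : HasDerivAt (fun s : ℂ => s • y) y 0 := by
      simpa using (hasDerivAt_id (0 : ℂ)).smul_const y
    have h4 : HasFDerivAt (Z i) (fderiv ℂ (Z i) 0) ((0 : ℂ) • y) := by
      rw [zero_smul]; exact (hZan i).differentiableAt.hasFDerivAt
    have h5 := h4.comp_hasDerivAt (0 : ℂ) hc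
    rw [hZ1, hasDerivAt_iff_tendsto_slope] at h5
    have h6 := (tendsto_pi_nhds.1 h5) l
    refine h6.congr fun s => ?_
    simp [slope, hZ0]
  have h2 := hF.lead_fderiv hΦ h0 h1
  refine tendsto_nhds_unique h2 ?_
  refine tendsto_const_nhds.congr' ?_
  have h3 : Tendsto (fun t : ℂ => t • y) (𝓝[≠] 0) (𝓝 0) := by
    have : Continuous (fun t : ℂ => t • y) := by fun_prop
    simpa using (this.tendsto 0).mono_left nhdsWithin_le_nhds
  filter_upwards [h3.eventually (hFZ i)] with t ht
  rw [ht, mul_zero]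

theorem u_eq (Φ : (Fin n →₀ ℕ) → ℂ) (d : ℕ) (y : Fin n → ℂ) :
    (fun l => y l * fderiv ℂ (hom Φ d) y (Pi.single l 1)) =
      ∑ α ∈ degSet n d, (Φ α * mon y α) • fun l => (α l : ℂ) := by
  ext l
  have h := hom_theta Φ d (Pi.single l 1) y
  have e : (Pi.single l 1 : Fin n → ℂ) * y = y l • Pi.single l 1 := by
    ext s; by_cases h : s = l
    · subst h; simp
    · simp [h]
  rw [e, map_smul, smul_eq_mul] at h
  rw [← h, hom, Finset.sum_apply]
  refine Finset.sum_congr rfl fun α _ => ?_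
  have : lam (Pi.single l 1 : Fin n → ℂ) α = α l := by
    rw [lam, Finset.sum_eq_single l]
    · simp
    · intro s _ hs; simp [hs]
    · simp
  rw [this]; simp; ring

theorem u_mem (L : Fin r → Fin n → ℂ) (Φ : (Fin n →₀ ℕ) → ℂ) (d : ℕ)
    (h : ∀ i α, α.degree = d → lam (L i) α * Φ α = 0) (y : Fin n → ℂ) :
    (fun l => y l * fderiv ℂ (hom Φ d) y (Pi.single l 1)) ∈ Submodule.span ℂ (intK L) := by
  rw [u_eq]
  refine Submodule.sum_mem _ fun α hα => ?_
  by_cases h0 : Φ α = 0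
  · simp [h0]
  · refine Submodule.smul_mem _ _ (Submodule.subset_span ⟨fun i => ?_, fun l => (α l : ℤ), by simp⟩)
    exact (mul_eq_zero.1 (h i α (mem_degSet.1 hα))).resolve_right h0

theorem u_ker (L : Fin r → Fin n → ℂ) (Φ : (Fin n →₀ ℕ) → ℂ) (d : ℕ)
    (h : ∀ i α, α.degree = d → lam (L i) α * Φ α = 0) (y : Fin n → ℂ) (i) :
    ∑ l, L i l * (y l * fderiv ℂ (hom Φ d) y (Pi.single l 1)) = 0 := by
  have h1 : hom (fun α => lam (L i) α * Φ α) d y = 0 := by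
    rw [hom]; exact Finset.sum_eq_zero fun α hα => by rw [h i α (mem_degSet.1 hα), zero_mul]
  rw [hom_theta, fderiv_coords] at h1
  rw [← h1]
  exact Finset.sum_congr rfl fun l _ => by rw [Pi.mul_apply]; ring

/-- A homogeneous vector field annihilated by the differentials is zero, given normalisation. -/
theorem coef_zero (L K : Fin r → Fin n → ℂ) (hL : LinearIndependent ℂ L) (hn : n = r + q)
    (hKL : ∀ j i, ∑ l, K j l * L i l = if j = i then 1 else 0)
    (Φ : Fin q → (Fin n →₀ ℕ) → ℂ) (d : Fin q → ℕ)
    (hres : ∀ j i α, α.degree = d j → lam (L i) α * Φ j α = 0)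
    (hdense : Dense {y | LinearIndependent ℂ fun j => fderiv ℂ (hom (Φ j) (d j)) y})
    (e : Fin n → (Fin n →₀ ℕ) → ℂ) (N : ℕ)
    (hQ : ∀ j y, fderiv ℂ (hom (Φ j) (d j)) y (fun l => hom (e l) N y) = 0)
    (hK : ∀ γ, (∀ s, lam (L s) γ = 0) → ∀ j, ∑ l, K j l * e l (γ + Finsupp.single l 1) = 0)
    (l0 : Fin n) (β : Fin n →₀ ℕ) (hβ : β.degree = N) (hβr : ∀ s, mu L s l0 β = 0) :
    e l0 β = 0 := by
  classical
  let o : Fin n → (Fin n →₀ ℕ) := fun l => Finsupp.equivFunOnFinite.symm fun s => if s = l then 0 else 1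
  have ho : ∀ l s, o l s = if s = l then 0 else 1 := fun l s => rfl
  -- generic identity
  have key : ∀ a : Fin n → ℂ, (∀ i, ∑ l, L i l * a l = 0) →
      ∀ y : Fin n → ℂ, ∑ l, a l * (mon y (o l) * hom (e l) N y) = 0 := by
    intro a ha
    have hcont : Continuous fun y : Fin n → ℂ => ∑ l, a l * (mon y (o l) * hom (e l) N y) :=
      continuous_finsetSum _ fun l _ =>
        continuous_const.mul ((continuous_mon (o l)).mul (continuous_hom (e l) N))
    have hd := hdense.inter_of_isOpen_right dense_coords.1 dense_coords.2
    refine fun y => congrFun (Continuous.ext_on hd hcont continuous_const ?_) y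
    rintro y ⟨hy1, hy2⟩
    have hu := u_indep _ y hy2 hy1
    have hs := ker_span L hL hn _ hu (fun j i => u_ker L (Φ j) (d j) (hres j) y i) a ha
    obtain ⟨c, hc⟩ := (Submodule.mem_span_range_iff_exists_fun ℂ).1 hs
    have hmon : ∀ l, y l * mon y (o l) = ∏ s, y s := by
      intro l
      rw [← mon_single y l, ← mon_add, mon]
      refine Finset.prod_congr rfl fun s _ => ?_
      rw [Finsupp.add_apply, ho]
      by_cases h : s = l
      · subst h; simp
      · simp [h, Ne.symm h]
    beta_reduce
    have h1 : ∀ l, a l = ∑ j, c j * (y l * fderiv ℂ (hom (Φ j) (d j)) y (Pi.single l 1)) := by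
      intro l
      rw [← hc]; simp
    calc ∑ l, a l * (mon y (o l) * hom (e l) N y)
        = ∑ l, ∑ j, (∏ s, y s) * (c j * (hom (e l) N y * fderiv ℂ (hom (Φ j) (d j)) y (Pi.single l 1))) := by
          refine Finset.sum_congr rfl fun l _ => ?_
          rw [h1 l, Finset.sum_mul]
          refine Finset.sum_congr rfl fun j _ => ?_
          rw [← hmon l]; ring
      _ = ∑ j, (∏ s, y s) * (c j * fderiv ℂ (hom (Φ j) (d j)) y (fun l => hom (e l) N y)) := by
          rw [Finset.sum_comm]
          refine Finset.sum_congr rfl fun j _ => ?_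
          rw [fderiv_coords _ y (fun l => hom (e l) N y), Finset.mul_sum, Finset.mul_sum]
      _ = 0 := Finset.sum_eq_zero fun j _ => by rw [hQ, mul_zero, mul_zero]
  have key2 : ∀ a : Fin n → ℂ, (∀ i, ∑ l, L i l * a l = 0) → ∀ δ : Fin n →₀ ℕ,
      ∑ l, a l * ∑ x ∈ Finset.HasAntidiagonal.antidiagonal δ, (if x.1 = o l then (1 : ℂ) else 0) *
        (if x.2.degree = N then e l x.2 else 0) = 0 := by
    intro a ha δ
    have h1 := Rep.sum Finset.univ (fun l _ => ((rep_mon (o l)).mul (rep_hom (e l) N)).cmul (a l))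
    have h2 : (fun z : Fin n → ℂ => ∑ l, a l * (mon z (o l) * hom (e l) N z)) = fun _ => 0 := by
      ext y; exact key a ha y
    rw [h2] at h1
    exact congrFun h1.eq_zero δ
  by_cases hb : β l0 = 0
  · have h := key2 (fun s => (β s : ℂ) - if s = l0 then 1 else 0) (by
      intro i
      have := hβr i
      rw [mu, lam] at this
      refine Eq.trans ?_ this
      simp [mul_sub, Finset.sum_sub_distrib]) (β + o l0)
    rw [Finset.sum_eq_single l0] at h
    · rw [conv_ind (o l0) (fun α => if α.degree = N then e l0 α else 0)] at h
      simpa [hb, hβ] using h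
    · intro l _ hl
      rw [conv_ind_zero (o l) (fun α => if α.degree = N then e l α else 0) _ l0, mul_zero]
      simp [ho, hb, hl.symm]
    · simp
  · obtain ⟨γ, rfl⟩ := sub_single_add β l0 hb
    have hγ : ∀ s, lam (L s) γ = 0 := by
      intro s; have := hβr s
      rw [mu, lam_add, lam_single] at this
      simpa using this
    have hdeg : ∀ l, (γ + Finsupp.single l 1 : Fin n →₀ ℕ).degree = N := by
      intro l; rw [← hβ]; simp
    let O : Fin n →₀ ℕ := Finsupp.equivFunOnFinite.symm fun _ => 1
    have hO : ∀ l, γ + O = (γ + Finsupp.single l 1) + o l := by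
      intro l; ext s
      rw [Finsupp.add_apply, Finsupp.add_apply, Finsupp.add_apply, ho]
      have : O s = 1 := rfl
      by_cases h : s = l
      · subst h; simp [this]
      · simp [this, h, Ne.symm h]
    have key3 : ∀ a : Fin n → ℂ, (∀ i, ∑ l, L i l * a l = 0) →
        ∑ l, a l * e l (γ + Finsupp.single l 1) = 0 := by
      intro a ha
      rw [← key2 a ha (γ + O)]
      refine Finset.sum_congr rfl fun l _ => ?_
      rw [hO l, conv_ind (o l) (fun α => if α.degree = N then e l α else 0), if_pos (hdeg l)]
    have h := key3 (fun s => (if s = l0 then 1 else 0) - ∑ j, L j l0 * K j s) (by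
      intro i
      simp only [mul_sub, Finset.sum_sub_distrib, Finset.mul_sum]
      rw [Finset.sum_comm]
      have : ∀ j, ∑ l, L i l * (L j l0 * K j l) = L j l0 * if j = i then 1 else 0 := by
        intro j; rw [← hKL j i, Finset.mul_sum]
        exact Finset.sum_congr rfl fun l _ => by ring
      simp [this])
    simp only [sub_mul, Finset.sum_sub_distrib, Finset.sum_mul] at h
    rw [Finset.sum_comm (s := Finset.univ) (t := Finset.univ)
      (f := fun l j => L j l0 * K j l * e l (γ + Finsupp.single l 1))] at h
    have h2 : ∀ j, ∑ l, L j l0 * K j l * e l (γ + Finsupp.single l 1) = 0 := by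
      intro j
      rw [← mul_zero (L j l0), ← hK γ hγ j, Finset.mul_sum]
      exact Finset.sum_congr rfl fun l _ => by ring
    simp only [h2] at h
    simpa using h

end GeoLin

namespace GeoLin
open Filter Topology

variable {n r q : ℕ}

theorem comm_err {ψ Wi Wk Zi Zk : (Fin n → ℂ) → (Fin n → ℂ)} {y : Fin n → ℂ}
    (hψ : AnalyticAt ℂ ψ y) (hWi : DifferentiableAt ℂ Wi y) (hWk : DifferentiableAt ℂ Wk y)
    (hZi : DifferentiableAt ℂ Zi (ψ y)) (hZk : DifferentiableAt ℂ Zk (ψ y))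
    (hW : fderiv ℂ Wi y (Wk y) = fderiv ℂ Wk y (Wi y))
    (hZ : fderiv ℂ Zk (ψ y) (Zi (ψ y)) = fderiv ℂ Zi (ψ y) (Zk (ψ y))) :
    fderiv ℂ (fun y => fderiv ℂ ψ y (Wi y) - Zi (ψ y)) y (Wk y)
      - fderiv ℂ (fun y => fderiv ℂ ψ y (Wk y) - Zk (ψ y)) y (Wi y) =
    fderiv ℂ Zk (ψ y) (fderiv ℂ ψ y (Wi y) - Zi (ψ y))
      - fderiv ℂ Zi (ψ y) (fderiv ℂ ψ y (Wk y) - Zk (ψ y)) := by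
  have hd2 : DifferentiableAt ℂ (fderiv ℂ ψ) y := hψ.fderiv.differentiableAt
  have key : ∀ {V Z : (Fin n → ℂ) → (Fin n → ℂ)} (_ : DifferentiableAt ℂ V y)
      (_ : DifferentiableAt ℂ Z (ψ y)) (v : Fin n → ℂ),
      fderiv ℂ (fun y => fderiv ℂ ψ y (V y) - Z (ψ y)) y v =
        fderiv ℂ ψ y (fderiv ℂ V y v) + fderiv ℂ (fderiv ℂ ψ) y v (V y) -
          fderiv ℂ Z (ψ y) (fderiv ℂ ψ y v) := by
    intro V Z hV hZ v
    have h1 := hd2.hasFDerivAt.clm_apply hV.hasFDerivAt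
    have h2 := hZ.hasFDerivAt.comp y hψ.differentiableAt.hasFDerivAt
    have h3 := (h1.sub h2).fderiv
    have h4 : fderiv ℂ (fun y => fderiv ℂ ψ y (V y) - Z (ψ y)) y = _ := h3
    rw [h4]
    simp
  have hsymm : fderiv ℂ (fderiv ℂ ψ) y (Wk y) (Wi y) = fderiv ℂ (fderiv ℂ ψ) y (Wi y) (Wk y) :=
    (hψ.contDiffAt (n := ⊤)).isSymmSndFDerivAt_of_omega (Wk y) (Wi y)
  rw [key hWi hZi, key hWk hZk, hsymm, hW, map_sub, map_sub, hZ]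
  abel

/-- the model fields `∑ f_ij L_j y` -/
noncomputable def Vf (L : Fin r → Fin n → ℂ) (f : Fin r → Fin r → (Fin n → ℂ) → ℂ) (i : Fin r)
    (y : Fin n → ℂ) : Fin n → ℂ := ∑ j, f i j y • (L j * y)

theorem Vf_hasFDeriv (L : Fin r → Fin n → ℂ) (f : Fin r → Fin r → (Fin n → ℂ) → ℂ) (i : Fin r)
    (y : Fin n → ℂ) (hf : ∀ j, DifferentiableAt ℂ (f i j) y) :
    DifferentiableAt ℂ (Vf L f i) y ∧ ∀ v, fderiv ℂ (Vf L f i) y v =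
      ∑ j, (f i j y • (L j * v) + fderiv ℂ (f i j) y v • (L j * y)) := by
  have h1 : ∀ j, HasFDerivAt (fun y : Fin n → ℂ => L j * y) (ContinuousLinearMap.mul ℂ (Fin n → ℂ) (L j)) y :=
    fun j => (ContinuousLinearMap.mul ℂ (Fin n → ℂ) (L j)).hasFDerivAt
  have h2 := HasFDerivAt.fun_sum (u := Finset.univ) fun j _ => (hf j).hasFDerivAt.smul (h1 j)
  have h3 : HasFDerivAt (Vf L f i) _ y := h2
  refine ⟨h3.differentiableAt, fun v => ?_⟩
  rw [h3.fderiv]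
  simp

theorem Vf_comm (L : Fin r → Fin n → ℂ) (f : Fin r → Fin r → (Fin n → ℂ) → ℂ) (i k : Fin r)
    (y : Fin n → ℂ) (hf : ∀ i j, DifferentiableAt ℂ (f i j) y)
    (hr : ∀ i j s, fderiv ℂ (f i j) y (L s * y) = 0) :
    fderiv ℂ (Vf L f i) y (Vf L f k y) = fderiv ℂ (Vf L f k) y (Vf L f i y) := by
  have h0 : ∀ i j k, fderiv ℂ (f i j) y (Vf L f k y) = 0 := by
    intro i j k
    rw [Vf, map_sum]
    exact Finset.sum_eq_zero fun s _ => by rw [map_smul, hr, smul_zero]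
  rw [(Vf_hasFDeriv L f i y (hf i)).2, (Vf_hasFDeriv L f k y (hf k)).2]
  simp only [h0, zero_smul, add_zero]
  simp only [Vf, Finset.mul_sum, Finset.smul_sum]
  rw [Finset.sum_comm]
  refine Finset.sum_congr rfl fun j _ => Finset.sum_congr rfl fun s _ => ?_
  ext l
  simp
  ring

theorem tendsto_smul_zero (z : Fin n → ℂ) : Tendsto (fun t : ℂ => t • z) (𝓝[≠] 0) (𝓝 0) := by
  have : Continuous (fun t : ℂ => t • z) := by fun_prop
  simpa using (this.tendsto 0).mono_left nhdsWithin_le_nhds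

theorem comm_coef (L : Fin r → Fin n → ℂ)
    (Z : Fin r → (Fin n → ℂ) → (Fin n → ℂ)) (hZan : ∀ i, AnalyticAt ℂ (Z i) 0)
    (hZ1 : ∀ i v, fderiv ℂ (Z i) 0 v = L i * v)
    (hcomm : ∀ i j, ∀ᶠ x in 𝓝 0, fderiv ℂ (Z j) x (Z i x) = fderiv ℂ (Z i) x (Z j x))
    (ψ : (Fin n → ℂ) → (Fin n → ℂ)) (hψ : AnalyticAt ℂ ψ 0) (hψ0 : ψ 0 = 0)
    (f : Fin r → Fin r → (Fin n → ℂ) → ℂ) (hf : ∀ i j, AnalyticAt ℂ (f i j) 0)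
    (hf0 : ∀ i j, f i j 0 = if i = j then 1 else 0)
    (hfr : ∀ i j s, ∀ᶠ y in 𝓝 0, fderiv ℂ (f i j) y (L s * y) = 0)
    (E : Fin r → Fin n → (Fin n →₀ ℕ) → ℂ)
    (hE : ∀ i l, Rep (fun y => (fderiv ℂ ψ y (Vf L f i y) - Z i (ψ y)) l) (E i l))
    (N : ℕ) (hN : ∀ i l α, α.degree < N → E i l α = 0) (i k : Fin r) (l : Fin n) :
    ∀ α, α.degree = N → mu L k l α * E i l α = mu L i l α * E k l α := by
  have hψt : Tendsto ψ (𝓝 0) (𝓝 0) := by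
    have := hψ.continuousAt.tendsto; rwa [hψ0] at this
  let Er : Fin r → (Fin n → ℂ) → (Fin n → ℂ) := fun i y => fderiv ℂ ψ y (Vf L f i y) - Z i (ψ y)
  have hErd : ∀ i, ∀ᶠ y in 𝓝 0, DifferentiableAt ℂ (Er i) y := by
    intro i
    have : AnalyticAt ℂ (Er i) 0 := by
      rw [analyticAt_pi_iff]
      exact fun l => (hE i l).analyticAt
    exact this.eventually_analyticAt.mono fun y h => h.differentiableAt
  have hfd : ∀ᶠ y in 𝓝 (0 : Fin n → ℂ), ∀ i j, DifferentiableAt ℂ (f i j) y := by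
    rw [eventually_all]; intro i; rw [eventually_all]; intro j
    exact (hf i j).eventually_analyticAt.mono fun y h => h.differentiableAt
  have hfr' : ∀ᶠ y in 𝓝 (0 : Fin n → ℂ), ∀ i j s, fderiv ℂ (f i j) y (L s * y) = 0 := by
    rw [eventually_all]; intro i; rw [eventually_all]; intro j; rw [eventually_all]; intro s
    exact hfr i j s
  have hZd : ∀ i, ∀ᶠ y in 𝓝 0, DifferentiableAt ℂ (Z i) (ψ y) := by
    intro i
    exact hψt.eventually ((hZan i).eventually_analyticAt.mono fun y h => h.differentiableAt)
  have hid : ∀ᶠ y in 𝓝 0, fderiv ℂ (Er i) y (Vf L f k y) - fderiv ℂ (Er k) y (Vf L f i y) =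
      fderiv ℂ (Z k) (ψ y) (Er i y) - fderiv ℂ (Z i) (ψ y) (Er k y) := by
    filter_upwards [hfd, hfr', hZd i, hZd k, hψ.eventually_analyticAt, hψt.eventually (hcomm i k)] with
      y h1 h2 h3 h4 h5 h6
    exact comm_err h5 (Vf_hasFDeriv L f i y (h1 i)).1 (Vf_hasFDeriv L f k y (h1 k)).1 h3 h4
      (Vf_comm L f i k y h1 h2) h6
  -- limits
  have hL1 : ∀ i k z, Tendsto (fun t : ℂ => (t ^ N)⁻¹ * (fderiv ℂ (Er i) (t • z) (Vf L f k (t • z))) l)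
      (𝓝[≠] 0) (𝓝 (hom (fun α => lam (L k) α * E i l α) N z)) := by
    intro i k z
    have h1 : Tendsto (fun t : ℂ => ∑ j, f k j (t • z) *
        ((t ^ N)⁻¹ * fderiv ℂ (fun y => Er i y l) (t • z) (L j * (t • z)))) (𝓝[≠] 0)
        (𝓝 (∑ j, (if k = j then (1 : ℂ) else 0) * hom (fun α => lam (L j) α * E i l α) N z)) := by
      refine tendsto_finsetSum _ fun j _ => Tendsto.mul ?_ ?_
      · rw [← hf0 k j]
        exact (hf k j).continuousAt.tendsto.comp (tendsto_smul_zero z)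
      · refine ((hE i l).theta (L j)).lead (fun α hα => by rw [hN i l α hα, mul_zero]) (z := fun t => t • z) ?_
        refine tendsto_const_nhds.congr' ?_
        filter_upwards [self_mem_nhdsWithin] with t ht
        rw [smul_smul, inv_mul_cancel₀ ht, one_smul]
    have e : ∑ j, (if k = j then (1 : ℂ) else 0) * hom (fun α => lam (L j) α * E i l α) N z =
        hom (fun α => lam (L k) α * E i l α) N z := by simp
    rw [e] at h1
    refine h1.congr' ?_
    filter_upwards [(tendsto_smul_zero z).eventually (hErd i)] with t ht
    have h2 : ∀ v, fderiv ℂ (fun y => Er i y l) (t • z) v = (fderiv ℂ (Er i) (t • z) v) l := by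
      intro v
      have h3 := (ContinuousLinearMap.proj (R := ℂ) (φ := fun _ : Fin n => ℂ) l).hasFDerivAt.comp
        (t • z) ht.hasFDerivAt
      have h4 : fderiv ℂ (fun y => Er i y l) (t • z) = _ := h3.fderiv
      rw [h4]; simp
    rw [Vf, map_sum, Finset.sum_apply, Finset.mul_sum]
    refine Finset.sum_congr rfl fun j _ => ?_
    rw [h2, map_smul, Pi.smul_apply, smul_eq_mul]
    ring
  have hL2 : ∀ i k z, Tendsto (fun t : ℂ => (t ^ N)⁻¹ * (fderiv ℂ (Z k) (ψ (t • z)) (Er i (t • z))) l)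
      (𝓝[≠] 0) (𝓝 (L k l * hom (E i l) N z)) := by
    intro i k z
    have h1 : Tendsto (fun t : ℂ => (t ^ N)⁻¹ • Er i (t • z)) (𝓝[≠] 0) (𝓝 (fun l => hom (E i l) N z)) := by
      rw [tendsto_pi_nhds]
      intro s
      refine (hE i s).lead (hN i s) (z := fun t => t • z) ?_
      refine tendsto_const_nhds.congr' ?_
      filter_upwards [self_mem_nhdsWithin] with t ht
      rw [smul_smul, inv_mul_cancel₀ ht, one_smul]
    have h2 : Tendsto (fun t : ℂ => fderiv ℂ (Z k) (ψ (t • z))) (𝓝[≠] 0) (𝓝 (fderiv ℂ (Z k) 0)) :=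
      (hZan k).fderiv.continuousAt.tendsto.comp (hψt.comp (tendsto_smul_zero z))
    have h4 : Tendsto (fun t : ℂ => fderiv ℂ (Z k) (ψ (t • z)) ((t ^ N)⁻¹ • Er i (t • z))) (𝓝[≠] 0)
        (𝓝 (fderiv ℂ (Z k) 0 (fun l => hom (E i l) N z))) :=
      ((isBoundedBilinearMap_apply (𝕜 := ℂ) (E := Fin n → ℂ) (F := Fin n → ℂ)).continuous.tendsto
        (fderiv ℂ (Z k) 0, fun l => hom (E i l) N z)).comp (h2.prodMk_nhds h1)
    have h3 := (tendsto_pi_nhds.1 h4) l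
    rw [hZ1] at h3
    refine h3.congr fun t => ?_
    rw [map_smul, Pi.smul_apply, smul_eq_mul]
  have hfin : ∀ z, hom (fun α => lam (L k) α * E i l α) N z - hom (fun α => lam (L i) α * E k l α) N z =
      L k l * hom (E i l) N z - L i l * hom (E k l) N z := by
    intro z
    refine tendsto_nhds_unique ((hL1 i k z).sub (hL1 k i z)) (((hL2 i k z).sub (hL2 k i z)).congr' ?_)
    filter_upwards [(tendsto_smul_zero z).eventually hid] with t ht
    rw [← mul_sub, ← mul_sub, ← Pi.sub_apply, ← Pi.sub_apply, ht]
  intro α hα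
  have h := hom_eq_zero (a := fun α => mu L k l α * E i l α - mu L i l α * E k l α) (k := N) (fun z => by
    have h1 := hfin z
    have h2 : hom (fun α => mu L k l α * E i l α - mu L i l α * E k l α) N z =
        (hom (fun α => lam (L k) α * E i l α) N z - hom (fun α => lam (L i) α * E k l α) N z) -
        (L k l * hom (E i l) N z - L i l * hom (E k l) N z) := by
      simp only [hom, Finset.mul_sum, ← Finset.sum_sub_distrib]
      exact Finset.sum_congr rfl fun α _ => by simp only [mu]; ring
    rw [h2, h1, sub_self]) α hα
  exact sub_eq_zero.1 h

end GeoLin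

namespace GeoLin
open Filter Topology

variable {n r q : ℕ}

theorem integral_coef (L : Fin r → Fin n → ℂ)
    (Z : Fin r → (Fin n → ℂ) → (Fin n → ℂ))
    (ψ : (Fin n → ℂ) → (Fin n → ℂ)) (hψ : AnalyticAt ℂ ψ 0) (hψ0 : ψ 0 = 0)
    (hψ1 : ∀ v, fderiv ℂ ψ 0 v = v)
    (f : Fin r → Fin r → (Fin n → ℂ) → ℂ) (Fc : Fin r → Fin r → (Fin n →₀ ℕ) → ℂ)
    (hf : ∀ i j, Rep (f i j) (Fc i j))
    (hFc : ∀ i j α, (∃ s, lam (L s) α ≠ 0) → Fc i j α = 0)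
    {F : (Fin n → ℂ) → ℂ} {Φ} (hF : Rep F Φ) {d : ℕ}
    (hΦ : ∀ α, α.degree < d + 1 → Φ α = 0)
    (hΦr : ∀ i α, α.degree = d + 1 → lam (L i) α * Φ α = 0)
    (i : Fin r)
    (hFZ : ∀ᶠ x in 𝓝 0, fderiv ℂ F x (Z i x) = 0)
    (E : Fin n → (Fin n →₀ ℕ) → ℂ)
    (hE : ∀ l, Rep (fun y => (fderiv ℂ ψ y (Vf L f i y) - Z i (ψ y)) l) (E l))
    (N : ℕ) (hN : ∀ l α, α.degree < N → E l α = 0)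
    (hnr : ∀ l α, α.degree = N → (∃ s, mu L s l α ≠ 0) → E l α = 0) (y : Fin n → ℂ) :
    fderiv ℂ (hom Φ (d + 1)) y (fun l => hom (E l) N y) = 0 := by
  have hψt : Tendsto ψ (𝓝 0) (𝓝 0) := by
    have := hψ.continuousAt.tendsto; rwa [hψ0] at this
  have hHan : AnalyticAt ℂ (fun y => F (ψ y)) 0 := by
    have h1 : AnalyticAt ℂ F (ψ 0) := by rw [hψ0]; exact hF.analyticAt
    exact h1.comp hψ
  obtain ⟨h, hH⟩ := GeoLin.AnalyticAt.exists_rep hHan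
  have hb := Rep.sum Finset.univ (fun j _ => (hf i j).mul (hH.theta (L j)))
  set b : (Fin n →₀ ℕ) → ℂ := fun α => ∑ j, ∑ x ∈ Finset.HasAntidiagonal.antidiagonal α,
    Fc i j x.1 * (lam (L j) x.2 * h x.2) with hbdef
  have hbr : ∀ β, (∀ s, lam (L s) β = 0) → b β = 0 := by
    intro β hβ
    rw [hbdef]
    refine Finset.sum_eq_zero fun j _ => Finset.sum_eq_zero fun x hx => ?_
    have hx := Finset.HasAntidiagonal.mem_antidiagonal.1 hx
    by_cases h1 : ∃ s, lam (L s) x.1 ≠ 0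
    · rw [hFc i j _ h1, zero_mul]
    · push Not at h1
      have h2 := hβ j
      rw [← hx, lam_add, h1 j, zero_add] at h2
      rw [h2, zero_mul, mul_zero]
  let Q : (Fin n → ℂ) → ℂ := fun y => fderiv ℂ (hom Φ (d + 1)) y (fun l => hom (E l) N y)
  have hlim : ∀ y, Tendsto (fun t : ℂ => (t ^ (d + N))⁻¹ *
      (∑ j, f i j (t • y) * fderiv ℂ (fun y => F (ψ y)) (t • y) (L j * (t • y)))) (𝓝[≠] 0) (𝓝 (Q y)) := by
    intro y
    have h0 : Tendsto (fun t : ℂ => t⁻¹ • (ψ (t • y))) (𝓝[≠] 0) (𝓝 y) := by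
      have hc : HasDerivAt (fun s : ℂ => s • y) y 0 := by
        simpa using (hasDerivAt_id (0 : ℂ)).smul_const y
      have h4 : HasFDerivAt ψ (fderiv ℂ ψ 0) ((0 : ℂ) • y) := by
        rw [zero_smul]; exact hψ.differentiableAt.hasFDerivAt
      have h5 := h4.comp_hasDerivAt (0 : ℂ) hc
      rw [hψ1, hasDerivAt_iff_tendsto_slope] at h5
      refine h5.congr fun s => ?_
      simp [slope, hψ0]
    have h1 : ∀ l, Tendsto (fun t : ℂ => (t ^ N)⁻¹ *
        (fderiv ℂ ψ (t • y) (Vf L f i (t • y)) - Z i (ψ (t • y))) l) (𝓝[≠] 0) (𝓝 (hom (E l) N y)) := by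
      intro l
      refine (hE l).lead (hN l) (z := fun t => t • y) ?_
      refine tendsto_const_nhds.congr' ?_
      filter_upwards [self_mem_nhdsWithin] with t ht
      rw [smul_smul, inv_mul_cancel₀ ht, one_smul]
    have h2 := hF.lead_fderiv (v := fun t => fderiv ℂ ψ (t • y) (Vf L f i (t • y)) - Z i (ψ (t • y)))
      (w := fun l => hom (E l) N y) (N := N) hΦ h0 h1
    refine h2.congr' ?_
    have hFd : ∀ᶠ x in 𝓝 0, DifferentiableAt ℂ F x :=
      hF.analyticAt.eventually_analyticAt.mono fun x h => h.differentiableAt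
    filter_upwards [(tendsto_smul_zero y).eventually (hψt.eventually hFZ),
      (tendsto_smul_zero y).eventually (hψt.eventually hFd),
      (tendsto_smul_zero y).eventually hψ.eventually_analyticAt] with t h3 h4 h5
    congr 1
    rw [map_sub, h3, sub_zero]
    have h6 : fderiv ℂ (fun y => F (ψ y)) (t • y) = (fderiv ℂ F (ψ (t • y))).comp (fderiv ℂ ψ (t • y)) :=
      (h4.hasFDerivAt.comp (t • y) h5.differentiableAt.hasFDerivAt).fderiv
    rw [h6, Vf, map_sum, map_sum]
    refine Finset.sum_congr rfl fun j _ => ?_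
    rw [map_smul, map_smul, smul_eq_mul]
    rfl
  have hbQ := (hb.order_of_lim hlim).2
  -- the polynomial `Q`
  have hQrep := Rep.sum Finset.univ (fun l _ => (rep_hom (E l) N).mul
    (rep_hom (fun α => ((α l : ℂ) + 1) * Φ (α + Finsupp.single l 1)) d))
  set qf : (Fin n →₀ ℕ) → ℂ := fun α => ∑ l, ∑ x ∈ Finset.HasAntidiagonal.antidiagonal α,
    (if x.1.degree = N then E l x.1 else 0) *
      (if x.2.degree = d then ((x.2 l : ℂ) + 1) * Φ (x.2 + Finsupp.single l 1) else 0) with hqf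
  have hQe : ∀ y, ∑ l, hom (E l) N y * hom (fun α => ((α l : ℂ) + 1) * Φ (α + Finsupp.single l 1)) d y =
      Q y := by
    intro y
    simp only [Q]
    rw [fderiv_coords]
    exact Finset.sum_congr rfl fun l _ => by rw [hom_pderiv]
  have hqQ := (hQrep.order_of_lim (M := d + N) (Q := Q) (by
    intro y
    refine tendsto_const_nhds.congr' ?_
    filter_upwards [self_mem_nhdsWithin] with t ht
    have ht : t ≠ 0 := ht
    rw [← hQe y, Finset.mul_sum]
    refine Finset.sum_congr rfl fun l _ => ?_
    rw [hom_smul, hom_smul, pow_add]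
    field_simp)).2
  have hqr : ∀ β, (∃ s, lam (L s) β ≠ 0) → qf β = 0 := by
    rintro β ⟨s, hs⟩
    rw [hqf]
    refine Finset.sum_eq_zero fun l _ => Finset.sum_eq_zero fun x hx => ?_
    have hx := Finset.HasAntidiagonal.mem_antidiagonal.1 hx
    split_ifs with h1 h2
    · by_cases h3 : mu L s l x.1 = 0
      · have h4 := hΦr s (x.2 + Finsupp.single l 1) (by simp [h2])
        rcases mul_eq_zero.1 h4 with h5 | h5
        · exfalso; apply hs
          rw [lam_add, lam_single] at h5
          rw [mu] at h3
          rw [← hx, lam_add]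
          linear_combination h3 + h5
        · rw [h5]; simp
      · rw [hnr l x.1 h1 ⟨s, h3⟩]; simp
    all_goals simp
  have hz := hom_eq_zero (a := fun α => 1 * b α + (-1) * qf α) (k := d + N) (fun y => by
    rw [hom_lin, hbQ, hqQ]; ring)
  have hb0 : ∀ β, β.degree = d + N → b β = 0 := by
    intro β hβ
    by_cases h1 : ∃ s, lam (L s) β ≠ 0
    · have := hz β hβ
      rw [hqr β h1] at this
      simpa using this
    · push Not at h1
      exact hbr β h1
  show Q y = 0
  rw [← hbQ y, hom]
  exact Finset.sum_eq_zero fun α hα => by rw [hb0 α (mem_degSet.1 hα), zero_mul]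

/-- Core: normal form in diagonal coordinates. -/
theorem core (L : Fin r → Fin n → ℂ) (hL : LinearIndependent ℂ L) (hn : n = r + q)
    (Z : Fin r → (Fin n → ℂ) → (Fin n → ℂ)) (hZan : ∀ i, AnalyticAt ℂ (Z i) 0)
    (hZ0 : ∀ i, Z i 0 = 0) (hZ1 : ∀ i v, fderiv ℂ (Z i) 0 v = L i * v)
    (hcomm : ∀ i j, ∀ᶠ x in 𝓝 0, fderiv ℂ (Z j) x (Z i x) = fderiv ℂ (Z i) x (Z j x))
    (F : Fin q → (Fin n → ℂ) → ℂ) (Φ : Fin q → (Fin n →₀ ℕ) → ℂ) (hF : ∀ j, Rep (F j) (Φ j))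
    (d : Fin q → ℕ) (hΦ : ∀ j α, α.degree < d j → Φ j α = 0)
    (hFZ : ∀ j i, ∀ᶠ x in 𝓝 0, fderiv ℂ (F j) x (Z i x) = 0)
    (hdense : Dense {y | LinearIndependent ℂ fun j => fderiv ℂ (hom (Φ j) (d j)) y}) :
    ∃ c : ℝ, 0 < c ∧ (∀ w : Fin n → ℤ, (∀ i, ∑ l, L i l * (w l : ℂ) = 0) ∨
        ∃ i, c ≤ ‖∑ l, L i l * (w l : ℂ)‖) ∧
    ∃ (ψ : (Fin n → ℂ) → (Fin n → ℂ)) (f : Fin r → Fin r → (Fin n → ℂ) → ℂ),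
      AnalyticAt ℂ ψ 0 ∧ ψ 0 = 0 ∧ (∀ v, fderiv ℂ ψ 0 v = v) ∧
      (∀ i j, AnalyticAt ℂ (f i j) 0) ∧ (∀ i j, f i j 0 = if i = j then 1 else 0) ∧
      (∀ i j s, ∀ᶠ y in 𝓝 0, fderiv ℂ (f i j) y (L s * y) = 0) ∧
      ∀ i, ∀ᶠ y in 𝓝 0, fderiv ℂ ψ y (∑ j, f i j y • (L j * y)) = Z i (ψ y) := by
  obtain ⟨K, hKL⟩ := exists_K L hL
  obtain ⟨y0, hy0, hy0'⟩ := hdense.inter_open_nonempty _ dense_coords.2 dense_coords.1.nonempty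
  have hd : ∀ j, ∃ e, d j = e + 1 := by
    intro j
    rcases Nat.eq_zero_or_pos (d j) with h | h
    · exfalso
      apply (show LinearIndependent ℂ _ from hy0').ne_zero j
      rw [h]
      have : hom (Φ j) 0 = fun _ => hom (Φ j) 0 0 := by
        ext y
        have := hom_smul (Φ j) 0 0 y
        simpa using this.symm
      rw [this]
      simp
    · exact ⟨d j - 1, by omega⟩
  choose e he using hd
  obtain rfl : d = fun j => e j + 1 := funext he
  have hres : ∀ j i α, α.degree = e j + 1 → lam (L i) α * Φ j α = 0 := fun j =>
    res_F L Z hZan hZ0 hZ1 (hF j) (hΦ j) (hFZ j)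
  have hu := u_indep _ y0 hy0 hy0'
  obtain ⟨c, hc0, hc⟩ := divisor L (fun v hv => kernel_span L hL hn _ hu
    (fun j => u_mem L (Φ j) (e j + 1) (hres j) y0) v hv)
  refine ⟨c, hc0, hc, ?_⟩
  obtain ⟨ψ, f, Ψ, Fc, E, hψ, hψl, hf, hfr, hf0, hE, hEl, hEn, hEr⟩ :=
    approx_normal L K hKL c hc0 hc Z hZan hZ0 hZ1
  have hψan : AnalyticAt ℂ ψ 0 := by
    rw [analyticAt_pi_iff]
    exact fun l => (hψ l).analyticAt
  have hlow : ∀ l, ψ 0 l = 0 ∧ ∀ v, fderiv ℂ (fun y => ψ y l) 0 v = v l := by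
    intro l
    have h1 := (hψ l).sub (Rep.coord l)
    have hcoef : ∀ α : Fin n →₀ ℕ, α.degree < 2 →
        Ψ l α - (if α = Finsupp.single l 1 then 1 else 0) = 0 := by
      intro α hα; rw [hψl l α (by omega), sub_self]
    have h2 := h1.isBigO hcoef
    have h3 : (fun z : Fin n → ℂ => ψ z l - z l) =O[𝓝 0] fun z : Fin n → ℂ => ‖z - 0‖ ^ 2 := by
      have h4 : (fun z : Fin n → ℂ => hom (fun α => Ψ l α - (if α = Finsupp.single l 1 then 1 else 0)) 2 z)
          =O[𝓝 0] fun z => ‖z‖ ^ 2 := by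
        simp only [hom]
        refine Asymptotics.IsBigO.fun_sum fun α hα => ?_
        refine Asymptotics.IsBigO.of_bound (‖Ψ l α - (if α = Finsupp.single l 1 then 1 else 0)‖)
          (Eventually.of_forall fun z => ?_)
        rw [norm_mul, norm_pow, norm_norm]
        have := norm_mon_le z α
        rw [mem_degSet.1 hα] at this
        gcongr
      have h5 : (fun z : Fin n → ℂ => ‖z‖ ^ (2 + 1)) =O[𝓝 0] fun z => ‖z‖ ^ 2 := by
        refine Asymptotics.IsBigO.of_bound 1 ?_
        filter_upwards [Metric.closedBall_mem_nhds (0 : Fin n → ℂ) one_pos] with z hz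
        have hz : ‖z‖ ≤ 1 := by simpa using hz
        rw [norm_pow, norm_pow, norm_norm, one_mul]
        exact pow_le_pow_of_le_one (norm_nonneg _) hz (by norm_num)
      have h6 := (h2.trans h5).add h4
      simpa using h6
    have h7 := h3.hasFDerivAt (𝕜 := ℂ) (by norm_num)
    have h8 : ψ 0 l - (0 : Fin n → ℂ) l = 0 := by
      have := h3.eq_zero_of_norm_pow (by norm_num)
      simpa using this
    refine ⟨by simpa using h8, fun v => ?_⟩
    have h9 : HasFDerivAt (fun y => ψ y l) (0 + ContinuousLinearMap.proj (R := ℂ) (φ := fun _ : Fin n => ℂ) l) 0 := by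
      have h10 := h7.add (ContinuousLinearMap.proj (R := ℂ) (φ := fun _ : Fin n => ℂ) l).hasFDerivAt
      refine h10.congr_of_eventuallyEq (Eventually.of_forall fun z => ?_)
      simp
    rw [h9.fderiv]; simp
  have hψ0 : ψ 0 = 0 := funext fun l => (hlow l).1
  have hcomp : ∀ y, DifferentiableAt ℂ ψ y → ∀ l v, fderiv ℂ (fun y => ψ y l) y v = (fderiv ℂ ψ y v) l := by
    intro y hy l v
    have h3 := (ContinuousLinearMap.proj (R := ℂ) (φ := fun _ : Fin n => ℂ) l).hasFDerivAt.comp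
      y hy.hasFDerivAt
    have h4 : fderiv ℂ (fun y => ψ y l) y = _ := h3.fderiv
    rw [h4]; simp
  have hψ1 : ∀ v, fderiv ℂ ψ 0 v = v := by
    intro v; ext l
    rw [← hcomp 0 hψan.differentiableAt, (hlow l).2]
  have hfan : ∀ i j, AnalyticAt ℂ (f i j) 0 := fun i j => (hf i j).analyticAt
  have hf00 : ∀ i j, f i j 0 = if i = j then 1 else 0 := by
    intro i j
    rw [← hf0 i j]
    have h3 := (hf i j).hasFPowerSeriesAt.coeff_zero (fun _ => 0)
    rw [ser_apply, hom, Finset.sum_eq_single 0] at h3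
    · rw [← h3, mon_zero, mul_one]
    · intro α hα hne
      have := mem_degSet.1 hα
      rw [Finsupp.degree_eq_zero_iff] at this
      exact absurd this hne
    · intro h; exfalso; apply h; rw [mem_degSet]; simp
  have hfth : ∀ i j s, ∀ᶠ y in 𝓝 0, fderiv ℂ (f i j) y (L s * y) = 0 := by
    intro i j s
    have h1 := (hf i j).theta (L s)
    have h2 : (fun α => lam (L s) α * Fc i j α) = fun _ => 0 := by
      ext α
      by_cases h : lam (L s) α = 0
      · rw [h, zero_mul]
      · rw [hfr i j α ⟨s, h⟩, mul_zero]
    rw [h2] at h1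
    exact h1.eventually_zero
  have hE' : ∀ i l, Rep (fun y => (fderiv ℂ ψ y (Vf L f i y) - Z i (ψ y)) l) (E i l) := by
    intro i l
    refine (hE i l).congr ?_
    filter_upwards [hψan.eventually_analyticAt] with y hy
    rw [Pi.sub_apply, Vf, map_sum, Finset.sum_apply]
    congr 1
    refine Finset.sum_congr rfl fun j _ => ?_
    rw [map_smul, Pi.smul_apply, smul_eq_mul, hcomp y hy.differentiableAt]
  have hzero : ∀ N i l α, α.degree = N → E i l α = 0 := by
    intro N
    induction N using Nat.strong_induction_on with
    | _ N ih =>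
      have hN : ∀ i l α, α.degree < N → E i l α = 0 := fun i l α hα => ih _ hα i l α rfl
      have hcc := comm_coef L Z hZan hZ1 hcomm ψ hψan hψ0 f hfan hf00 hfth E hE' N hN
      have hnr : ∀ i l α, α.degree = N → (∃ s, mu L s l α ≠ 0) → E i l α = 0 := by
        intro i l α hα hs
        obtain ⟨k, hk, hk0⟩ := hEn l α hs
        have := hcc i k l α hα
        rw [hk0, mul_zero] at this
        exact (mul_eq_zero.1 this).resolve_left hk
      intro i l α hα
      by_cases hs : ∃ s, mu L s l α ≠ 0
      · exact hnr i l α hα hs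
      · push Not at hs
        refine coef_zero L K hL hn hKL Φ (fun j => e j + 1) hres hdense (E i) N ?_ (fun γ hγ j => hEr γ hγ i j)
          l α hα hs
        intro j y
        exact integral_coef L Z ψ hψan hψ0 hψ1 f Fc hf hfr (hF j) (hΦ j) (hres j) i (hFZ j i) (E i) (hE' i)
          N (hN i) (hnr i) y
  refine ⟨ψ, f, hψan, hψ0, hψ1, hfan, hf00, hfth, fun i => ?_⟩
  have h1 : ∀ᶠ y in 𝓝 (0 : Fin n → ℂ), ∀ l, (fderiv ℂ ψ y (Vf L f i y) - Z i (ψ y)) l = 0 := by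
    rw [eventually_all]
    intro l
    have h2 := hE' i l
    have h3 : E i l = fun _ => 0 := funext fun α => hzero _ i l α rfl
    rw [h3] at h2
    exact h2.eventually_zero
  filter_upwards [h1] with y hy
  have : fderiv ℂ ψ y (Vf L f i y) - Z i (ψ y) = 0 := funext hy
  exact sub_eq_zero.1 this

end GeoLin

namespace GeoLin
open Filter Topology
variable {n r q : ℕ}

/-- solving the cohomological equation modulo resonant terms -/
theorem cohom (L : Fin r → Fin n → ℂ) {c : ℝ} (hc : 0 < c)
    (hdiv : ∀ w : Fin n → ℤ, (∀ i, ∑ l, L i l * (w l : ℂ) = 0) ∨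
        ∃ i, c ≤ ‖∑ l, L i l * (w l : ℂ)‖)
    (g : Fin r → (Fin n → ℂ) → ℂ) (hg : ∀ j, AnalyticAt ℂ (g j) 0)
    (hcl : ∀ i j, ∀ᶠ y in 𝓝 0, fderiv ℂ (g j) y (L i * y) = fderiv ℂ (g i) y (L j * y)) :
    ∃ (u : (Fin n → ℂ) → ℂ) (h : Fin r → (Fin n → ℂ) → ℂ), AnalyticAt ℂ u 0 ∧ u 0 = 0 ∧
      (∀ j, AnalyticAt ℂ (h j) 0) ∧ (∀ j, ∀ᶠ y in 𝓝 0, fderiv ℂ u y (L j * y) + h j y = g j y) ∧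
      ∀ i j, ∀ᶠ y in 𝓝 0, fderiv ℂ (h j) y (L i * y) = 0 := by
  classical
  have hd : ∀ β : Fin n →₀ ℕ, (∀ i, lam (L i) β = 0) ∨ ∃ i, c ≤ ‖lam (L i) β‖ := by
    intro β
    have := hdiv (fun l => (β l : ℤ))
    simpa [lam] using this
  choose C hC using fun j => AnalyticAt.exists_rep (hg j)
  have hcoef : ∀ i j β, lam (L i) β * C j β = lam (L j) β * C i β := by
    intro i j β
    have h1 := (hC j).theta (L i)
    have h2 := (hC i).theta (L j)
    have h3 := h1.congr (hcl i j)
    exact congrFun (h3.unique h2) β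
  have hσ : ∀ β : Fin n →₀ ℕ, ∃ o : Option (Fin r),
      (o = none → ∀ i, lam (L i) β = 0) ∧ ∀ i, o = some i → c ≤ ‖lam (L i) β‖ := by
    intro β
    rcases hd β with h | ⟨i, hi⟩
    · exact ⟨none, fun _ => h, fun i h => by simp at h⟩
    · exact ⟨some i, fun h => by simp at h, fun j h => by simp at h; exact h ▸ hi⟩
  choose σ hσ1 hσ2 using hσ
  have hm : ∀ j, ∃ gg, Rep gg (fun α => (if σ α = some j then (lam (L j) α)⁻¹ else 0) * C j α) := by
    intro j
    refine (hC j).mult _ c⁻¹ fun α => ?_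
    have h1 : (1 : ℝ) ≤ 2 ^ α.degree := one_le_pow₀ (by norm_num)
    have h2 : 0 < c⁻¹ := inv_pos.2 hc
    split_ifs with h
    · rw [norm_inv]
      have := hσ2 α j h
      calc ‖lam (L j) α‖⁻¹ ≤ c⁻¹ := by gcongr
        _ ≤ _ := by nlinarith
    · simp; positivity
  choose gg hgg using hm
  have hu := Rep.sum Finset.univ (fun j _ => hgg j)
  have hr : ∀ j, ∃ h, Rep h (fun α => (if σ α = none then 1 else 0) * C j α) := by
    intro j
    refine (hC j).mult _ 1 fun α => ?_
    have h1 : (1 : ℝ) ≤ 2 ^ α.degree := one_le_pow₀ (by norm_num)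
    split_ifs with h
    · simpa using h1
    · simp
  choose h hh using hr
  refine ⟨_, h, hu.analyticAt, ?_, fun j => (hh j).analyticAt, fun j => ?_, fun i j => ?_⟩
  · have h1 : ∀ j, gg j 0 = 0 := by
      intro j
      obtain ⟨ρ, h0, -, hs⟩ := hgg j
      have h2 := hs 0 (by simpa using h0.le)
      have h3 : (fun α : Fin n →₀ ℕ => (if σ α = some j then (lam (L j) α)⁻¹ else 0) * C j α * mon 0 α)
          = fun _ => 0 := by
        funext α
        by_cases hα : α = 0
        · subst hα
          have : lam (L j) 0 = 0 := by simp [lam]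
          rw [this]; simp
        · obtain ⟨l, hl⟩ := Finsupp.ne_iff.1 hα
          have : mon (0 : Fin n → ℂ) α = 0 := by
            have h4 := norm_mon_le (0 : Fin n → ℂ) α
            rw [norm_zero, zero_pow (by simpa [Finsupp.degree_eq_zero_iff] using hα)] at h4
            exact norm_le_zero_iff.1 h4
          rw [this, mul_zero]
      rw [h3] at h2
      exact h2.unique hasSum_zero
    simp [h1]
  · have h1 := ((hu.theta (L j)).add (hh j)).sub (hC j)
    have h2 : (fun α => lam (L j) α * (∑ i, (if σ α = some i then (lam (L i) α)⁻¹ else 0) * C i α)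
        + (if σ α = none then 1 else 0) * C j α - C j α) = fun _ => 0 := by
      funext α
      rcases hs : σ α with _ | i
      · simp
      · have h3 : lam (L i) α ≠ 0 := by
          have := hσ2 α i hs
          intro h; rw [h, norm_zero] at this; linarith
        have h4 : ∀ a : Fin r, (some i = some a) ↔ i = a := fun a => Option.some_inj
        simp only [h4, ite_mul, zero_mul, Finset.sum_ite_eq, Finset.mem_univ, if_true]
        have h5 := hcoef i j α
        simp
        field_simp
        linear_combination -h5
    rw [h2] at h1
    filter_upwards [h1.eventually_zero] with y hy
    exact sub_eq_zero.1 hy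
  · have h1 := (hh j).theta (L i)
    have h2 : (fun α => lam (L i) α * ((if σ α = none then 1 else 0) * C j α)) = fun _ => 0 := by
      funext α
      split_ifs with hs
      · rw [hσ1 α hs i, zero_mul]
      · simp
    rw [h2] at h1
    exact h1.eventually_zero
end GeoLin

namespace GeoLin
open Filter Topology
variable {n r q : ℕ}

theorem analyticAt_det {E : Type*} [NormedAddCommGroup E] [NormedSpace ℂ E] {ι : Type*} [Fintype ι]
    [DecidableEq ι] {M : E → Matrix ι ι ℂ} {x : E} (h : ∀ i j, AnalyticAt ℂ (fun y => M y i j) x) :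
    AnalyticAt ℂ (fun y => (M y).det) x := by
  simp only [Matrix.det_apply]
  refine Finset.analyticAt_fun_sum _ fun σ _ => ?_
  have h1 : AnalyticAt ℂ (fun y => ∏ i, M y (σ i) i) x :=
    Finset.analyticAt_fun_prod _ fun i _ => h _ _
  exact h1.const_smul

theorem analyticAt_inv {E : Type*} [NormedAddCommGroup E] [NormedSpace ℂ E] {ι : Type*} [Fintype ι]
    [DecidableEq ι] {M : E → Matrix ι ι ℂ} {x : E} (h : ∀ i j, AnalyticAt ℂ (fun y => M y i j) x)
    (h0 : (M x).det ≠ 0) (i j) : AnalyticAt ℂ (fun y => (M y)⁻¹ i j) x := by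
  have h1 : (fun y => (M y)⁻¹ i j) = fun y => ((M y).det)⁻¹ * (M y).adjugate i j := by
    funext y
    rw [Matrix.inv_def]; simp
  rw [h1]
  refine ((analyticAt_det h).inv h0).mul ?_
  simp only [Matrix.adjugate_apply]
  refine analyticAt_det fun s t => ?_
  by_cases hs : s = j
  · subst hs; simp only [Matrix.updateRow_self]; exact analyticAt_const
  · simp only [Matrix.updateRow_ne hs]; exact h s t

theorem core2 {κ : ℕ} (L : Fin r → Fin n → ℂ) (hL : LinearIndependent ℂ L) (hn : n = r + q)
    (Z : Fin r → (Fin n → ℂ) → (Fin n → ℂ)) (hZan : ∀ i, AnalyticAt ℂ (Z i) 0)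
    (hZ0 : ∀ i, Z i 0 = 0) (hZ1 : ∀ i v, fderiv ℂ (Z i) 0 v = L i * v)
    (hcomm : ∀ i j, ∀ᶠ x in 𝓝 0, fderiv ℂ (Z j) x (Z i x) = fderiv ℂ (Z i) x (Z j x))
    (a : Fin r → Fin κ → (Fin n → ℂ) → ℂ) (ha : ∀ i l, AnalyticAt ℂ (a i l) 0)
    (hacomm : ∀ i j l, ∀ᶠ x in 𝓝 0, fderiv ℂ (a j l) x (Z i x) = fderiv ℂ (a i l) x (Z j x))
    (F : Fin q → (Fin n → ℂ) → ℂ) (Φ : Fin q → (Fin n →₀ ℕ) → ℂ) (hF : ∀ j, Rep (F j) (Φ j))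
    (d : Fin q → ℕ) (hΦ : ∀ j α, α.degree < d j → Φ j α = 0)
    (hFZ : ∀ j i, ∀ᶠ x in 𝓝 0, fderiv ℂ (F j) x (Z i x) = 0)
    (hdense : Dense {y | LinearIndependent ℂ fun j => fderiv ℂ (hom (Φ j) (d j)) y}) :
    ∃ (ψ : (Fin n → ℂ) → (Fin n → ℂ)) (f : Fin r → Fin r → (Fin n → ℂ) → ℂ)
      (u : Fin κ → (Fin n → ℂ) → ℂ) (h : Fin r → Fin κ → (Fin n → ℂ) → ℂ),
      AnalyticAt ℂ ψ 0 ∧ ψ 0 = 0 ∧ (∀ v, fderiv ℂ ψ 0 v = v) ∧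
      (∀ i j, AnalyticAt ℂ (f i j) 0) ∧ (∀ i j, f i j 0 = if i = j then 1 else 0) ∧
      (∀ l, AnalyticAt ℂ (u l) 0) ∧ (∀ l, u l 0 = 0) ∧ (∀ j l, AnalyticAt ℂ (h j l) 0) ∧
      (∀ i j s, ∀ᶠ y in 𝓝 0, fderiv ℂ (f i j) y (L s * y) = 0) ∧
      (∀ j l s, ∀ᶠ y in 𝓝 0, fderiv ℂ (h j l) y (L s * y) = 0) ∧
      (∀ i, ∀ᶠ y in 𝓝 0, fderiv ℂ ψ y (∑ j, f i j y • (L j * y)) = Z i (ψ y)) ∧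
      ∀ i l, ∀ᶠ y in 𝓝 0, fderiv ℂ (u l) y (∑ j, f i j y • (L j * y)) + ∑ j, f i j y * h j l y
        = a i l (ψ y) := by
  classical
  obtain ⟨c, hc, hdiv, ψ, f, hψ, hψ0, hψ1, hf, hf0, hfint, hconj⟩ :=
    core L hL hn Z hZan hZ0 hZ1 hcomm F Φ hF d hΦ hFZ hdense
  set M : (Fin n → ℂ) → Matrix (Fin r) (Fin r) ℂ := fun y => Matrix.of fun i j => f i j y with hM
  have hM0 : M 0 = 1 := by
    ext i j; simp [hM, hf0, Matrix.one_apply]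
  have hMdet0 : (M 0).det ≠ 0 := by rw [hM0]; simp
  have hMan : ∀ i j, AnalyticAt ℂ (fun y => M y i j) 0 := fun i j => hf i j
  have hinv := fun i j => analyticAt_inv hMan hMdet0 i j
  have hdet : ∀ᶠ y in 𝓝 0, IsUnit (M y).det := by
    have := (analyticAt_det hMan).continuousAt.eventually_ne hMdet0
    filter_upwards [this] with y hy using isUnit_iff_ne_zero.2 hy
  set g : Fin κ → Fin r → (Fin n → ℂ) → ℂ := fun l j y => ∑ i, (M y)⁻¹ j i * a i l (ψ y) with hg
  have hb : ∀ i l, AnalyticAt ℂ (fun y => a i l (ψ y)) 0 := by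
    intro i l
    have h1 : AnalyticAt ℂ (a i l) (ψ 0) := by rw [hψ0]; exact ha i l
    exact h1.comp hψ
  have hgan : ∀ l j, AnalyticAt ℂ (g l j) 0 := by
    intro l j
    exact Finset.analyticAt_fun_sum _ fun i _ => (hinv j i).mul (hb i l)
  have hfg : ∀ l i, ∀ᶠ y in 𝓝 0, ∑ j, f i j y * g l j y = a i l (ψ y) := by
    intro l i
    filter_upwards [hdet] with y hy
    have h1 : (M y).mulVec ((M y)⁻¹.mulVec fun i => a i l (ψ y)) = fun i => a i l (ψ y) := by
      rw [Matrix.mulVec_mulVec, Matrix.mul_nonsing_inv _ hy, Matrix.one_mulVec]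
    exact congrFun h1 i
  have htend : Tendsto ψ (𝓝 0) (𝓝 0) := by
    have := hψ.continuousAt.tendsto; rwa [hψ0] at this
  have hcl : ∀ l i j, ∀ᶠ y in 𝓝 0, fderiv ℂ (g l j) y (L i * y) = fderiv ℂ (g l i) y (L j * y) := by
    intro l
    have e1 : ∀ᶠ y in 𝓝 0, ∀ i, ∀ᶠ z in 𝓝 y, ∑ j, f i j z * g l j z = a i l (ψ z) :=
      eventually_all.2 fun i => (hfg l i).eventually_nhds
    have e2 : ∀ᶠ y in 𝓝 0, ∀ i j, AnalyticAt ℂ (f i j) y :=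
      eventually_all.2 fun i => eventually_all.2 fun j => (hf i j).eventually_analyticAt
    have e3 : ∀ᶠ y in 𝓝 0, ∀ j, AnalyticAt ℂ (g l j) y :=
      eventually_all.2 fun j => (hgan l j).eventually_analyticAt
    have e4 : ∀ᶠ y in 𝓝 0, ∀ i j s, fderiv ℂ (f i j) y (L s * y) = 0 :=
      eventually_all.2 fun i => eventually_all.2 fun j => eventually_all.2 fun s => hfint i j s
    have e5 : ∀ᶠ y in 𝓝 0, ∀ i, fderiv ℂ ψ y (∑ j, f i j y • (L j * y)) = Z i (ψ y) :=
      eventually_all.2 hconj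
    have e6 : ∀ᶠ y in 𝓝 0, ∀ i j, fderiv ℂ (a j l) (ψ y) (Z i (ψ y)) = fderiv ℂ (a i l) (ψ y) (Z j (ψ y)) :=
      eventually_all.2 fun i => eventually_all.2 fun j => htend.eventually (hacomm i j l)
    have e7 : ∀ᶠ y in 𝓝 0, ∀ i, AnalyticAt ℂ (a i l) (ψ y) :=
      eventually_all.2 fun i => htend.eventually (ha i l).eventually_analyticAt
    have key : ∀ᶠ y in 𝓝 0, ∀ i j, fderiv ℂ (g l j) y (L i * y) = fderiv ℂ (g l i) y (L j * y) := by
      filter_upwards [e1, e2, e3, e4, e5, e6, e7, hdet, hψ.eventually_analyticAt]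
        with y h1 h2 h3 h4 h5 h6 h7 hdy hψy
      set N : Matrix (Fin r) (Fin r) ℂ := Matrix.of fun s j => fderiv ℂ (g l j) y (L s * y) with hN
      -- derivative of b_i along θ_s
      have d1 : ∀ i v, fderiv ℂ (fun y => a i l (ψ y)) y v = fderiv ℂ (a i l) (ψ y) (fderiv ℂ ψ y v) := by
        intro i v
        have h8 := ((h7 i).differentiableAt.hasFDerivAt).comp y hψy.differentiableAt.hasFDerivAt
        have h9 : fderiv ℂ (fun y => a i l (ψ y)) y = _ := h8.fderiv
        rw [h9]; rfl
      have d2 : ∀ i s, fderiv ℂ (fun y => a i l (ψ y)) y (L s * y) = ∑ j, f i j y * N s j := by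
        intro i s
        have h8 : (fun y => a i l (ψ y)) =ᶠ[𝓝 y] fun z => ∑ j, f i j z * g l j z := by
          filter_upwards [h1 i] with z hz using hz.symm
        rw [h8.fderiv_eq, fderiv_fun_sum fun j _ => (h2 i j).differentiableAt.fun_mul (h3 j).differentiableAt]
        rw [ContinuousLinearMap.sum_apply]
        refine Finset.sum_congr rfl fun j _ => ?_
        rw [fderiv_fun_mul (h2 i j).differentiableAt (h3 j).differentiableAt]
        simp [h4, hN]
      have d3 : ∀ t i, (M y * N * (M y).transpose) t i = fderiv ℂ (a i l) (ψ y) (Z t (ψ y)) := by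
        intro t i
        rw [← h5 t, ← d1, map_sum]
        simp only [map_smul, d2, Matrix.mul_apply, Matrix.transpose_apply, smul_eq_mul, Finset.sum_mul,
          Finset.mul_sum]
        rw [Finset.sum_comm]
        refine Finset.sum_congr rfl fun s _ => Finset.sum_congr rfl fun j _ => ?_
        simp [hM]; ring
      have d4 : M y * N * (M y).transpose = M y * N.transpose * (M y).transpose := by
        have h8 : M y * N.transpose * (M y).transpose = (M y * N * (M y).transpose).transpose := by
          simp [Matrix.transpose_mul, Matrix.mul_assoc]
        rw [h8]
        ext t i
        rw [Matrix.transpose_apply, d3, d3, h6 t i]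
      have hu1 : IsUnit (M y) := (Matrix.isUnit_iff_isUnit_det _).2 hdy
      have hu2 : IsUnit (M y).transpose := (Matrix.isUnit_iff_isUnit_det _).2 (by rwa [Matrix.det_transpose])
      have d5 : N = N.transpose := hu1.mul_left_cancel (hu2.mul_right_cancel d4)
      intro i j
      exact congrFun (congrFun d5 i) j
    intro i j
    filter_upwards [key] with y hy using hy i j
  have hco := fun l => cohom L hc hdiv (g l) (hgan l) (hcl l)
  choose u h hu hu0 hh hsol hhfi using hco
  refine ⟨ψ, f, u, fun j l => h l j, hψ, hψ0, hψ1, hf, hf0, hu, hu0, fun j l => hh l j, hfint,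
    fun j l s => hhfi l s j, hconj, fun i l => ?_⟩
  have e1 : ∀ᶠ y in 𝓝 0, ∀ j, fderiv ℂ (u l) y (L j * y) + h l j y = g l j y :=
    eventually_all.2 fun j => hsol l j
  filter_upwards [e1, hfg l i] with y h1 h2
  rw [← h2, map_sum, ← Finset.sum_add_distrib]
  refine Finset.sum_congr rfl fun j _ => ?_
  rw [map_smul, smul_eq_mul, ← mul_add, h1]
end GeoLin

namespace GeoLin
open Filter Topology
variable {n r q : ℕ}

theorem gen_eigen (P : Matrix (Fin n) (Fin n) ℂ) (hP : IsUnit P) (d : Fin n → ℂ) (μ : ℂ) (k : ℕ)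
    (v : Fin n → ℂ)
    (h : ((Matrix.toLin' (P * Matrix.diagonal d * P⁻¹) - μ • (1 : Module.End ℂ (Fin n → ℂ))) ^ k) v = 0) :
    (P * Matrix.diagonal d * P⁻¹).mulVec v = μ • v := by
  have hP' := (Matrix.isUnit_iff_isUnit_det _).1 hP
  set E : Matrix (Fin n) (Fin n) ℂ := Matrix.diagonal (fun l => d l - μ) with hE
  have h1 : P * Matrix.diagonal d * P⁻¹ - μ • 1 = P * E * P⁻¹ := by
    have : E = Matrix.diagonal d - μ • 1 := by
      rw [hE, Matrix.smul_one_eq_diagonal, Matrix.diagonal_sub]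
    rw [this, Matrix.mul_sub, Matrix.sub_mul]
    simp [Matrix.mul_nonsing_inv _ hP']
  have h2 : Matrix.toLin' (P * Matrix.diagonal d * P⁻¹) - μ • (1 : Module.End ℂ (Fin n → ℂ))
      = Matrix.toLin' (P * E * P⁻¹) := by
    rw [← h1, map_sub, map_smul, Matrix.toLin'_one]; rfl
  have h3 : ∀ k : ℕ, (P * E * P⁻¹) ^ k = P * E ^ k * P⁻¹ := by
    intro k
    induction k with
    | zero => simp [Matrix.mul_nonsing_inv _ hP']
    | succ k ih =>
      rw [pow_succ, ih, pow_succ]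
      calc P * E ^ k * P⁻¹ * (P * E * P⁻¹) = P * E ^ k * (P⁻¹ * P) * E * P⁻¹ := by
            simp only [Matrix.mul_assoc]
        _ = _ := by rw [Matrix.nonsing_inv_mul _ hP']; simp [Matrix.mul_assoc]
  rw [h2, ← Matrix.toLin'_pow, h3, Matrix.toLin'_apply] at h
  have h4 : (E ^ k).mulVec (P⁻¹.mulVec v) = 0 := by
    have := congrArg (P⁻¹.mulVec) h
    rw [Matrix.mulVec_zero, Matrix.mulVec_mulVec, ← Matrix.mul_assoc, ← Matrix.mul_assoc,
      Matrix.nonsing_inv_mul _ hP', Matrix.one_mul, ← Matrix.mulVec_mulVec] at this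
    exact this
  have h5 : E.mulVec (P⁻¹.mulVec v) = 0 := by
    funext l
    have := congrFun h4 l
    rw [hE, Matrix.diagonal_pow, Matrix.mulVec_diagonal] at this
    rw [hE, Matrix.mulVec_diagonal]
    simp only [Pi.zero_apply, mul_eq_zero, Pi.pow_apply] at this ⊢
    rcases this with h | h
    · left; exact pow_eq_zero_iff (n := k) (by rintro rfl; simp at h) |>.1 h
    · right; exact h
  have h6 : (P * E * P⁻¹).mulVec v = 0 := by
    rw [← Matrix.mulVec_mulVec, ← Matrix.mulVec_mulVec, h5, Matrix.mulVec_zero]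
  rw [← h1, Matrix.sub_mulVec, sub_eq_zero] at h6
  rw [h6, Matrix.smul_mulVec, Matrix.one_mulVec]

theorem simdiag (A : Fin r → Matrix (Fin n) (Fin n) ℂ) (hc : ∀ i j, A i * A j = A j * A i)
    (hs : ∀ i, ∃ P : Matrix (Fin n) (Fin n) ℂ, IsUnit P ∧ ∃ d : Fin n → ℂ,
      A i = P * Matrix.diagonal d * P⁻¹) :
    ∃ P : Matrix (Fin n) (Fin n) ℂ, IsUnit P.det ∧ ∃ L : Fin r → Fin n → ℂ,
      ∀ i, A i = P * Matrix.diagonal (L i) * P⁻¹ := by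
  have h1 := Module.End.iSup_iInf_maxGenEigenspace_eq_top_of_iSup_maxGenEigenspace_eq_top_of_commute
    (K := ℂ) (fun i => Matrix.toLin' (A i)) (fun i j _ => by
      show (Matrix.toLin' (A i)).comp (Matrix.toLin' (A j)) = (Matrix.toLin' (A j)).comp (Matrix.toLin' (A i))
      rw [← Matrix.toLin'_mul, ← Matrix.toLin'_mul, hc])
    (fun i => Module.End.iSup_maxGenEigenspace_eq_top _)
  set S : Set (Fin n → ℂ) := {v | ∃ χ : Fin r → ℂ, ∀ i, (A i).mulVec v = χ i • v} with hS
  have h2 : ⊤ ≤ Submodule.span ℂ S := by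
    rw [← h1]
    refine iSup_le fun χ => fun v hv => Submodule.subset_span ⟨χ, fun i => ?_⟩
    rw [Module.End.mem_iInf_maxGenEigenspace_iff] at hv
    obtain ⟨k, hk⟩ := hv i
    obtain ⟨P, hP, d, hd⟩ := hs i
    beta_reduce at hk
    rw [hd] at hk ⊢
    exact gen_eigen P hP d _ k v hk
  set b := Module.Basis.ofSpan h2
  have hfin : Finite _ := Module.Finite.finite_basis b
  letI := Fintype.ofFinite ((linearIndepOn_empty ℂ id).extend (Set.empty_subset S))
  have hcard : Fintype.card ((linearIndepOn_empty ℂ id).extend (Set.empty_subset S)) = n := by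
    rw [← Module.finrank_eq_card_basis b]; simp
  set e := Fintype.equivFinOfCardEq hcard
  set b' := b.reindex e
  have hb' : ∀ l, ∃ χ : Fin r → ℂ, ∀ i, (A i).mulVec (b' l) = χ i • b' l := by
    intro l
    have : b' l ∈ S := by
      rw [Module.Basis.reindex_apply]
      exact Module.Basis.ofSpan_subset h2 ⟨_, rfl⟩
    exact this
  choose χ hχ using hb'
  set P : Matrix (Fin n) (Fin n) ℂ := Matrix.of fun s l => b' l s with hP
  have hPu : IsUnit P := by
    rw [← Matrix.linearIndependent_cols_iff_isUnit]
    exact b'.linearIndependent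
  have hPd := (Matrix.isUnit_iff_isUnit_det _).1 hPu
  refine ⟨P, hPd, fun i l => χ l i, fun i => ?_⟩
  have h3 : A i * P = P * Matrix.diagonal (fun l => χ l i) := by
    ext s l
    rw [Matrix.mul_diagonal]
    have := congrFun (hχ l i) s
    rw [Matrix.mul_apply]
    simp only [hP, Matrix.of_apply]
    rw [mul_comm]
    exact this
  rw [← h3, Matrix.mul_assoc, Matrix.mul_nonsing_inv _ hPd, Matrix.mul_one]
end GeoLin

namespace GeoLin
open Filter Topology
variable {n r q : ℕ}

theorem exists_equiv (P : Matrix (Fin n) (Fin n) ℂ) (hP : IsUnit P.det) :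
    ∃ E : (Fin n → ℂ) ≃L[ℂ] (Fin n → ℂ), ∀ y, E y = P.mulVec y := by
  let E0 : (Fin n → ℂ) ≃ₗ[ℂ] (Fin n → ℂ) := LinearEquiv.ofLinear (Matrix.toLin' P) (Matrix.toLin' P⁻¹)
    (by rw [← Matrix.toLin'_mul, Matrix.mul_nonsing_inv _ hP, Matrix.toLin'_one])
    (by rw [← Matrix.toLin'_mul, Matrix.nonsing_inv_mul _ hP, Matrix.toLin'_one])
  exact ⟨E0.toContinuousLinearEquiv, fun y => rfl⟩

theorem lin_comm (A : Fin r → Matrix (Fin n) (Fin n) ℂ)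
    (Z : Fin r → (Fin n → ℂ) → (Fin n → ℂ)) (hZan : ∀ i, AnalyticAt ℂ (Z i) 0)
    (hZ0 : ∀ i, Z i 0 = 0) (hZ1 : ∀ i v, fderiv ℂ (Z i) 0 v = (A i).mulVec v)
    (hcomm : ∀ i j, ∀ᶠ x in 𝓝 0, fderiv ℂ (Z j) x (Z i x) = fderiv ℂ (Z i) x (Z j x)) :
    ∀ i j, A i * A j = A j * A i := by
  have key : ∀ i j v, fderiv ℂ (fun x => fderiv ℂ (Z j) x (Z i x)) 0 v = (A j * A i).mulVec v := by
    intro i j v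
    have h1 := ((hZan j).fderiv.differentiableAt.hasFDerivAt).clm_apply
      (hZan i).differentiableAt.hasFDerivAt
    rw [h1.fderiv]
    simp [hZ0, hZ1, Matrix.mulVec_mulVec]
  intro i j
  refine Matrix.mulVec_injective ?_
  funext v
  have h2 : (fun x => fderiv ℂ (Z j) x (Z i x)) =ᶠ[𝓝 0] fun x => fderiv ℂ (Z i) x (Z j x) := hcomm i j
  rw [← key j i, ← key i j, h2.fderiv_eq]

theorem rep_iter {F : (Fin n → ℂ) → ℂ} {Φ} (hF : Rep F Φ) (k : ℕ) (y : Fin n → ℂ) :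
    (k.factorial : ℂ) * hom Φ k y = iteratedFDeriv ℂ k F 0 fun _ => y := by
  obtain ⟨R, hR⟩ := hF.hasFPowerSeriesAt
  have h1 := hR.factorial_smul y k
  rw [← h1, ser_apply]
  simp

theorem reduced {κ : ℕ} (A : Fin r → Matrix (Fin n) (Fin n) ℂ) (hn : n = r + q)
    (hss : ∀ i, ∃ P : Matrix (Fin n) (Fin n) ℂ, IsUnit P ∧ ∃ d : Fin n → ℂ,
      A i = P * Matrix.diagonal d * P⁻¹)
    (hAind : Dense {z : Fin n → ℂ | LinearIndependent ℂ fun i => (A i).mulVec z})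
    (Z : Fin r → (Fin n → ℂ) → (Fin n → ℂ)) (hZan : ∀ i, AnalyticAt ℂ (Z i) 0)
    (hZ0 : ∀ i, Z i 0 = 0) (hZ1 : ∀ i v, fderiv ℂ (Z i) 0 v = (A i).mulVec v)
    (hcomm : ∀ i j, ∀ᶠ x in 𝓝 0, fderiv ℂ (Z j) x (Z i x) = fderiv ℂ (Z i) x (Z j x))
    (a : Fin r → Fin κ → (Fin n → ℂ) → ℂ) (ha : ∀ i l, AnalyticAt ℂ (a i l) 0)
    (hacomm : ∀ i j l, ∀ᶠ x in 𝓝 0, fderiv ℂ (a j l) x (Z i x) = fderiv ℂ (a i l) x (Z j x))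
    (F : Fin q → (Fin n → ℂ) → ℂ) (hFan : ∀ j, AnalyticAt ℂ (F j) 0)
    (hFZ : ∀ j i, ∀ᶠ x in 𝓝 0, fderiv ℂ (F j) x (Z i x) = 0)
    (d : Fin q → ℕ) (G : Fin q → (Fin n → ℂ) → ℂ)
    (hlow : ∀ j, ∀ l < d j, iteratedFDeriv ℂ l (F j) 0 = 0)
    (hG : ∀ j z, G j z = (((d j).factorial : ℂ))⁻¹ • iteratedFDeriv ℂ (d j) (F j) 0 (fun _ => z))
    (hGind : Dense {z : Fin n → ℂ | LinearIndependent ℂ fun j => fderiv ℂ (G j) z}) :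
    ∃ (ψ : (Fin n → ℂ) → (Fin n → ℂ)) (f : Fin r → Fin r → (Fin n → ℂ) → ℂ)
      (u : Fin κ → (Fin n → ℂ) → ℂ) (h : Fin r → Fin κ → (Fin n → ℂ) → ℂ),
      AnalyticAt ℂ ψ 0 ∧ ψ 0 = 0 ∧ (∀ v, fderiv ℂ ψ 0 v = v) ∧
      (∀ i j, AnalyticAt ℂ (f i j) 0) ∧ (∀ i j, f i j 0 = if i = j then 1 else 0) ∧
      (∀ l, AnalyticAt ℂ (u l) 0) ∧ (∀ l, u l 0 = 0) ∧ (∀ j l, AnalyticAt ℂ (h j l) 0) ∧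
      (∀ i j s, ∀ᶠ y in 𝓝 0, fderiv ℂ (f i j) y ((A s).mulVec y) = 0) ∧
      (∀ j l s, ∀ᶠ y in 𝓝 0, fderiv ℂ (h j l) y ((A s).mulVec y) = 0) ∧
      (∀ i, ∀ᶠ y in 𝓝 0, fderiv ℂ ψ y (∑ j, f i j y • (A j).mulVec y) = Z i (ψ y)) ∧
      ∀ i l, ∀ᶠ y in 𝓝 0, fderiv ℂ (u l) y (∑ j, f i j y • (A j).mulVec y) + ∑ j, f i j y * h j l y
        = a i l (ψ y) := by
  classical
  obtain ⟨P, hP, L, hAL⟩ := simdiag A (lin_comm A Z hZan hZ0 hZ1 hcomm) hss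
  obtain ⟨E, hE⟩ := exists_equiv P hP
  have hEL : ∀ i y, (A i).mulVec (E y) = E (L i * y) := by
    intro i y
    rw [hE, hE, hAL, Matrix.mulVec_mulVec, Matrix.mul_assoc, Matrix.nonsing_inv_mul _ hP, Matrix.mul_one,
      ← Matrix.mulVec_mulVec]
    congr 1
    funext l
    rw [Matrix.mulVec_diagonal]; rfl
  have hL : LinearIndependent ℂ L := by
    obtain ⟨z, hz⟩ := hAind.nonempty
    have hz : LinearIndependent ℂ fun i => (A i).mulVec z := hz
    rw [Fintype.linearIndependent_iff] at hz ⊢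
    intro g hg
    refine hz g ?_
    have h1 : ∀ i, (A i).mulVec z = E (L i * E.symm z) := by
      intro i; rw [← hEL, E.apply_symm_apply]
    simp only [h1, ← map_smul]
    rw [← map_sum]
    have h2 : ∑ i, g i • (L i * E.symm z) = (∑ i, g i • L i) * E.symm z := by
      rw [Finset.sum_mul]; simp
    rw [h2, hg, zero_mul, map_zero]
  have htE : Tendsto E (𝓝 0) (𝓝 0) := by
    have := E.continuous.tendsto 0; rwa [map_zero] at this
  have htS : Tendsto E.symm (𝓝 0) (𝓝 0) := by
    have := E.symm.continuous.tendsto 0; rwa [map_zero] at this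
  have hEan : AnalyticAt ℂ (fun y => E y) 0 := (E : (Fin n → ℂ) →L[ℂ] (Fin n → ℂ)).analyticAt 0
  have hSan : AnalyticAt ℂ (fun y => E.symm y) 0 := (E.symm : (Fin n → ℂ) →L[ℂ] (Fin n → ℂ)).analyticAt 0
  -- general composition facts
  have anE : ∀ {g : (Fin n → ℂ) → ℂ}, AnalyticAt ℂ g 0 → AnalyticAt ℂ (fun y => g (E y)) 0 := by
    intro g hg
    have : AnalyticAt ℂ g (E 0) := by rwa [map_zero]
    exact this.comp hEan
  have anS : ∀ {g : (Fin n → ℂ) → ℂ}, AnalyticAt ℂ g 0 → AnalyticAt ℂ (fun y => g (E.symm y)) 0 := by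
    intro g hg
    have : AnalyticAt ℂ g (E.symm 0) := by rwa [map_zero]
    exact this.comp hSan
  have dE : ∀ (g : (Fin n → ℂ) → ℂ) y v, fderiv ℂ (fun y => g (E y)) y v = fderiv ℂ g (E y) (E v) := by
    intro g y v
    have h1 : fderiv ℂ (fun y => g (E y)) y = _ := E.comp_right_fderiv (f := g) (x := y)
    rw [h1]; rfl
  have dS : ∀ (g : (Fin n → ℂ) → ℂ) y v, fderiv ℂ (fun y => g (E.symm y)) y v
      = fderiv ℂ g (E.symm y) (E.symm v) := by
    intro g y v
    have h1 : fderiv ℂ (fun y => g (E.symm y)) y = _ := E.symm.comp_right_fderiv (f := g) (x := y)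
    rw [h1]; rfl
  have dZ : ∀ (g : (Fin n → ℂ) → (Fin n → ℂ)) y v, fderiv ℂ (fun y => E.symm (g (E y))) y v
      = E.symm (fderiv ℂ g (E y) (E v)) := by
    intro g y v
    have h1 : fderiv ℂ (fun y => g (E y)) y = _ := E.comp_right_fderiv (f := g) (x := y)
    have h2 : fderiv ℂ (fun y => E.symm (g (E y))) y = _ :=
      E.symm.comp_fderiv (f := fun y => g (E y)) (x := y)
    rw [h2, h1]; rfl
  have dψ : ∀ (g : (Fin n → ℂ) → (Fin n → ℂ)) y v, fderiv ℂ (fun y => E (g (E.symm y))) y v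
      = E (fderiv ℂ g (E.symm y) (E.symm v)) := by
    intro g y v
    have h1 : fderiv ℂ (fun y => g (E.symm y)) y = _ := E.symm.comp_right_fderiv (f := g) (x := y)
    have h2 : fderiv ℂ (fun y => E (g (E.symm y))) y = _ :=
      E.comp_fderiv (f := fun y => g (E.symm y)) (x := y)
    rw [h2, h1]; rfl
  choose Φ hΦ using fun j => AnalyticAt.exists_rep (anE (hFan j))
  have hiter : ∀ j k y, (k.factorial : ℂ) * hom (Φ j) k y = iteratedFDeriv ℂ k (F j) 0 fun _ => E y := by
    intro j k y
    rw [rep_iter (hΦ j)]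
    have h1 := E.iteratedFDerivWithin_comp_right (f := F j) (s := Set.univ) uniqueDiffOn_univ
      (x := 0) (Set.mem_univ _) k
    rw [Set.preimage_univ, iteratedFDerivWithin_univ, iteratedFDerivWithin_univ, map_zero] at h1
    have h2 : iteratedFDeriv ℂ k (fun y => F j (E y)) 0 = _ := h1
    rw [h2]; rfl
  have hGhom : ∀ j y, hom (Φ j) (d j) y = G j (E y) := by
    intro j y
    rw [hG, ← hiter, smul_eq_mul, inv_mul_cancel_left₀]
    exact_mod_cast (Nat.factorial_ne_zero _)
  have hΦlow : ∀ j α, α.degree < d j → Φ j α = 0 := by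
    intro j α hα
    refine hom_eq_zero (k := α.degree) (fun y => ?_) α rfl
    have h1 := hiter j α.degree y
    rw [hlow j _ hα] at h1
    have h2 : ((α.degree.factorial : ℕ) : ℂ) ≠ 0 := by exact_mod_cast (Nat.factorial_ne_zero _)
    simpa [h2, Nat.factorial_ne_zero] using h1
  have hdense : Dense {y | LinearIndependent ℂ fun j => fderiv ℂ (hom (Φ j) (d j)) y} := by
    have h1 := hGind.preimage E.toHomeomorph.isOpenMap
    refine h1.mono fun y hy => ?_
    have hy : LinearIndependent ℂ fun j => fderiv ℂ (G j) (E y) := hy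
    show LinearIndependent ℂ _
    rw [Fintype.linearIndependent_iff] at hy ⊢
    intro g hg
    refine hy g ?_
    ext v
    have h2 := congrArg (fun T => T (E.symm v)) hg
    have h3 : ∀ j, fderiv ℂ (hom (Φ j) (d j)) y (E.symm v) = fderiv ℂ (G j) (E y) v := by
      intro j
      have : hom (Φ j) (d j) = fun y => G j (E y) := funext (hGhom j)
      rw [this, dE, E.apply_symm_apply]
    simpa [ContinuousLinearMap.sum_apply, h3] using h2
  obtain ⟨ψ, f, u, h, hψ, hψ0, hψ1, hf, hf0, hu, hu0, hh, hfint, hhfi, hconj, hsol⟩ :=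
    core2 L hL hn (fun i y => E.symm (Z i (E y)))
      (fun i => by
        have h1 : AnalyticAt ℂ (Z i) (E 0) := by rw [map_zero]; exact hZan i
        exact ((E.symm : (Fin n → ℂ) →L[ℂ] (Fin n → ℂ)).analyticAt _).comp (h1.comp hEan))
      (fun i => by simp [hZ0])
      (fun i v => by rw [dZ, map_zero, hZ1, hEL, E.symm_apply_apply])
      (fun i j => by
        filter_upwards [htE.eventually (hcomm i j)] with x hx
        rw [dZ, dZ, E.apply_symm_apply, E.apply_symm_apply, hx])
      (fun i l y => a i l (E y)) (fun i l => anE (ha i l))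
      (fun i j l => by
        filter_upwards [htE.eventually (hacomm i j l)] with x hx
        rw [dE, dE, E.apply_symm_apply, E.apply_symm_apply, hx])
      (fun j y => F j (E y)) Φ hΦ d hΦlow
      (fun j i => by
        filter_upwards [htE.eventually (hFZ j i)] with x hx
        rw [dE, E.apply_symm_apply, hx])
      hdense
  have hAS : ∀ i y, E.symm ((A i).mulVec y) = L i * E.symm y := by
    intro i y
    have := hEL i (E.symm y)
    rw [E.apply_symm_apply] at this
    rw [this, E.symm_apply_apply]
  refine ⟨fun y => E (ψ (E.symm y)), fun i j y => f i j (E.symm y), fun l y => u l (E.symm y),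
    fun j l y => h j l (E.symm y), ?_, by simp [hψ0], ?_, fun i j => anS (hf i j), ?_,
    fun l => anS (hu l), ?_, fun j l => anS (hh j l), ?_, ?_, ?_, ?_⟩
  · have h1 : AnalyticAt ℂ ψ (E.symm 0) := by rw [map_zero]; exact hψ
    exact ((E : (Fin n → ℂ) →L[ℂ] (Fin n → ℂ)).analyticAt _).comp (h1.comp hSan)
  · intro v; rw [dψ, map_zero, hψ1, E.apply_symm_apply]
  · intro i j; simp [hf0]
  · intro l; simp [hu0]
  · intro i j s
    filter_upwards [htS.eventually (hfint i j s)] with y hy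
    rw [dS, hAS, hy]
  · intro i j s
    filter_upwards [htS.eventually (hhfi i j s)] with y hy
    rw [dS, hAS, hy]
  · intro i
    filter_upwards [htS.eventually (hconj i)] with y hy
    rw [dψ, map_sum]
    simp only [map_smul, hAS]
    rw [hy, E.apply_symm_apply]
  · intro i l
    filter_upwards [htS.eventually (hsol i l)] with y hy
    rw [dS, map_sum]
    simp only [map_smul, hAS]
    exact hy
end GeoLin

namespace GeoLin
open Filter Topology
variable {n r q : ℕ}

/-- model vector fields indexed by a sum type -/
noncomputable def YS {m k : ℕ} (π : (Fin m → ℂ) →L[ℂ] (Fin n → ℂ)) (ι : (Fin n → ℂ) →L[ℂ] (Fin m → ℂ))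
    (J : (Fin k → ℂ) →L[ℂ] (Fin m → ℂ)) (A : Fin r → Matrix (Fin n) (Fin n) ℂ) :
    Fin r ⊕ Fin k → (Fin m → ℂ) → (Fin m → ℂ) :=
  Sum.elim (fun j y => ι ((A j).mulVec (π y))) (fun l _ => J (Pi.single l 1))

/-- vector fields indexed by a sum type -/
noncomputable def XS {m k : ℕ} (J : (Fin k → ℂ) →L[ℂ] (Fin m → ℂ))
    (X : Fin r → (Fin m → ℂ) → (Fin m → ℂ)) :
    Fin r ⊕ Fin k → (Fin m → ℂ) → (Fin m → ℂ) :=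
  Sum.elim X (fun l _ => J (Pi.single l 1))

/-- coefficient functions indexed by a sum type -/
noncomputable def gS {k : ℕ} (f : Fin r → Fin r → (Fin n → ℂ) → ℂ) (h : Fin r → Fin k → (Fin n → ℂ) → ℂ) :
    Fin r ⊕ Fin k → Fin r ⊕ Fin k → (Fin n → ℂ) → ℂ
  | Sum.inl i, Sum.inl j => f i j
  | Sum.inl i, Sum.inr l => fun y => ∑ t, f i t y * h t l y
  | Sum.inr _, Sum.inl _ => fun _ => 0
  | Sum.inr l, Sum.inr l' => fun _ => if l = l' then 1 else 0

theorem gS_analytic {k : ℕ} {f : Fin r → Fin r → (Fin n → ℂ) → ℂ} {h : Fin r → Fin k → (Fin n → ℂ) → ℂ}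
    {y : Fin n → ℂ} (hf : ∀ i j, AnalyticAt ℂ (f i j) y) (hh : ∀ j l, AnalyticAt ℂ (h j l) y) (i j) :
    AnalyticAt ℂ (gS f h i j) y := by
  rcases i with i | i <;> rcases j with j | j
  · exact hf i j
  · exact Finset.analyticAt_fun_sum _ fun t _ => (hf i t).mul (hh t j)
  · exact analyticAt_const
  · exact analyticAt_const

theorem gS_int {k : ℕ} {f : Fin r → Fin r → (Fin n → ℂ) → ℂ} {h : Fin r → Fin k → (Fin n → ℂ) → ℂ}
    {y v : Fin n → ℂ} (hf : ∀ i j, AnalyticAt ℂ (f i j) y) (hh : ∀ j l, AnalyticAt ℂ (h j l) y)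
    (hfi : ∀ i j, fderiv ℂ (f i j) y v = 0) (hhi : ∀ j l, fderiv ℂ (h j l) y v = 0) (i j) :
    fderiv ℂ (gS f h i j) y v = 0 := by
  rcases i with i | i <;> rcases j with j | j
  · exact hfi i j
  · show fderiv ℂ (fun y => ∑ t, f i t y * h t j y) y v = 0
    rw [fderiv_fun_sum fun t _ => (hf i t).differentiableAt.fun_mul (hh t j).differentiableAt,
      ContinuousLinearMap.sum_apply]
    refine Finset.sum_eq_zero fun t _ => ?_
    rw [fderiv_fun_mul (hf i t).differentiableAt (hh t j).differentiableAt]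
    simp [hfi, hhi]
  · show fderiv ℂ (fun _ => (0 : ℂ)) y v = 0
    simp
  · show fderiv ℂ (fun _ => (if i = j then (1 : ℂ) else 0)) y v = 0
    simp

theorem gS_det {k : ℕ} {f : Fin r → Fin r → (Fin n → ℂ) → ℂ} {h : Fin r → Fin k → (Fin n → ℂ) → ℂ}
    (hf0 : ∀ i j, f i j 0 = if i = j then 1 else 0) :
    (Matrix.of fun i j => gS f h i j 0).det ≠ 0 := by
  have : (Matrix.of fun i j => gS f h i j 0) =
      Matrix.fromBlocks 1 (Matrix.of fun i l => ∑ t, f i t 0 * h t l 0) 0 1 := by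
    ext i j
    rcases i with i | i <;> rcases j with j | j <;> simp [gS, hf0, Matrix.one_apply]
  rw [this, Matrix.det_fromBlocks_zero₂₁]
  simp

theorem final_abs {m k : ℕ} (π : (Fin m → ℂ) →L[ℂ] (Fin n → ℂ)) (ι : (Fin n → ℂ) →L[ℂ] (Fin m → ℂ))
    (ρ : (Fin m → ℂ) →L[ℂ] (Fin k → ℂ)) (J : (Fin k → ℂ) →L[ℂ] (Fin m → ℂ))
    (hπι : ∀ z, π (ι z) = z) (hπJ : ∀ c, π (J c) = 0) (hρι : ∀ z, ρ (ι z) = 0) (hρJ : ∀ c, ρ (J c) = c)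
    (hid : ∀ x, J (ρ x) + ι (π x) = x) (hn : n = r + q)
    (U : Set (Fin m → ℂ)) (hUopen : IsOpen U) (hU0 : (0 : Fin m → ℂ) ∈ U)
    (X : Fin r → (Fin m → ℂ) → (Fin m → ℂ)) (F : Fin q → (Fin m → ℂ) → ℂ)
    (hXan : ∀ i, AnalyticOnNhd ℂ (X i) U) (hFan : ∀ j, AnalyticOnNhd ℂ (F j) U)
    (hcomm : ∀ i j, ∀ x ∈ U, fderiv ℂ (X j) x (X i x) = fderiv ℂ (X i) x (X j x))
    (hFint : ∀ i j, ∀ x ∈ U, fderiv ℂ (F j) x (X i x) = 0)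
    (hXinv : ∀ i x, X i x = X i (ι (π x))) (hFinv : ∀ j x, F j x = F j (ι (π x)))
    (hfix : ∀ i, X i 0 = 0)
    (A : Fin r → Matrix (Fin n) (Fin n) ℂ)
    (hA : ∀ i v, π (fderiv ℂ (X i) 0 (ι v)) = (A i).mulVec v)
    (hss : ∀ i, ∃ P : Matrix (Fin n) (Fin n) ℂ, IsUnit P ∧ ∃ d : Fin n → ℂ,
      A i = P * Matrix.diagonal d * P⁻¹)
    (hAind : Dense {z : Fin n → ℂ | LinearIndependent ℂ fun i => (A i).mulVec z})
    (d : Fin q → ℕ) (G : Fin q → (Fin n → ℂ) → ℂ)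
    (hlow : ∀ j, ∀ l < d j, iteratedFDeriv ℂ l (fun z => F j (ι z)) 0 = 0)
    (hG : ∀ j z, G j z = (((d j).factorial : ℂ))⁻¹ •
      iteratedFDeriv ℂ (d j) (fun z => F j (ι z)) 0 (fun _ => z))
    (hGind : Dense {z : Fin n → ℂ | LinearIndependent ℂ fun j => fderiv ℂ (G j) z}) :
    ∃ V W : Set (Fin m → ℂ), IsOpen V ∧ V ⊆ U ∧ (0 : Fin m → ℂ) ∈ V ∧
      IsOpen W ∧ (0 : Fin m → ℂ) ∈ W ∧
      ∃ φ ψ : (Fin m → ℂ) → (Fin m → ℂ),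
        AnalyticOnNhd ℂ φ V ∧ AnalyticOnNhd ℂ ψ W ∧
        Set.MapsTo φ V W ∧ Set.MapsTo ψ W V ∧
        (∀ x ∈ V, ψ (φ x) = x) ∧ (∀ y ∈ W, φ (ψ y) = y) ∧ φ '' V = W ∧ φ 0 = 0 ∧
        ∃ f : Fin r ⊕ Fin k → Fin r ⊕ Fin k → (Fin m → ℂ) → ℂ,
          (∀ i j, AnalyticOnNhd ℂ (f i j) W) ∧
          (∀ y ∈ W, (Matrix.of fun i j => f i j y).det ≠ 0) ∧
          (∀ i j l, ∀ y ∈ W, fderiv ℂ (f i j) y (YS π ι J A l y) = 0) ∧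
          (∀ i, ∀ x ∈ V, fderiv ℂ φ x (XS J X i x) =
            ∑ j, f i j (φ x) • YS π ι J A j (φ x)) := by
  classical
  have hUn : U ∈ 𝓝 (0 : Fin m → ℂ) := hUopen.mem_nhds hU0
  have hιU : ∀ᶠ z in 𝓝 (0 : Fin n → ℂ), ι z ∈ U := by
    have := ι.continuous.tendsto 0
    rw [map_zero] at this
    exact this.eventually hUn
  have hιan : ∀ z, AnalyticAt ℂ (fun z => ι z) z := fun z => ι.analyticAt z
  have hπan : ∀ z, AnalyticAt ℂ (fun z => π z) z := fun z => π.analyticAt z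
  have hXι : ∀ i z, ι z ∈ U → AnalyticAt ℂ (fun z => X i (ι z)) z := fun i z hz =>
    (hXan i (ι z) hz).comp (hιan z)
  have hFι : ∀ i z, ι z ∈ U → AnalyticAt ℂ (fun z => F i (ι z)) z := fun i z hz =>
    (hFan i (ι z) hz).comp (hιan z)
  -- derivatives through projections
  have dX : ∀ i z v, ι z ∈ U → fderiv ℂ (X i) (ι z) v = fderiv ℂ (fun z => X i (ι z)) z (π v) := by
    intro i z v hz
    have h1 : HasFDerivAt (fun z => X i (ι z)) (fderiv ℂ (fun z => X i (ι z)) z) (π (ι z)) := by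
      rw [hπι]; exact (hXι i z hz).differentiableAt.hasFDerivAt
    have h2 := h1.comp (ι z) π.hasFDerivAt
    have h3 : ((fun z => X i (ι z)) ∘ π) = X i := by
      funext x; exact (hXinv i x).symm
    rw [h3] at h2
    rw [h2.fderiv]; rfl
  have dF : ∀ j z v, ι z ∈ U → fderiv ℂ (F j) (ι z) v = fderiv ℂ (fun z => F j (ι z)) z (π v) := by
    intro i z v hz
    have h1 : HasFDerivAt (fun z => F i (ι z)) (fderiv ℂ (fun z => F i (ι z)) z) (π (ι z)) := by
      rw [hπι]; exact (hFι i z hz).differentiableAt.hasFDerivAt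
    have h2 := h1.comp (ι z) π.hasFDerivAt
    have h3 : ((fun z => F i (ι z)) ∘ π) = F i := by
      funext x; exact (hFinv i x).symm
    rw [h3] at h2
    rw [h2.fderiv]; rfl
  have h0U : ι 0 ∈ U := by rw [map_zero]; exact hU0
  have dZ : ∀ i z v, ι z ∈ U → fderiv ℂ (fun z => π (X i (ι z))) z v
      = π (fderiv ℂ (fun z => X i (ι z)) z v) := by
    intro i z v hz
    have h2 := π.hasFDerivAt.comp z (hXι i z hz).differentiableAt.hasFDerivAt
    have h3 : fderiv ℂ (fun z => π (X i (ι z))) z = _ := h2.fderiv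
    rw [h3]; rfl
  have da : ∀ i l z v, ι z ∈ U → fderiv ℂ (fun z => ρ (X i (ι z)) l) z v
      = ρ (fderiv ℂ (fun z => X i (ι z)) z v) l := by
    intro i l z v hz
    have h2 := ((ContinuousLinearMap.proj (R := ℂ) (φ := fun _ : Fin k => ℂ) l).comp ρ).hasFDerivAt.comp z
      (hXι i z hz).differentiableAt.hasFDerivAt
    have h3 : fderiv ℂ (fun z => ρ (X i (ι z)) l) z = _ := h2.fderiv
    rw [h3]; rfl
  have hcomm' : ∀ i j z, ι z ∈ U → fderiv ℂ (fun z => X j (ι z)) z (π (X i (ι z)))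
      = fderiv ℂ (fun z => X i (ι z)) z (π (X j (ι z))) := by
    intro i j z hz
    rw [← dX j z _ hz, ← dX i z _ hz, hcomm i j _ hz]
  obtain ⟨ψ, f, u, h, hψ, hψ0, hψ1, hf, hf0, hu, hu0, hh, hfint, hhfi, hconj, hsol⟩ :=
    reduced (κ := k) A hn hss hAind (fun i z => π (X i (ι z)))
      (fun i => (π.analyticAt _).comp (hXι i 0 h0U))
      (fun i => by simp [hfix])
      (fun i v => by
        rw [dZ i 0 v h0U, ← hA, ← hπι v, ← dX i 0 _ h0U, map_zero, hπι])
      (fun i j => by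
        filter_upwards [hιU] with z hz
        rw [dZ j z _ hz, dZ i z _ hz, hcomm' i j z hz])
      (fun i l z => ρ (X i (ι z)) l)
      (fun i l => (((ContinuousLinearMap.proj (R := ℂ) (φ := fun _ : Fin k => ℂ) l).comp ρ).analyticAt
        _).comp (hXι i 0 h0U))
      (fun i j l => by
        filter_upwards [hιU] with z hz
        rw [da j l z _ hz, da i l z _ hz, hcomm' i j z hz])
      (fun j z => F j (ι z)) (fun j => hFι j 0 h0U)
      (fun j i => by
        filter_upwards [hιU] with z hz
        rw [← dF j z _ hz, hFint i j _ hz])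
      d G hlow hG hGind
  set uu : (Fin n → ℂ) → (Fin k → ℂ) := fun y l => u l y with huu
  have huan : AnalyticAt ℂ uu 0 := by
    rw [analyticAt_pi_iff]; exact hu
  have hduu : ∀ y, AnalyticAt ℂ uu y → ∀ l v, fderiv ℂ (u l) y v = (fderiv ℂ uu y v) l := by
    intro y hy l v
    have h3 := (ContinuousLinearMap.proj (R := ℂ) (φ := fun _ : Fin k => ℂ) l).hasFDerivAt.comp
      y hy.differentiableAt.hasFDerivAt
    have h4 : fderiv ℂ (u l) y = _ := h3.fderiv
    rw [h4]; simp
  set Ψ : (Fin m → ℂ) → (Fin m → ℂ) := fun y => J (ρ y + uu (π y)) + ι (ψ (π y)) with hΨ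
  -- derivative of Ψ
  have hΨd : ∀ y, AnalyticAt ℂ uu (π y) → AnalyticAt ℂ ψ (π y) → AnalyticAt ℂ Ψ y := by
    intro y h1 h2
    exact ((J.analyticAt _).comp ((ρ.analyticAt y).add (h1.comp (hπan y)))).add
      ((ι.analyticAt _).comp (h2.comp (hπan y)))
  have hΨf : ∀ y, AnalyticAt ℂ uu (π y) → AnalyticAt ℂ ψ (π y) → ∀ v,
      fderiv ℂ Ψ y v = J (ρ v + fderiv ℂ uu (π y) (π v)) + ι (fderiv ℂ ψ (π y) (π v)) := by
    intro y h1 h2 v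
    have h3 := (h1.differentiableAt.hasFDerivAt).comp y π.hasFDerivAt
    have h4 := (h2.differentiableAt.hasFDerivAt).comp y π.hasFDerivAt
    have h5 := (J.hasFDerivAt.comp y (ρ.hasFDerivAt.add h3)).add (ι.hasFDerivAt.comp y h4)
    have h6 : fderiv ℂ Ψ y = _ := h5.fderiv
    rw [h6]; rfl
  have huan0 : AnalyticAt ℂ uu (π 0) := by rw [map_zero]; exact huan
  have hψan0 : AnalyticAt ℂ ψ (π 0) := by rw [map_zero]; exact hψ
  have hΨ0 : Ψ 0 = 0 := by
    have : uu 0 = 0 := funext hu0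
    simp [hΨ, this, hψ0]
  have hΨan : AnalyticAt ℂ Ψ 0 := hΨd 0 huan0 hψan0
  set D := fderiv ℂ uu 0 with hD
  let B : (Fin m → ℂ) →L[ℂ] (Fin m → ℂ) :=
    ContinuousLinearMap.id ℂ _ + J.comp (D.comp π)
  let B' : (Fin m → ℂ) →L[ℂ] (Fin m → ℂ) :=
    ContinuousLinearMap.id ℂ _ - J.comp (D.comp π)
  let Be : (Fin m → ℂ) ≃L[ℂ] (Fin m → ℂ) := ContinuousLinearEquiv.equivOfInverse B B'
    (fun x => by simp [B, B', hπJ]) (fun x => by simp [B, B', hπJ])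
  have hBe : (Be : (Fin m → ℂ) →L[ℂ] (Fin m → ℂ)) = fderiv ℂ Ψ 0 := by
    refine ContinuousLinearMap.ext fun v => ?_
    rw [hΨf 0 huan0 hψan0, map_zero π, hψ1, map_add J]
    show v + J (D (π v)) = _
    nth_rewrite 1 [← hid v]
    abel
  have hstrict : HasStrictFDerivAt Ψ (Be : (Fin m → ℂ) →L[ℂ] (Fin m → ℂ)) 0 := by
    rw [hBe]; exact hΨan.hasStrictFDerivAt
  set e := hstrict.toOpenPartialHomeomorph Ψ with he
  have heΨ : ∀ y, e y = Ψ y := fun y => by rw [he, hstrict.toOpenPartialHomeomorph_coe]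
  have he0 : (0 : Fin m → ℂ) ∈ e.source := hstrict.mem_toOpenPartialHomeomorph_source
  have hes0 : e.symm 0 = 0 := by
    have := e.left_inv he0
    rw [heΨ, hΨ0] at this; exact this
  have hsan : AnalyticAt ℂ e.symm 0 := by
    have ht : (0 : Fin m → ℂ) ∈ e.target := by
      have := e.map_source he0; rwa [heΨ, hΨ0] at this
    refine e.analyticAt_symm (i := Be) ht ?_ ?_
    · rw [hes0]
      exact hΨan
    · rw [hes0, hBe]
      rfl
  -- good set at the n-level
  have hgood : ∀ᶠ y in 𝓝 (0 : Fin n → ℂ), AnalyticAt ℂ uu y ∧ AnalyticAt ℂ ψ y ∧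
      (∀ i j, AnalyticAt ℂ (f i j) y) ∧ (∀ i j, AnalyticAt ℂ (h i j) y) ∧
      (∀ s i j, fderiv ℂ (f i j) y ((A s).mulVec y) = 0) ∧
      (∀ s i j, fderiv ℂ (h i j) y ((A s).mulVec y) = 0) ∧
      (Matrix.of fun i j => gS f h i j y).det ≠ 0 ∧
      (∀ i, fderiv ℂ ψ y (∑ j, f i j y • (A j).mulVec y) = π (X i (ι (ψ y)))) ∧
      (∀ i l, fderiv ℂ (u l) y (∑ j, f i j y • (A j).mulVec y) + ∑ j, f i j y * h j l y
        = ρ (X i (ι (ψ y))) l) := by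
    have hdet : ∀ᶠ y in 𝓝 (0 : Fin n → ℂ), (Matrix.of fun i j => gS f h i j y).det ≠ 0 := by
      have h1 : AnalyticAt ℂ (fun y => (Matrix.of fun i j => gS f h i j y).det) 0 :=
        analyticAt_det fun i j => gS_analytic hf hh i j
      exact h1.continuousAt.eventually_ne (gS_det hf0)
    refine huan.eventually_analyticAt.and (hψ.eventually_analyticAt.and ?_)
    refine Eventually.and (eventually_all.2 fun i => eventually_all.2 fun j =>
      (hf i j).eventually_analyticAt) ?_
    refine Eventually.and (eventually_all.2 fun i => eventually_all.2 fun j =>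
      (hh i j).eventually_analyticAt) ?_
    refine Eventually.and (eventually_all.2 fun s => eventually_all.2 fun i => eventually_all.2 fun j =>
      hfint i j s) ?_
    refine Eventually.and (eventually_all.2 fun s => eventually_all.2 fun i => eventually_all.2 fun j =>
      hhfi i j s) ?_
    refine hdet.and (Eventually.and (eventually_all.2 hconj) ?_)
    exact eventually_all.2 fun i => eventually_all.2 fun l => hsol i l
  have hπt : Tendsto π (𝓝 0) (𝓝 0) := by
    have := π.continuous.tendsto 0; rwa [map_zero] at this
  have hΨt : Tendsto Ψ (𝓝 0) (𝓝 0) := by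
    have := hΨan.continuousAt.tendsto; rwa [hΨ0] at this
  have hall := (hπt.eventually hgood).and ((hΨt.eventually hUn).and
    (hΨt.eventually hsan.eventually_analyticAt))
  obtain ⟨O, hO, hOo, hO0⟩ := eventually_nhds_iff.1 hall
  set W := e.source ∩ O with hW
  have hWo : IsOpen W := e.open_source.inter hOo
  have hV : e '' W = e.target ∩ e.symm ⁻¹' W := e.image_eq_target_inter_inv_preimage Set.inter_subset_left
  have hVo : IsOpen (e '' W) := by
    rw [hV]; exact e.symm.isOpen_inter_preimage hWo
  have hsm : ∀ y ∈ W, e.symm (e y) = y := fun y hy => e.left_inv hy.1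
  -- conjugacy downstairs
  have hpush : ∀ i, ∀ y ∈ W, fderiv ℂ Ψ y (∑ j, gS f h i j (π y) • YS π ι J A j y) = XS J X i (Ψ y) := by
    intro i y hy
    obtain ⟨⟨g1, g2, g3, g4, g5, g6, g7, g8, g9⟩, -, -⟩ := hO y hy.2
    rw [Fintype.sum_sum_type]
    rcases i with i | i
    · have e1 : ∑ a₁, gS f h (Sum.inl i) (Sum.inl a₁) (π y) • YS π ι J A (Sum.inl a₁) y
          = ι (∑ j, f i j (π y) • (A j).mulVec (π y)) := by
        rw [map_sum]; simp only [map_smul]; rfl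
      have e2 : ∑ a₂, gS f h (Sum.inl i) (Sum.inr a₂) (π y) • YS π ι J A (Sum.inr a₂) y
          = J (fun l => ∑ t, f i t (π y) * h t l (π y)) := by
        have : (fun l => ∑ t, f i t (π y) * h t l (π y)) =
            ∑ l : Fin k, (∑ t, f i t (π y) * h t l (π y)) • (Pi.single l 1 : Fin k → ℂ) := by
          funext l'
          simp [Finset.sum_apply, Pi.single_apply]
        rw [this, map_sum]; simp only [map_smul]; rfl
      rw [e1, e2, hΨf y g1 g2, map_add π, map_add ρ, hπι, hπJ, hρι, hρJ, add_zero, zero_add, g8]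
      show _ = X i (Ψ y)
      have e3 : π (Ψ y) = ψ (π y) := by simp [hΨ, hπJ, hπι]
      rw [hXinv i (Ψ y), e3]
      refine Eq.trans ?_ (hid _)
      congr 2
      funext l
      rw [← g9 i l, Pi.add_apply, hduu _ g1, add_comm]
    · have e1 : ∑ a₁, gS f h (Sum.inr i) (Sum.inl a₁) (π y) • YS π ι J A (Sum.inl a₁) y = 0 :=
        Finset.sum_eq_zero fun j _ => by simp [gS]
      have e2 : ∑ a₂, gS f h (Sum.inr i) (Sum.inr a₂) (π y) • YS π ι J A (Sum.inr a₂) y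
          = J (Pi.single i 1) := by
        simp [gS, YS]
      rw [e1, e2, zero_add, hΨf y g1 g2, hπJ, hρJ]
      simp [XS]
  refine ⟨e '' W, W, hVo, ?_, ⟨0, ⟨he0, hO0⟩, by rw [heΨ, hΨ0]⟩, hWo, ⟨he0, hO0⟩, e.symm, Ψ,
    ?_, ?_, ?_, ?_, ?_, ?_, ?_, hes0, fun i j y => gS f h i j (π y), ?_, ?_, ?_, ?_⟩
  · rintro _ ⟨y, hy, rfl⟩
    rw [heΨ]; exact (hO y hy.2).2.1
  · rintro _ ⟨y, hy, rfl⟩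
    rw [heΨ]; exact (hO y hy.2).2.2
  · intro y hy
    exact hΨd y (hO y hy.2).1.1 (hO y hy.2).1.2.1
  · rintro _ ⟨y, hy, rfl⟩
    rw [hsm y hy]; exact hy
  · intro y hy
    exact ⟨y, hy, heΨ y⟩
  · rintro _ ⟨y, hy, rfl⟩
    rw [hsm y hy, heΨ]
  · intro y hy
    rw [← heΨ, hsm y hy]
  · ext y
    constructor
    · rintro ⟨_, ⟨z, hz, rfl⟩, rfl⟩
      rw [hsm z hz]; exact hz
    · intro hy
      exact ⟨e y, ⟨y, hy, rfl⟩, hsm y hy⟩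
  · intro i j y hy
    obtain ⟨⟨g1, g2, g3, g4, -⟩, -⟩ := hO y hy.2
    exact (gS_analytic g3 g4 i j).comp (hπan y)
  · intro y hy
    exact (hO y hy.2).1.2.2.2.2.2.2.1
  · intro i j l y hy
    obtain ⟨⟨g1, g2, g3, g4, g5, g6, -⟩, -⟩ := hO y hy.2
    have h3 := ((gS_analytic g3 g4 i j).differentiableAt.hasFDerivAt).comp y π.hasFDerivAt
    have h4 : fderiv ℂ (fun y => gS f h i j (π y)) y = _ := h3.fderiv
    rw [h4]
    show fderiv ℂ (gS f h i j) (π y) (π (YS π ι J A l y)) = 0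
    rcases l with l | l
    · have : π (YS π ι J A (Sum.inl l) y) = (A l).mulVec (π y) := hπι _
      rw [this]
      exact gS_int g3 g4 (g5 l) (g6 l) i j
    · have : π (YS π ι J A (Sum.inr l) y) = 0 := hπJ _
      rw [this, map_zero]
  · rintro i _ ⟨y, hy, rfl⟩
    rw [hsm y hy, heΨ, ← hpush i y hy]
    obtain ⟨⟨g1, g2, -⟩, -, g3⟩ := hO y hy.2
    have h3 := g3.differentiableAt.hasFDerivAt.comp y (hΨd y g1 g2).differentiableAt.hasFDerivAt
    have h4 : (e.symm ∘ Ψ) =ᶠ[𝓝 y] id := by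
      filter_upwards [hWo.mem_nhds hy] with z hz
      show e.symm (Ψ z) = z
      rw [← heΨ, hsm z hz]
    have h5 := h3.fderiv
    rw [h4.fderiv_eq, fderiv_id] at h5
    have h6 := congrArg (fun T => T (∑ j, gS f h i j (π y) • YS π ι J A j y)) h5
    exact h6.symm
end GeoLin

/-- Every nondegenerate singular point of a complex analytic integrable system of type
(p,q) is locally geometrically equivalent to the direct product of a nondegenerate
linear integrable system and a constant (regular) system. -/
theorem geometric_linearization_singular_point
    (p q m k : ℕ) (hm : m = p + q) (hk0 : 0 < k) (hkp : k ≤ p) (hpm : p ≤ m)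
    (U : Set (Fin m → ℂ)) (hUopen : IsOpen U) (hU0 : (0 : Fin m → ℂ) ∈ U)
    (X : Fin p → (Fin m → ℂ) → (Fin m → ℂ)) (F : Fin q → (Fin m → ℂ) → ℂ)
    (hXan : ∀ i, AnalyticOnNhd ℂ (X i) U)
    (hFan : ∀ j, AnalyticOnNhd ℂ (F j) U)
    (hcomm : ∀ i j, ∀ x ∈ U, fderiv ℂ (X j) x (X i x) - fderiv ℂ (X i) x (X j x) = 0)
    (hFint : ∀ i j, ∀ x ∈ U, fderiv ℂ (F j) x (X i x) = 0)
    (hXind : U ⊆ closure {x ∈ U | LinearIndependent ℂ fun i => X i x})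
    (hFind : U ⊆ closure {x ∈ U | LinearIndependent ℂ fun j => fderiv ℂ (F j) x})
    -- the last k vector fields are the constant coordinate vector fields e_1, ..., e_k
    (hconst : ∀ j : Fin k, X ⟨p - k + (j : ℕ), by have := j.isLt; omega⟩ =
      fun _ => Pi.single (⟨(j : ℕ), by have := j.isLt; omega⟩ : Fin m) 1)
    -- all the X_i and F_j are independent of the first k coordinates
    (hXinv : ∀ i, ∀ x y : Fin m → ℂ, (∀ l : Fin m, k ≤ (l : ℕ) → x l = y l) → X i x = X i y)
    (hFinv : ∀ j, ∀ x y : Fin m → ℂ, (∀ l : Fin m, k ≤ (l : ℕ) → x l = y l) → F j x = F j y)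
    -- 0 is a fixed point of the first p-k vector fields
    (hfix : ∀ i : Fin (p - k), X ⟨(i : ℕ), by have := i.isLt; omega⟩ 0 = 0)
    -- A_i is the linear part at 0 of the reduced vector field of X_i on ℂ^{m-k}
    (A : Fin (p - k) → Matrix (Fin (m - k)) (Fin (m - k)) ℂ)
    (hA : ∀ (i : Fin (p - k)) (r s : Fin (m - k)),
      A i r s = fderiv ℂ (X ⟨(i : ℕ), by have := i.isLt; omega⟩) 0
        (Pi.single (⟨k + (s : ℕ), by have := s.isLt; omega⟩ : Fin m) 1)
        ⟨k + (r : ℕ), by have := r.isLt; omega⟩)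
    -- the reduced system has a nondegenerate fixed point at 0 :
    (hss : ∀ i, IsSemisimpleMatrixC (A i))
    (hAind : Dense {z : Fin (m - k) → ℂ | LinearIndependent ℂ fun i => (A i).mulVec z})
    -- G_j is the lowest-degree nonzero homogeneous Taylor term at 0 of the reduced F_j
    (kk : Fin q → ℕ) (G : Fin q → (Fin (m - k) → ℂ) → ℂ)
    (hklow : ∀ j, ∀ l < kk j, iteratedFDeriv ℂ l (fun z => F j (embLast m k z)) 0 = 0)
    (hG : ∀ j z, G j z = (((kk j).factorial : ℂ))⁻¹ •
      iteratedFDeriv ℂ (kk j) (fun z' => F j (embLast m k z')) 0 (fun _ => z))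
    (hGne : ∀ j, G j ≠ 0)
    (hGind : Dense {z : Fin (m - k) → ℂ | LinearIndependent ℂ fun j => fderiv ℂ (G j) z}) :
    ∃ V W : Set (Fin m → ℂ), IsOpen V ∧ V ⊆ U ∧ (0 : Fin m → ℂ) ∈ V ∧
      IsOpen W ∧ (0 : Fin m → ℂ) ∈ W ∧
      ∃ φ ψ : (Fin m → ℂ) → (Fin m → ℂ),
        AnalyticOnNhd ℂ φ V ∧ AnalyticOnNhd ℂ ψ W ∧
        Set.MapsTo φ V W ∧ Set.MapsTo ψ W V ∧
        (∀ x ∈ V, ψ (φ x) = x) ∧ (∀ y ∈ W, φ (ψ y) = y) ∧ φ '' V = W ∧ φ 0 = 0 ∧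
        ∃ f : Fin p → Fin p → (Fin m → ℂ) → ℂ,
          (∀ i j, AnalyticOnNhd ℂ (f i j) W) ∧
          (∀ y ∈ W, (Matrix.of fun i j => f i j y).det ≠ 0) ∧
          -- each f_{ij} is a common first integral of the model vector fields
          (∀ i j l, ∀ y ∈ W, fderiv ℂ (f i j) y (modelYhat m k p hpm A l y) = 0) ∧
          (∀ i, ∀ x ∈ V, fderiv ℂ φ x (X i x) =
            ∑ j, f i j (φ x) • modelYhat m k p hpm A j (φ x)) := by
  let π : (Fin m → ℂ) →L[ℂ] (Fin (m - k) → ℂ) := ContinuousLinearMap.pi fun s =>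
    ContinuousLinearMap.proj (⟨k + (s : ℕ), by have := s.isLt; omega⟩ : Fin m)
  let ρ : (Fin m → ℂ) →L[ℂ] (Fin k → ℂ) := ContinuousLinearMap.pi fun s =>
    ContinuousLinearMap.proj (⟨(s : ℕ), by have := s.isLt; omega⟩ : Fin m)
  let ι : (Fin (m - k) → ℂ) →L[ℂ] (Fin m → ℂ) := ContinuousLinearMap.pi fun l =>
    if h : (l : ℕ) < k then 0
    else ContinuousLinearMap.proj (⟨(l : ℕ) - k, by have := l.isLt; omega⟩ : Fin (m - k))
  let J : (Fin k → ℂ) →L[ℂ] (Fin m → ℂ) := ContinuousLinearMap.pi fun l =>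
    if h : (l : ℕ) < k then ContinuousLinearMap.proj (⟨(l : ℕ), h⟩ : Fin k) else 0
  have hπ : ∀ x s, π x s = x ⟨k + (s : ℕ), by have := s.isLt; omega⟩ := fun x s => rfl
  have hρ : ∀ x s, ρ x s = x ⟨(s : ℕ), by have := s.isLt; omega⟩ := fun x s => rfl
  have hι : ∀ z, ι z = embLast m k z := by
    intro z; funext l
    by_cases h : (l : ℕ) < k <;> simp [ι, embLast, h]
  have hJ1 : ∀ c (l : Fin m) (h : (l : ℕ) < k), J c l = c ⟨l, h⟩ := by
    intro c l h; simp [J, h]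
  have hJ2 : ∀ c (l : Fin m) (_ : ¬ (l : ℕ) < k), J c l = 0 := by
    intro c l h; simp [J, h]
  have hι1 : ∀ z (l : Fin m) (_ : (l : ℕ) < k), ι z l = 0 := by
    intro c l h; simp [ι, h]
  have hι2 : ∀ z (l : Fin m) (_ : ¬ (l : ℕ) < k), ι z l = z ⟨(l : ℕ) - k, by have := l.isLt; omega⟩ := by
    intro c l h; simp [ι, h]
  have hπι : ∀ z, π (ι z) = z := by
    intro z; funext s
    rw [hπ, hι2 _ _ (by simp)]
    congr 1; ext; simp
  have hπJ : ∀ c, π (J c) = 0 := by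
    intro c; funext s
    rw [hπ, hJ2 _ _ (by simp)]; rfl
  have hρι : ∀ z, ρ (ι z) = 0 := by
    intro c; funext s
    rw [hρ, hι1 _ _ (by simp)]; rfl
  have hρJ : ∀ c, ρ (J c) = c := by
    intro c; funext s
    rw [hρ, hJ1 _ _ (by simp)]
  have hid : ∀ x, J (ρ x) + ι (π x) = x := by
    intro x; funext l
    rw [Pi.add_apply]
    by_cases h : (l : ℕ) < k
    · rw [hJ1 _ _ h, hι1 _ _ h, hρ, add_zero]
    · rw [hJ2 _ _ h, hι2 _ _ h, hπ, zero_add]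
      congr 1; ext; simp; omega
  have hJs : ∀ l : Fin k, J (Pi.single l 1) = Pi.single (⟨(l : ℕ), by have := l.isLt; omega⟩ : Fin m) 1 := by
    intro l; funext s
    by_cases h : (s : ℕ) < k
    · rw [hJ1 _ _ h]
      simp only [Pi.single_apply, Fin.ext_iff]
    · rw [hJ2 _ _ h, Pi.single_apply, if_neg]
      intro h2
      apply h; rw [h2]; exact l.isLt
  have hιs : ∀ s : Fin (m - k), ι (Pi.single s 1) =
      Pi.single (⟨k + (s : ℕ), by have := s.isLt; omega⟩ : Fin m) 1 := by
    intro s; funext l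
    by_cases h : (l : ℕ) < k
    · rw [hι1 _ _ h, Pi.single_apply, if_neg]
      intro h2
      rw [h2] at h; simp at h
    · rw [hι2 _ _ h]
      simp only [Pi.single_apply, Fin.ext_iff]
      congr 1
      simp only [eq_iff_iff]; omega
  have hinv : ∀ x : Fin m → ℂ, ∀ l : Fin m, k ≤ (l : ℕ) → x l = ι (π x) l := by
    intro x l hl
    rw [hι2 _ _ (by omega), hπ]
    congr 1; ext; simp; omega
  let σ : Fin (p - k) ⊕ Fin k ≃ Fin p := finSumFinEquiv.trans (finCongr (by omega))
  have hσl : ∀ i : Fin (p - k), σ (Sum.inl i) = ⟨(i : ℕ), by have := i.isLt; omega⟩ := by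
    intro i; ext; simp [σ]
  have hσr : ∀ l : Fin k, σ (Sum.inr l) = ⟨p - k + (l : ℕ), by have := l.isLt; omega⟩ := by
    intro l; ext; simp [σ]
  have hFι : ∀ j, (fun z => F j (embLast m k z)) = fun z => F j (ι z) := by
    intro j; funext z; rw [hι]
  simp only [hFι] at hklow hG
  obtain ⟨V, W, hV, hVU, hV0, hW, hW0, φ, ψ, hφ, hψ, hm1, hm2, hl, hr, him, hφ0, f, hf, hdet, hfirst, hconj⟩ :=
    GeoLin.final_abs (q := q) (r := p - k) π ι ρ J hπι hπJ hρι hρJ hid (by omega) U hUopen hU0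
      (fun i => X (σ (Sum.inl i))) F (fun i => hXan _) hFan
      (fun i j x hx => sub_eq_zero.1 (hcomm _ _ x hx)) (fun i j x hx => hFint _ j x hx)
      (fun i x => hXinv _ _ _ (hinv x)) (fun j x => hFinv _ _ _ (hinv x))
      (fun i => by beta_reduce; rw [hσl]; exact hfix i) A
      (fun i v => by
        beta_reduce
        rw [hσl]
        funext s
        have h1 : v = ∑ t, v t • (Pi.single t 1 : Fin (m - k) → ℂ) := by
          funext t; simp [Finset.sum_apply, Pi.single_apply]
        rw [hπ]
        conv_lhs => rw [h1]
        simp only [map_sum, map_smul, hιs]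
        rw [Finset.sum_apply]
        simp only [Matrix.mulVec, dotProduct, hA, Pi.smul_apply, smul_eq_mul]
        exact Finset.sum_congr rfl fun t _ => mul_comm _ _)
      hss hAind kk G hklow hG hGind
  have hY : ∀ l y, modelYhat m k p hpm A (σ l) y = GeoLin.YS π ι J A l y := by
    intro l y
    rcases l with l | l
    · rw [hσl]
      show _ = ι ((A l).mulVec (π y))
      funext t
      have hlt : (l : ℕ) < p - k := l.isLt
      simp only [modelYhat, hlt, dif_pos]
      by_cases h : (t : ℕ) < k
      · rw [hι1 _ _ h]; simp [h]
      · rw [hι2 _ _ h]; simp only [h, dif_neg, not_false_iff]; rfl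
    · rw [hσr]
      show _ = J (Pi.single l 1)
      rw [hJs]
      have hlt : ¬ (p - k + (l : ℕ) < p - k) := by omega
      simp only [modelYhat, hlt, dif_neg, not_false_iff]
      congr 1; ext; simp
  have hXs : ∀ l x, X (σ l) x = GeoLin.XS J (fun i => X (σ (Sum.inl i))) l x := by
    intro l x
    rcases l with l | l
    · rfl
    · rw [hσr, hconst]
      exact (hJs l).symm
  refine ⟨V, W, hV, hVU, hV0, hW, hW0, φ, ψ, hφ, hψ, hm1, hm2, hl, hr, him, hφ0,
    fun i j => f (σ.symm i) (σ.symm j), fun i j => hf _ _, ?_, ?_, ?_⟩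
  · intro y hy
    have h1 := hdet y hy
    have h2 : (Matrix.of fun i j => f (σ.symm i) (σ.symm j) y) =
        (Matrix.of fun i j => f i j y).submatrix σ.symm σ.symm := rfl
    rw [h2, Matrix.det_submatrix_equiv_self]
    exact h1
  · intro i j l y hy
    obtain ⟨l, rfl⟩ := σ.surjective l
    rw [hY]
    exact hfirst _ _ l y hy
  · intro i x hx
    obtain ⟨i, rfl⟩ := σ.surjective i
    rw [hXs, hconj i x hx, ← σ.sum_comp]
    simp only [hY, Equiv.symm_apply_apply]
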